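/- arXiv:1407.4174 — 4 statements merged into one kernel-verified Lean document; each statement's English description precedes it below -/
import Mathlib

section
/- Let G be a countable abelian group and let A, B ⊆ G. Then for all integers 0 < j < k one has d*(A^j B) ≥ d*(A^k)^{j/k} · d*(B)^{1 - j/k}. -/
open Filter MeasureTheory Pointwise

variable {G : Type*}

/-- A Følner sequence: a sequence of nonempty finite subsets `F n` of `G` such that
`|F n ∩ g • F n| / |F n| → 1` for every `g ∈ G`. -/
def IsFolner [Group G] (F : ℕ → Finset G) : Prop :=
  (∀ n, (F n).Nonempty) ∧
    ∀ g : G, Filter.Tendsto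
      (fun n => ((((F n : Set G)) ∩ (g • (F n : Set G))).ncard : ℝ) / (F n).card)
      Filter.atTop (nhds 1)

/-- The upper Banach density of `A ⊆ G`: the supremum over Følner sequences of the
limsup of `|F n ∩ A| / |F n|`. -/
noncomputable def upperBanachDensity [Group G] (A : Set G) : ℝ :=
  sSup {d : ℝ | ∃ F : ℕ → Finset G, IsFolner F ∧
    d = Filter.limsup (fun n => (((F n : Set G) ∩ A).ncard : ℝ) / (F n).card) Filter.atTop}

/-- The lower Banach density of `A ⊆ G`: the infimum over Følner sequences of the
liminf of `|F n ∩ A| / |F n|`. -/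
noncomputable def lowerBanachDensity [Group G] (A : Set G) : ℝ :=
  sInf {d : ℝ | ∃ F : ℕ → Finset G, IsFolner F ∧
    d = Filter.liminf (fun n => (((F n : Set G) ∩ A).ncard : ℝ) / (F n).card) Filter.atTop}

section FinitePart

open Finset

theorem PB_sum_layer {X : Type*} (s : Finset X) (d : X → ℕ) (N : ℕ) (hN : ∀ x ∈ s, d x ≤ N) :
    ∑ x ∈ s, d x = ∑ t ∈ range N, #{x ∈ s | t < d x} := by
  classical
  simp_rw [card_filter]
  rw [sum_comm]
  refine sum_congr rfl fun x hx => ?_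
  rw [← card_filter]
  have : {t ∈ range N | t < d x} = range (d x) := by
    ext t; have := hN x hx; simp; omega
  rw [this, card_range]

/-- The double counting lemma. -/
theorem PB_count {X : Type*} [DecidableEq X] (U S W : Finset X) (r : X → X → Prop)
    [DecidableRel r] (μ : ℝ)
    (h1 : ∀ Z ⊆ S, (#Z : ℝ) ≤ μ * #{u ∈ U | ∃ v ∈ Z, r u v})
    (h2 : ∀ Z ⊆ S, μ * (#Z : ℝ) ≤ #{w ∈ W | ∃ v ∈ Z, r v w})
    (c1 : ∀ u ∈ U, ∀ v ∈ S, r u v → #{w ∈ W | r v w} ≤ #{v' ∈ S | r u v'})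
    (c2 : ∀ v ∈ S, ∀ w ∈ W, r v w → #{u ∈ U | r u v} ≤ #{v' ∈ S | r v' w}) (hμ : 0 < μ) :
    μ * #{u ∈ U | ∃ v ∈ S, r u v} ≤ #S := by
  set N := #U + #S + #W + 1 with hN
  have E1 : ∑ u ∈ U, #{v ∈ S | r u v} = ∑ v ∈ S, #{u ∈ U | r u v} :=
    sum_card_bipartiteAbove_eq_sum_card_bipartiteBelow r
  have E2 : ∑ v ∈ S, #{w ∈ W | r v w} = ∑ w ∈ W, #{v ∈ S | r v w} :=
    sum_card_bipartiteAbove_eq_sum_card_bipartiteBelow r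
  rw [PB_sum_layer U _ N (fun x _ => (card_filter_le _ _).trans (by omega)),
    PB_sum_layer S _ N (fun x _ => (card_filter_le _ _).trans (by omega))] at E1
  rw [PB_sum_layer S _ N (fun x _ => (card_filter_le _ _).trans (by omega)),
    PB_sum_layer W _ N (fun x _ => (card_filter_le _ _).trans (by omega))] at E2
  have I1 : ∀ t, (#{v ∈ S | t < #{w ∈ W | r v w}} : ℝ) ≤ μ * #{u ∈ U | t < #{v ∈ S | r u v}} := by
    intro t
    refine (h1 _ (filter_subset _ _)).trans ?_
    gcongr with u hu
    rintro ⟨v, hv, huv⟩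
    rw [mem_filter] at hv
    exact hv.2.trans_le (c1 u hu v hv.1 huv)
  have I2 : ∀ t, μ * (#{v ∈ S | t < #{u ∈ U | r u v}} : ℝ) ≤ #{w ∈ W | t < #{v ∈ S | r v w}} := by
    intro t
    refine (h2 _ (filter_subset _ _)).trans ?_
    gcongr with w hw
    rintro ⟨v, hv, hvw⟩
    rw [mem_filter] at hv
    exact hv.2.trans_le (c2 v hv.1 w hw hvw)
  have J2 : μ * ∑ t ∈ range N, (#{v ∈ S | t < #{u ∈ U | r u v}} : ℝ)
      ≤ ∑ t ∈ range N, (#{w ∈ W | t < #{v ∈ S | r v w}} : ℝ) := by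
    rw [mul_sum]; exact sum_le_sum fun t _ => I2 t
  have E1' : ∑ t ∈ range N, (#{u ∈ U | t < #{v ∈ S | r u v}} : ℝ)
    = ∑ t ∈ range N, (#{v ∈ S | t < #{u ∈ U | r u v}} : ℝ) := by exact_mod_cast E1
  have E2' : ∑ t ∈ range N, (#{v ∈ S | t < #{w ∈ W | r v w}} : ℝ)
    = ∑ t ∈ range N, (#{w ∈ W | t < #{v ∈ S | r v w}} : ℝ) := by exact_mod_cast E2
  have key : μ * #{u ∈ U | 0 < #{v ∈ S | r u v}} ≤ #{v ∈ S | 0 < #{w ∈ W | r v w}} := by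
    by_contra! hlt
    have : ∑ t ∈ range N, (#{v ∈ S | t < #{w ∈ W | r v w}} : ℝ)
        < ∑ t ∈ range N, μ * (#{u ∈ U | t < #{v ∈ S | r u v}} : ℝ) :=
      sum_lt_sum (fun t _ => I1 t) ⟨0, by simp [hN], hlt⟩
    rw [← mul_sum, E1'] at this
    linarith
  have e : {u ∈ U | ∃ v ∈ S, r u v} = {u ∈ U | 0 < #{v ∈ S | r u v}} := by
    ext u; simp [card_pos, Finset.Nonempty]
  rw [e]
  refine key.trans ?_
  exact_mod_cast card_filter_le _ _

variable {H : Type*} [CommGroup H] [DecidableEq H]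

/-- The separating set attached to a family `R`. -/
def PBcut (A B : Finset H) (R : ℕ → Finset H) : ℕ → Finset H
  | 0 => B \ R 0
  | (i + 1) => (R i * A) \ R (i + 1)

noncomputable def PBwt (A B : Finset H) (ν : ℝ) (h : ℕ) (R : ℕ → Finset H) : ℝ :=
  ∑ i ∈ range (h + 1), ν ^ i * #(PBcut A B R i)

def PBadm (A B : Finset H) (h : ℕ) (R : ℕ → Finset H) : Prop :=
  ∀ i, R i ⊆ if i < h then B * A ^ i else ∅

theorem PB_finite (A B : Finset H) (h : ℕ) : {R | PBadm A B h R}.Finite := by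
  let T : Fin h → Finset (Finset H) := fun i => (B * A ^ (i : ℕ)).powerset
  refine ((Fintype.piFinset T).finite_toSet.image
    (fun R i => if hi : i < h then R ⟨i, hi⟩ else ∅)).subset ?_
  intro R hR
  refine ⟨fun i => R i, ?_, ?_⟩
  · simp only [mem_coe, Fintype.mem_piFinset]
    intro i
    have := hR i
    simpa [T, i.2] using this
  · funext i
    have := hR i
    by_cases hi : i < h
    · simp [hi]
    · simp [hi] at this
      simp [hi, this]

theorem PB_wt_le (A B : Finset H) (ν : ℝ) (hν : 0 < ν) (h : ℕ) (R R' : ℕ → Finset H)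
    (p q : ℕ) (x y : ℕ) (hp : p ≤ h) (hq : q ≤ h)
    (hc : ∀ i, #(PBcut A B R' i) + (if i = q then y else 0) ≤
      #(PBcut A B R i) + (if i = p then x else 0)) :
    PBwt A B ν h R' + ν ^ q * y ≤ PBwt A B ν h R + ν ^ p * x := by
  have e : ∀ (p x : ℕ), p ≤ h → ν ^ p * (x : ℝ) =
      ∑ i ∈ range (h + 1), ν ^ i * ((if i = p then x else 0 : ℕ) : ℝ) := by
    intro p x hp
    rw [sum_eq_single p]
    · simp
    · intro b _ hb; simp [hb]
    · intro hh; simp at hh; omega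
  rw [e q y hq, e p x hp, PBwt, PBwt, ← sum_add_distrib, ← sum_add_distrib]
  refine sum_le_sum fun i _ => ?_
  rw [← mul_add, ← mul_add]
  refine mul_le_mul_of_nonneg_left ?_ (by positivity)
  exact_mod_cast hc i

/-- predecessors -/
def PBpre (A U Z : Finset H) : Finset H := {u ∈ U | ∃ v ∈ Z, ∃ a ∈ A, v = u * a}

theorem PB_down (A B : Finset H) (h : ℕ) (R : ℕ → Finset H) (m : ℕ) (Z : Finset H)
    (hZ : Z ⊆ PBcut A B R (m + 1)) (i : ℕ) :
    #(PBcut A B (Function.update R m (R m \ PBpre A (R m) Z)) i) +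
      (if i = m + 1 then #Z else 0) ≤
      #(PBcut A B R i) + (if i = m then #(PBpre A (R m) Z) else 0) := by
  set N := PBpre A (R m) Z
  rcases eq_or_ne i m with rfl | him
  · have : PBcut A B (Function.update R i (R i \ N)) i ⊆ PBcut A B R i ∪ N := by
      cases i with
      | zero => intro x; simp [PBcut]; tauto
      | succ i => intro x; simp [PBcut]; tauto
    have := (card_le_card this).trans (card_union_le _ _)
    simpa using this
  rcases eq_or_ne i (m + 1) with rfl | him'
  · have : PBcut A B (Function.update R m (R m \ N)) (m + 1) ⊆ PBcut A B R (m + 1) \ Z := by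
      intro x
      simp only [PBcut, Function.update_self, Finset.mem_sdiff, Finset.mem_mul]
      rw [Function.update_of_ne (by omega)]
      rintro ⟨⟨u, ⟨hu, huN⟩, a, ha, rfl⟩, hx⟩
      refine ⟨⟨⟨u, hu, a, ha, rfl⟩, hx⟩, fun hz => huN ?_⟩
      simp only [N, PBpre, mem_filter]
      exact ⟨hu, _, hz, a, ha, rfl⟩
    have := card_le_card this
    rw [card_sdiff_of_subset hZ] at this
    have := card_le_card hZ
    simp; omega
  · have : PBcut A B (Function.update R m (R m \ N)) i = PBcut A B R i := by
      cases i with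
      | zero => simp [PBcut, Function.update_of_ne him]
      | succ i =>
        simp only [PBcut]
        rw [Function.update_of_ne him, Function.update_of_ne (by omega)]
    simp [this, him, him']

theorem PB_up (A B : Finset H) (h : ℕ) (R : ℕ → Finset H) (m : ℕ) (Z : Finset H)
    (hZ : Z ⊆ PBcut A B R (m + 1)) (i : ℕ) :
    #(PBcut A B (Function.update R (m + 1) (R (m + 1) ∪ Z)) i) +
      (if i = m + 1 then #Z else 0) ≤
      #(PBcut A B R i) +
        (if i = m + 2 then #((Z * A) \ (R (m + 2) ∪ R (m + 1) * A)) else 0) := by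
  set N := (Z * A) \ (R (m + 2) ∪ R (m + 1) * A)
  rcases eq_or_ne i (m + 1) with rfl | him
  · have : PBcut A B (Function.update R (m + 1) (R (m + 1) ∪ Z)) (m + 1) ⊆
        PBcut A B R (m + 1) \ Z := by
      intro x
      simp [PBcut]
      tauto
    have := card_le_card this
    rw [card_sdiff_of_subset hZ] at this
    have := card_le_card hZ
    simp; omega
  rcases eq_or_ne i (m + 2) with rfl | him'
  · have : PBcut A B (Function.update R (m + 1) (R (m + 1) ∪ Z)) (m + 2) ⊆
        PBcut A B R (m + 2) ∪ N := by
      intro x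
      simp only [PBcut, Function.update_self, Finset.mem_sdiff, Finset.mem_union, union_mul, N]
      rw [Function.update_of_ne (by omega)]
      tauto
    have := (card_le_card this).trans (card_union_le _ _)
    simpa using this
  · have : PBcut A B (Function.update R (m + 1) (R (m + 1) ∪ Z)) i = PBcut A B R i := by
      cases i with
      | zero => simp [PBcut]
      | succ i =>
        simp only [PBcut]
        rw [Function.update_of_ne him, Function.update_of_ne (by omega)]
    simp [this, him, him']

theorem PB_step (A B : Finset H) (μ : ℝ) (hμ : 0 < μ) (h : ℕ) (R : ℕ → Finset H)
    (hR : PBadm A B h R) (hmin : ∀ R', PBadm A B h R' → PBwt A B μ⁻¹ h R ≤ PBwt A B μ⁻¹ h R')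
    (m : ℕ) (hm : m + 1 < h) :
    ∃ R₁, PBadm A B h R₁ ∧ PBwt A B μ⁻¹ h R₁ ≤ PBwt A B μ⁻¹ h R ∧
      PBcut A B R₁ (m + 1) = ∅ ∧ ∀ i, m + 1 < i → PBcut A B R₁ i = PBcut A B R i := by
  have hν : 0 < μ⁻¹ := by positivity
  have adm_down : ∀ Z, PBadm A B h (Function.update R m (R m \ Z)) := by
    intro Z i
    rcases eq_or_ne i m with rfl | hi
    · rw [Function.update_self]; exact sdiff_subset.trans (hR i)
    · rw [Function.update_of_ne hi]; exact hR i
  have adm_up : ∀ Z ⊆ PBcut A B R (m + 1),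
      PBadm A B h (Function.update R (m + 1) (R (m + 1) ∪ Z)) := by
    intro Z hZ i
    rcases eq_or_ne i (m + 1) with rfl | hi
    · rw [Function.update_self]
      refine union_subset (hR _) (hZ.trans ?_)
      have := hR m
      rw [if_pos (by omega)] at this
      rw [if_pos (by omega), pow_succ, ← mul_assoc]
      exact sdiff_subset.trans (mul_subset_mul_right this)
    · rw [Function.update_of_ne hi]; exact hR i
  set S := PBcut A B R (m + 1) with hS
  set W := (S * A) \ (R (m + 2) ∪ R (m + 1) * A) with hW
  let r : H → H → Prop := fun u v => ∃ a ∈ A, v = u * a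
  classical
  have key := PB_count (R m) S W r μ ?_ ?_ ?_ ?_ hμ
  · change μ * (#(PBpre A (R m) S) : ℝ) ≤ #S at key
    refine ⟨_, adm_down (PBpre A (R m) S), ?_, ?_, ?_⟩
    · have := PB_wt_le A B μ⁻¹ hν h R _ m (m + 1) _ _ (by omega) (by omega)
        (PB_down A B h R m S subset_rfl)
      have h3 : μ⁻¹ ^ m * (#(PBpre A (R m) S) : ℝ) ≤ μ⁻¹ ^ (m + 1) * #S := by
        rw [pow_succ, mul_assoc]
        gcongr
        rw [inv_mul_eq_div, le_div_iff₀ hμ]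
        linarith
      linarith
    · have := PB_down A B h R m S subset_rfl (m + 1)
      simp at this
      rw [← hS] at this
      rw [← card_eq_zero]
      omega
    · intro i hi
      cases i with
      | zero => omega
      | succ i =>
        simp only [PBcut]
        rw [Function.update_of_ne (by omega), Function.update_of_ne (by omega)]
  · intro Z hZ
    change _ ≤ μ * (#(PBpre A (R m) Z) : ℝ)
    have h1 := PB_wt_le A B μ⁻¹ hν h R _ m (m + 1) _ _ (by omega) (by omega)
        (PB_down A B h R m Z hZ)
    have h2 := hmin _ (adm_down (PBpre A (R m) Z))
    have h3 : μ⁻¹ ^ (m + 1) * (#Z : ℝ) ≤ μ⁻¹ ^ m * #(PBpre A (R m) Z) := by linarith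
    rw [pow_succ, mul_assoc] at h3
    have h4 := le_of_mul_le_mul_left h3 (by positivity)
    rwa [inv_mul_eq_div, div_le_iff₀' hμ] at h4
  · intro Z hZ
    have h1 := PB_wt_le A B μ⁻¹ hν h R _ (m + 2) (m + 1) _ _ (by omega) (by omega)
        (PB_up A B h R m Z hZ)
    have h2 := hmin _ (adm_up Z hZ)
    have h3 : μ⁻¹ ^ (m + 1) * (#Z : ℝ) ≤
      μ⁻¹ ^ (m + 2) * #((Z * A) \ (R (m + 2) ∪ R (m + 1) * A)) := by linarith
    rw [pow_succ _ (m + 1), mul_assoc] at h3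
    have h4 := le_of_mul_le_mul_left h3 (by positivity)
    rw [inv_mul_eq_div, le_div_iff₀' hμ] at h4
    refine h4.trans ?_
    norm_cast
    apply card_le_card
    intro x hx
    rw [Finset.mem_sdiff, Finset.mem_mul] at hx
    obtain ⟨⟨v, hv, a, ha, rfl⟩, hx⟩ := hx
    rw [mem_filter, hW, Finset.mem_sdiff]
    exact ⟨⟨mul_mem_mul (hZ hv) ha, hx⟩, v, hv, a, ha, rfl⟩
  · rintro u hu v hv ⟨a, ha, rfl⟩
    apply card_le_card_of_injOn (fun w => w * a⁻¹)
    · intro w hw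
      rw [mem_coe, mem_filter] at hw
      obtain ⟨hw, b, hb, rfl⟩ := hw
      rw [hW, Finset.mem_sdiff, Finset.mem_union, not_or] at hw
      have e : u * a * b * a⁻¹ = u * b := by rw [mul_right_comm u a b]; simp
      simp only [mem_coe, mem_filter]
      rw [e]
      refine ⟨?_, b, hb, rfl⟩
      rw [hS, PBcut, Finset.mem_sdiff]
      refine ⟨mul_mem_mul hu hb, fun hh => hw.2.2 ?_⟩
      rw [mul_right_comm]
      exact mul_mem_mul hh ha
    · intro x _ y _ hxy; simpa using hxy
  · rintro v hv w hw ⟨b, hb, rfl⟩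
    apply card_le_card_of_injOn (fun u => u * b)
    · intro u hu
      rw [mem_coe, mem_filter] at hu
      obtain ⟨hu, a, ha, rfl⟩ := hu
      rw [hW, Finset.mem_sdiff, Finset.mem_union, not_or] at hw
      simp only [mem_coe, mem_filter]
      refine ⟨?_, a, ha, mul_right_comm _ _ _⟩
      rw [hS, PBcut, Finset.mem_sdiff]
      refine ⟨mul_mem_mul hu hb, fun hh => hw.2.2 ?_⟩
      rw [mul_right_comm]
      exact mul_mem_mul hh ha
    · intro x _ y _ hxy; simpa using hxy

theorem PB_wt_lower (A B : Finset H) (μ : ℝ) (hμ : 0 < μ) (h : ℕ) (hh : 0 < h)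
    (hB : ∀ Z ⊆ B, μ ^ h * #Z ≤ #(Z * A ^ h))
    (R' : ℕ → Finset H) (hR' : PBadm A B h R') : (#B : ℝ) ≤ PBwt A B μ⁻¹ h R' := by
  obtain ⟨R₀, hR₀, hmin₀⟩ := Set.exists_min_image _ (PBwt A B μ⁻¹ h) (PB_finite A B h) ⟨R', hR'⟩
  have claim : ∀ n, n < h → ∃ R, PBadm A B h R ∧ PBwt A B μ⁻¹ h R ≤ PBwt A B μ⁻¹ h R₀ ∧
      ∀ i, h - n ≤ i → i < h → PBcut A B R i = ∅ := by
    intro n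
    induction n with
    | zero => intro _; exact ⟨R₀, hR₀, le_rfl, fun i h1 h2 => by omega⟩
    | succ n ih =>
      intro hn
      obtain ⟨R, h1, h2, h3⟩ := ih (by omega)
      obtain ⟨R₁, k1, k2, k3, k4⟩ := PB_step A B μ hμ h R h1
        (fun R'' hR'' => h2.trans (hmin₀ R'' hR'')) (h - n - 2) (by omega)
      refine ⟨R₁, k1, k2.trans h2, fun i hi hi' => ?_⟩
      rcases eq_or_ne i (h - n - 2 + 1) with rfl | hne
      · exact k3
      · rw [k4 i (by omega)]
        exact h3 i (by omega) hi'
  obtain ⟨R, h1, h2, h3⟩ := claim (h - 1) (by omega)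
  refine le_trans ?_ (h2.trans (hmin₀ R' hR'))
  have hsub : ∀ i, i < h → R 0 * A ^ i ⊆ R i := by
    intro i
    induction i with
    | zero => simp
    | succ i ih =>
      intro hi
      have := h3 (i + 1) (by omega) hi
      rw [PBcut, sdiff_eq_empty_iff_subset] at this
      rw [pow_succ, ← mul_assoc]
      exact (mul_subset_mul_right (ih (by omega))).trans this
  have hR0 : R 0 ⊆ B := by simpa [hh] using h1 0
  have hRh : R h = ∅ := by simpa using h1 h
  have htop : R 0 * A ^ h ⊆ PBcut A B R h := by
    obtain ⟨g, rfl⟩ : ∃ g, h = g + 1 := ⟨h - 1, by omega⟩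
    rw [PBcut, hRh, sdiff_empty, pow_succ, ← mul_assoc]
    exact mul_subset_mul_right (hsub g (by omega))
  have hw : (#(PBcut A B R 0) : ℝ) + μ⁻¹ ^ h * #(PBcut A B R h) ≤ PBwt A B μ⁻¹ h R := by
    have : ∑ i ∈ ({0, h} : Finset ℕ), μ⁻¹ ^ i * (#(PBcut A B R i) : ℝ) ≤ PBwt A B μ⁻¹ h R := by
      refine sum_le_sum_of_subset_of_nonneg ?_ fun i _ _ => by positivity
      intro i; simp; omega
    rw [sum_pair (by omega)] at this
    simpa using this
  have e1 : (#(PBcut A B R 0) : ℝ) = #B - #(R 0) := by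
    rw [PBcut, cast_card_sdiff hR0]
  have e2 : (#(R 0) : ℝ) ≤ μ⁻¹ ^ h * #(PBcut A B R h) := by
    have : (#(R 0 * A ^ h) : ℝ) ≤ #(PBcut A B R h) := by exact_mod_cast card_le_card htop
    rw [inv_pow, inv_mul_eq_div, le_div_iff₀' (by positivity)]
    exact (hB _ hR0).trans this
  linarith

/-- Plünnecke's inequality for magnification ratios. -/
theorem PB_plunnecke (A B : Finset H) (μ : ℝ) (hμ : 0 < μ) (h j : ℕ) (hj : 0 < j) (hjh : j ≤ h)
    (hB : ∀ Z ⊆ B, μ ^ h * #Z ≤ #(Z * A ^ h)) : μ ^ j * #B ≤ #(B * A ^ j) := by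
  let R : ℕ → Finset H := fun i => if i < j then B * A ^ i else ∅
  have hR : PBadm A B h R := by
    intro i
    by_cases hi : i < j
    · simp [R, hi, hi.trans_le hjh]
    · simp [R, hi]
  have hl := PB_wt_lower A B μ hμ h (by omega) hB R hR
  have hw : PBwt A B μ⁻¹ h R = μ⁻¹ ^ j * #(B * A ^ j) := by
    rw [PBwt, sum_eq_single j]
    · obtain ⟨g, rfl⟩ : ∃ g, j = g + 1 := ⟨j - 1, by omega⟩
      simp [PBcut, R, pow_succ, mul_assoc]
    · intro i _ hi
      cases i with
      | zero => simp [PBcut, R, hj]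
      | succ i =>
        rcases lt_or_gt_of_ne hi with hlt | hgt
        · simp [PBcut, R, hlt, (show i < j by omega), pow_succ, mul_assoc]
        · simp [PBcut, R, (show ¬ i < j by omega)]
    · intro hh; simp at hh; omega
  rw [hw, inv_pow, inv_mul_eq_div, le_div_iff₀' (by positivity)] at hl
  exact hl

end FinitePart

section DensityPart

open Finset

theorem PB_rat_le (F : Finset G) (A : Set G) : (((F : Set G) ∩ A).ncard : ℝ) / F.card ≤ 1 := by
  refine div_le_one_of_le₀ ?_ (by positivity)
  rw [← Set.ncard_coe_finset F]
  exact_mod_cast Set.ncard_le_ncard Set.inter_subset_left F.finite_toSet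

theorem PB_bdd (F : ℕ → Finset G) (A : Set G) :
    IsBoundedUnder (· ≤ ·) atTop (fun n => (((F n : Set G) ∩ A).ncard : ℝ) / (F n).card) :=
  isBoundedUnder_of ⟨1, fun n => PB_rat_le (F n) A⟩

theorem PB_cobdd (F : ℕ → Finset G) (A : Set G) :
    IsCoboundedUnder (· ≤ ·) atTop (fun n => (((F n : Set G) ∩ A).ncard : ℝ) / (F n).card) :=
  IsBoundedUnder.isCoboundedUnder_le (isBoundedUnder_of ⟨0, fun n => by positivity⟩)

theorem PB_limsup_le [Group G] (F : ℕ → Finset G) (hF : IsFolner F) (A : Set G) :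
    limsup (fun n => (((F n : Set G) ∩ A).ncard : ℝ) / (F n).card) atTop ≤
      upperBanachDensity A := by
  refine le_csSup ⟨1, ?_⟩ ⟨F, hF, rfl⟩
  rintro _ ⟨F', -, rfl⟩
  exact limsup_le_of_le (PB_cobdd F' A) (Eventually.of_forall fun n => PB_rat_le _ _)

theorem PB_nonneg [Group G] (A : Set G) : 0 ≤ upperBanachDensity A := by
  refine Real.sSup_nonneg ?_
  rintro _ ⟨F', -, rfl⟩
  exact le_limsup_of_frequently_le (Frequently.of_forall fun n => by positivity) (PB_bdd F' A)

theorem PB_exists [Group G] (A : Set G) (c : ℝ) (hc : 0 ≤ c) (h : c < upperBanachDensity A) :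
    ∃ F : ℕ → Finset G, IsFolner F ∧
      ∃ᶠ n in atTop, c * (F n).card < (((F n : Set G) ∩ A).ncard : ℝ) := by
  have hne : {d : ℝ | ∃ F : ℕ → Finset G, IsFolner F ∧
    d = Filter.limsup (fun n => (((F n : Set G) ∩ A).ncard : ℝ) / (F n).card)
      Filter.atTop}.Nonempty := by
    by_contra hcon
    rw [Set.not_nonempty_iff_eq_empty] at hcon
    rw [upperBanachDensity, hcon, Real.sSup_empty] at h
    linarith
  obtain ⟨_, ⟨F, hF, rfl⟩, hlt⟩ := exists_lt_of_lt_csSup hne h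
  refine ⟨F, hF, (frequently_lt_of_lt_limsup (PB_cobdd F A) hlt).mono fun n hn => ?_⟩
  rwa [lt_div_iff₀] at hn
  exact_mod_cast (hF.1 n).card_pos

theorem PB_eventually [Group G] (F : ℕ → Finset G) (hF : IsFolner F) (A : Set G) (c : ℝ)
    (h : upperBanachDensity A < c) :
    ∀ᶠ n in atTop, (((F n : Set G) ∩ A).ncard : ℝ) < c * (F n).card := by
  filter_upwards [eventually_lt_of_limsup_lt ((PB_limsup_le F hF A).trans_lt h) (PB_bdd F A)]
    with n hn
  rwa [div_lt_iff₀] at hn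
  exact_mod_cast (hF.1 n).card_pos

theorem PB_folner_inv [CommGroup G] [DecidableEq G] (F : ℕ → Finset G) (hF : IsFolner F)
    (g : ℕ → G) :
    IsFolner (fun n => (F n).image (fun x => g n * x⁻¹)) := by
  have hinj : ∀ n, Function.Injective (fun x : G => g n * x⁻¹) := by
    intro n x y hxy; simpa using hxy
  refine ⟨fun n => (hF.1 n).image _, fun a => ?_⟩
  refine (hF.2 a⁻¹).congr fun n => ?_
  rw [card_image_of_injective _ (hinj n), coe_image]
  congr 2
  rw [← Set.ncard_image_of_injective _ (hinj n), Set.image_inter (hinj n)]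
  congr 2
  ext x
  simp only [Set.mem_image, Set.mem_smul_set, smul_eq_mul, exists_exists_and_eq_and]
  constructor
  · rintro ⟨y, hy, rfl⟩
    exact ⟨y, hy, by simp [mul_left_comm, mul_comm]⟩
  · rintro ⟨y, hy, rfl⟩
    exact ⟨y, hy, by simp [mul_left_comm, mul_comm]⟩

theorem PB_uniform [CommGroup G] (F : ℕ → Finset G) (hF : IsFolner F) (B : Set G) (c : ℝ)
    (h : upperBanachDensity B < c) :
    ∀ᶠ n in atTop, ∀ g : G, (((F n : Set G) ∩ {x | g * x⁻¹ ∈ B}).ncard : ℝ) < c * (F n).card := by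
  classical
  let P : ℕ → G → Prop := fun n g =>
    (((F n : Set G) ∩ {x | g * x⁻¹ ∈ B}).ncard : ℝ) < c * (F n).card
  let g : ℕ → G := fun n => if hn : ∃ g, ¬ P n g then hn.choose else 1
  filter_upwards [PB_eventually _ (PB_folner_inv F hF g) B c h] with n hn
  by_contra! hcon
  have hcon' : ∃ g, ¬ P n g := by
    obtain ⟨g, hg⟩ := hcon
    exact ⟨g, not_lt.2 hg⟩
  have hg : ¬ P n (g n) := by
    simp only [g, dif_pos hcon']
    exact hcon'.choose_spec
  apply hg
  have hinj : Function.Injective (fun x : G => g n * x⁻¹) := by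
    intro x y hxy; simpa using hxy
  rw [card_image_of_injective _ hinj, coe_image] at hn
  rw [← Set.image_inter_preimage, Set.ncard_image_of_injective _ hinj] at hn
  exact hn

theorem PB_boundary [CommGroup G] [DecidableEq G] (E : ℕ → Finset G) (hE : IsFolner E)
    (C : Finset G) (ε : ℝ) (hε : 0 < ε) :
    ∀ᶠ n in atTop, (#((E n * C) \ E n) : ℝ) < ε * #(E n) := by
  have ht : Tendsto (fun n => ∑ c ∈ C,
      (1 - ((((E n : Set G)) ∩ (c • (E n : Set G))).ncard : ℝ) / (E n).card)) atTop
      (nhds (∑ c ∈ C, (1 - 1))) :=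
    tendsto_finset_sum _ fun c _ => tendsto_const_nhds.sub (hE.2 c)
  simp only [sub_self, sum_const_zero] at ht
  filter_upwards [ht.eventually_lt_const hε] with n hn
  have hpos : (0 : ℝ) < #(E n) := by exact_mod_cast (hE.1 n).card_pos
  rw [← div_lt_iff₀ hpos]
  refine lt_of_le_of_lt ?_ hn
  rw [div_le_iff₀ hpos, sum_mul]
  have hsub : (E n * C) \ E n ⊆ C.biUnion fun c => (c • E n) \ E n := by
    intro x hx
    rw [Finset.mem_sdiff, Finset.mem_mul] at hx
    obtain ⟨⟨e, he, c, hc, rfl⟩, hx⟩ := hx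
    rw [mem_biUnion]
    refine ⟨c, hc, Finset.mem_sdiff.2 ⟨?_, hx⟩⟩
    rw [mul_comm]
    exact smul_mem_smul_finset he
  have h1 : (#((E n * C) \ E n) : ℝ) ≤ ∑ c ∈ C, (#((c • E n) \ E n) : ℝ) := by
    exact_mod_cast (card_le_card hsub).trans card_biUnion_le
  refine h1.trans (sum_le_sum fun c _ => ?_)
  rw [sub_mul, div_mul_cancel₀ _ hpos.ne', one_mul]
  have h2 : (((E n : Set G)) ∩ (c • (E n : Set G))).ncard = #(E n ∩ c • E n) := by
    rw [← Set.ncard_coe_finset]; push_cast; rfl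
  rw [h2]
  have h3 : #((c • E n) \ E n) + #(E n ∩ c • E n) = #(c • E n) := by
    rw [inter_comm]; exact card_sdiff_add_card_inter _ _
  rw [card_smul_finset] at h3
  have : (#((c • E n) \ E n) : ℝ) + #(E n ∩ c • E n) = #(E n) := by exact_mod_cast h3
  linarith

theorem PB_fin_pow [CommGroup G] [DecidableEq G] (A : Set G) (k : ℕ) :
    ∀ T : Finset G, (T : Set G) ⊆ A ^ k → ∃ A' : Finset G, (A' : Set G) ⊆ A ∧ T ⊆ A' ^ k := by
  induction k with
  | zero =>
    intro T hT
    refine ⟨∅, by simp, ?_⟩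
    rw [pow_zero] at hT ⊢
    exact_mod_cast hT
  | succ k ih =>
    intro T hT
    rw [pow_succ] at hT
    obtain ⟨T1, T2, h1, h2, h3⟩ := Finset.subset_mul hT
    obtain ⟨A1, hA1, hT1⟩ := ih T1 h1
    refine ⟨A1 ∪ T2, by simp [hA1, h2], h3.trans ?_⟩
    rw [pow_succ]
    exact Finset.mul_subset_mul (hT1.trans (Finset.pow_subset_pow_left subset_union_left))
      subset_union_right

theorem PB_cover [CommGroup G] [DecidableEq G] (B : Set G) (F Z C : Finset G) (b : ℝ)
    (hF : ∀ g : G, (((F : Set G) ∩ {x | g * x⁻¹ ∈ B}).ncard : ℝ) ≤ b)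
    (hZ : (Z : Set G) ⊆ B) (hC : C ⊆ F) : (#Z : ℝ) * #C ≤ #(Z * C) * b := by
  have h1 : #(Z ×ˢ C) = ∑ y ∈ Z * C, #{p ∈ Z ×ˢ C | p.1 * p.2 = y} := by
    refine card_eq_sum_card_fiberwise ?_
    intro p hp
    have := mem_product.1 (mem_coe.1 hp)
    exact mem_coe.2 (mul_mem_mul this.1 this.2)
  have h2 : (#Z : ℝ) * #C = ∑ y ∈ Z * C, (#{p ∈ Z ×ˢ C | p.1 * p.2 = y} : ℝ) := by
    rw [← Nat.cast_mul, ← card_product, h1, Nat.cast_sum]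
  rw [h2, ← nsmul_eq_mul]
  refine sum_le_card_nsmul _ _ _ fun y _ => le_trans ?_ (hF y)
  norm_cast
  rw [← Set.ncard_coe_finset]
  refine Set.ncard_le_ncard_of_injOn Prod.snd ?_ ?_ (F.finite_toSet.inter_of_left _)
  · rintro ⟨z, c⟩ hp
    simp only [mem_coe, mem_filter, mem_product] at hp
    obtain ⟨⟨hz, hc⟩, rfl⟩ := hp
    exact ⟨hC hc, by simpa using hZ hz⟩
  · rintro ⟨z, c⟩ hp ⟨z', c'⟩ hp' hcc
    simp only [mem_coe, mem_filter, mem_product] at hp hp' hcc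
    subst hcc
    have := hp.2.trans hp'.2.symm
    simpa using this

theorem PB_main [CommGroup G] (A B : Set G) (j k : ℕ) (hj : 0 < j) (hjk : j < k)
    (ε : ℝ) (hε : 0 < ε) (hα : ε < upperBanachDensity (A ^ k)) (hβ : ε < upperBanachDensity B) :
    ((upperBanachDensity (A ^ k) - ε) / (upperBanachDensity B + ε)) ^ ((j : ℝ) / k) *
      (upperBanachDensity B - ε) ≤ upperBanachDensity (A ^ j * B) + ε + ε := by
  classical
  set α := upperBanachDensity (A ^ k)
  set β := upperBanachDensity B
  set γ := upperBanachDensity (A ^ j * B)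
  obtain ⟨F, hF, hFA⟩ := PB_exists (A ^ k) (α - ε) (by linarith) (show _ < α by linarith)
  obtain ⟨n, hn1, hn2⟩ := (hFA.and_eventually
    (PB_uniform F hF B (β + ε) (show β < _ by linarith))).exists
  set C : Finset G := {x ∈ F n | x ∈ A ^ k} with hC
  have hCc : ((F n : Set G) ∩ A ^ k).ncard = #C := by
    rw [← Set.ncard_coe_finset]; congr 1; ext x; simp [hC]
  rw [hCc] at hn1
  have hFpos : (0 : ℝ) < #(F n) := by exact_mod_cast (hF.1 n).card_pos
  obtain ⟨A', hA', hCA'⟩ := PB_fin_pow A k C (by intro x; simp [hC])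
  obtain ⟨E, hE, hEB⟩ := PB_exists B (β - ε) (by linarith) (show _ < β by linarith)
  obtain ⟨m, hm1, hm2, hm3⟩ := (hEB.and_eventually
    ((PB_eventually E hE (A ^ j * B) (γ + ε) (show γ < _ by linarith)).and
    (PB_boundary E hE (A' ^ j) ε hε))).exists
  have hEpos : (0 : ℝ) < #(E m) := by exact_mod_cast (hE.1 m).card_pos
  set D : Finset G := {x ∈ E m | x ∈ B} with hD
  have hDc : ((E m : Set G) ∩ B).ncard = #D := by
    rw [← Set.ncard_coe_finset]; congr 1; ext x; simp [hD]
  rw [hDc] at hm1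
  set ρ := (α - ε) / (β + ε) with hρ
  have hρ0 : 0 < ρ := div_pos (by linarith) (by linarith)
  have hk : (k : ℝ) ≠ 0 := by
    have : k ≠ 0 := by omega
    exact_mod_cast this
  have hpl := PB_plunnecke A' D (ρ ^ (1 / (k : ℝ))) (by positivity) k j hj hjk.le ?_
  · rw [← Real.rpow_mul_natCast hρ0.le, one_div_mul_eq_div] at hpl
    have hsub : D * A' ^ j ⊆ {x ∈ E m | x ∈ A ^ j * B} ∪ (E m * A' ^ j) \ E m := by
      intro x hx
      rw [Finset.mem_mul] at hx
      obtain ⟨d, hd, a, ha, rfl⟩ := hx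
      rw [hD, mem_filter] at hd
      rw [Finset.mem_union, mem_filter, Finset.mem_sdiff]
      have h1 : d * a ∈ A ^ j * B := by
        rw [mul_comm d a]
        refine Set.mul_mem_mul ?_ hd.2
        have : (a : G) ∈ ((A' ^ j : Finset G) : Set G) := ha
        rw [Finset.coe_pow] at this
        exact Set.pow_subset_pow_left hA' this
      have h2 : d * a ∈ E m * A' ^ j := mul_mem_mul hd.1 ha
      tauto
    have hc := (card_le_card hsub).trans (card_union_le _ _)
    have hc' : (#(D * A' ^ j) : ℝ) ≤ #{x ∈ E m | x ∈ A ^ j * B} + #((E m * A' ^ j) \ E m) := by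
      exact_mod_cast hc
    have hEc : ((E m : Set G) ∩ (A ^ j * B)).ncard = #{x ∈ E m | x ∈ A ^ j * B} := by
      rw [← Set.ncard_coe_finset]; congr 1; ext x; simp
    rw [hEc] at hm2
    refine le_of_mul_le_mul_right ?_ hEpos
    have h3 : ρ ^ ((j : ℝ) / k) * ((β - ε) * #(E m)) ≤ ρ ^ ((j : ℝ) / k) * #D := by
      gcongr
    rw [← mul_assoc] at h3
    linarith
  · intro Z hZ
    rw [← Real.rpow_mul_natCast hρ0.le, one_div_mul_cancel hk, Real.rpow_one]
    have hZB : (Z : Set G) ⊆ B := by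
      intro x hx
      have := hZ hx
      rw [hD, mem_filter] at this
      exact this.2
    have hcov := PB_cover B (F n) Z C _ (fun g => (hn2 g).le) hZB (filter_subset _ _)
    have h1 : (#Z : ℝ) * ((α - ε) * #(F n)) ≤ #Z * #C := by gcongr
    have h2 : (#(Z * C) : ℝ) ≤ #(Z * A' ^ k) := by
      exact_mod_cast card_le_card (mul_subset_mul_left hCA')
    refine le_trans ?_ h2
    rw [hρ, div_mul_eq_mul_div, div_le_iff₀ (by linarith)]
    refine le_of_mul_le_mul_right ?_ hFpos
    linarith

end DensityPart

/-- For a countable abelian group `G` and `A, B ⊆ G`, for all integers `0 < j < k`,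
`d*(A^j B) ≥ d*(A^k)^(j/k) · d*(B)^(1 - j/k)`. -/
theorem upper_banach_density_plunnecke [CommGroup G] [Countable G]
    (A B : Set G) (j k : ℕ) (hj : 0 < j) (hjk : j < k) :
    upperBanachDensity (A ^ j * B) ≥
      upperBanachDensity (A ^ k) ^ ((j : ℝ) / k) *
        upperBanachDensity B ^ (1 - (j : ℝ) / k) := by
  have hj' : (0 : ℝ) < j := by exact_mod_cast hj
  have hjk' : (j : ℝ) < k := by exact_mod_cast hjk
  have hs : 0 < (j : ℝ) / k := div_pos hj' (hj'.trans hjk')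
  have hs1 : (j : ℝ) / k < 1 := (div_lt_one (hj'.trans hjk')).2 hjk'
  have hγ := PB_nonneg (A ^ j * B)
  rcases (PB_nonneg (A ^ k)).eq_or_lt with hα | hα
  · rw [← hα, Real.zero_rpow hs.ne', zero_mul]; exact hγ
  rcases (PB_nonneg B).eq_or_lt with hβ | hβ
  · rw [← hβ, Real.zero_rpow (by linarith), mul_zero]; exact hγ
  have main := PB_main A B j k hj hjk
  generalize upperBanachDensity (A ^ j * B) = γ at *
  generalize upperBanachDensity (A ^ k) = α at *
  generalize upperBanachDensity B = β at *
  generalize (j : ℝ) / k = s at *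
  have hc1 : ContinuousAt (fun ε : ℝ => ((α - ε) / (β + ε)) ^ s * (β - ε)) 0 := by
    refine ContinuousAt.mul (ContinuousAt.rpow_const (ContinuousAt.div (by fun_prop)
      (by fun_prop) (by simpa using hβ.ne')) (Or.inr hs.le)) (by fun_prop)
  have hc2 : ContinuousAt (fun ε : ℝ => γ + ε + ε) 0 := by fun_prop
  have hl : ((α - 0) / (β + 0)) ^ s * (β - 0) ≤ γ + 0 + 0 := by
    refine le_of_tendsto_of_tendsto (b := nhdsWithin 0 (Set.Ioi 0))
      (hc1.tendsto.mono_left nhdsWithin_le_nhds) (hc2.tendsto.mono_left nhdsWithin_le_nhds) ?_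
    filter_upwards [self_mem_nhdsWithin,
      mem_nhdsWithin_of_mem_nhds (Iio_mem_nhds hα),
      mem_nhdsWithin_of_mem_nhds (Iio_mem_nhds hβ)] with ε h1 h2 h3
    exact main ε h1 h2 h3
  simp only [sub_zero, add_zero] at hl
  refine le_trans (le_of_eq ?_) hl
  rw [Real.div_rpow hα.le hβ.le, Real.rpow_sub hβ, Real.rpow_one]
  ring
end

section
/- Let G be a countable abelian group and let A, B ⊆ G. Then for all integers 0 < j < k one has d_*(A^j B) ≥ d*(A^k)^{j/k} · d_*(B)^{1 - j/k}. -/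
open Filter MeasureTheory Pointwise

variable {G : Type*}

section PlunneckeFinite

open Classical in
theorem pl_hall {α β : Type*} (S : Finset α) (U : Finset β) (rel : α → β → Prop) (c : ℝ)
    (hc : ∀ T ⊆ S, c * (T.card : ℝ) ≤ ((U.filter (fun u => ∃ v ∈ T, rel v u)).card : ℝ))
    (f : α → ℕ) (g : β → ℕ) (hfg : ∀ v ∈ S, ∀ u ∈ U, rel v u → f v ≤ g u) :
    c * ∑ v ∈ S, (f v : ℝ) ≤ ∑ u ∈ U, (g u : ℝ) := by
  obtain ⟨M, hM1, hM2⟩ : ∃ M : ℕ, (∀ v ∈ S, f v ≤ M) ∧ (∀ u ∈ U, g u ≤ M) := by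
    refine ⟨∑ v ∈ S, f v + ∑ u ∈ U, g u, ?_, ?_⟩
    · intro v hv
      exact (Finset.single_le_sum (f := f) (fun _ _ => Nat.zero_le _) hv).trans (Nat.le_add_right _ _)
    · intro v hv
      exact (Finset.single_le_sum (f := g) (fun _ _ => Nat.zero_le _) hv).trans (Nat.le_add_left _ _)
  have key : ∀ (γ : Type _) (s : Finset γ) (e : γ → ℕ), (∀ x ∈ s, e x ≤ M) →
      ∑ x ∈ s, (e x : ℝ) = ∑ m ∈ Finset.range M, ((s.filter (fun x => m < e x)).card : ℝ) := by
    intro γ s e he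
    have : ∀ x ∈ s, (e x : ℝ) = ∑ m ∈ Finset.range M, if m < e x then (1:ℝ) else 0 := by
      intro x hx
      rw [Finset.sum_boole]
      congr 1
      have : (Finset.range M).filter (fun m => m < e x) = Finset.range (e x) := by
        ext m
        have := he x hx
        simp
        omega
      rw [this, Finset.card_range]
    rw [Finset.sum_congr rfl this, Finset.sum_comm]
    refine Finset.sum_congr rfl fun m _ => ?_
    rw [Finset.sum_boole]
  have key2 : ∀ (γ : Type _) (s : Finset γ) (e : γ → ℕ), (∀ x ∈ s, e x ≤ M) →
      ∑ x ∈ s, (e x : ℝ) = ∑ m ∈ Finset.range M, ((s.filter (fun x => m < e x)).card : ℝ) := by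
    intro γ s e he
    have : ∀ x ∈ s, (e x : ℝ) = ∑ m ∈ Finset.range M, if m < e x then (1:ℝ) else 0 := by
      intro x hx
      rw [Finset.sum_boole]
      congr 1
      have : (Finset.range M).filter (fun m => m < e x) = Finset.range (e x) := by
        ext m
        have := he x hx
        simp
        omega
      rw [this, Finset.card_range]
    rw [Finset.sum_congr rfl this, Finset.sum_comm]
    refine Finset.sum_congr rfl fun m _ => ?_
    rw [Finset.sum_boole]
  rw [key _ S f hM1, key2 _ U g hM2, Finset.mul_sum]
  refine Finset.sum_le_sum fun m _ => ?_
  refine (hc _ (Finset.filter_subset _ _)).trans ?_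
  norm_cast
  apply Finset.card_le_card
  intro u hu
  simp only [Finset.mem_filter] at hu ⊢
  obtain ⟨hu, v, ⟨hv, hm⟩, hr⟩ := hu
  exact ⟨hu, lt_of_lt_of_le hm (hfg v hv u hu hr)⟩

open Classical in
/-- double counting: edges by multiplication by elements of `A` -/
theorem pl_double {G : Type*} [CommGroup G] (A S U : Finset G) :
    ∑ u ∈ U, ((A.filter (fun a => a * u ∈ S)).card : ℝ) =
      ∑ v ∈ S, ((A.filter (fun a => a⁻¹ * v ∈ U)).card : ℝ) := by
  have h1 : ∀ u ∈ U, ((A.filter (fun a => a * u ∈ S)).card : ℝ) =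
      ∑ v ∈ S, if v * u⁻¹ ∈ A then (1:ℝ) else 0 := by
    intro u _
    rw [Finset.sum_boole]
    congr 1
    refine Finset.card_bij (fun a _ => a * u) ?_ ?_ ?_
    · intro a ha
      simp only [Finset.mem_filter] at ha ⊢
      simpa using ha.symm
    · intro a _ b _ h
      exact mul_right_cancel h
    · intro v hv
      simp only [Finset.mem_filter] at hv
      exact ⟨v * u⁻¹, by simpa using hv.symm, by simp⟩
  have h2 : ∀ v ∈ S, ((A.filter (fun a => a⁻¹ * v ∈ U)).card : ℝ) =
      ∑ u ∈ U, if v * u⁻¹ ∈ A then (1:ℝ) else 0 := by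
    intro v _
    rw [Finset.sum_boole]
    congr 1
    refine Finset.card_bij (fun a _ => a⁻¹ * v) ?_ ?_ ?_
    · intro a ha
      simp only [Finset.mem_filter] at ha ⊢
      simpa using ha.symm
    · intro a _ b _ h
      exact inv_injective (mul_right_cancel h)
    · intro u hu
      simp only [Finset.mem_filter] at hu
      refine ⟨v * u⁻¹, by simpa using hu.symm, by simp⟩
  rw [Finset.sum_congr rfl h1, Finset.sum_congr rfl h2, Finset.sum_comm]

open Classical in
theorem pl_local {G : Type*} [CommGroup G] (A U Ri N : Finset G) (hN : A * Ri ⊆ N) (μ : ℝ)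
    (hμ : 0 < μ)
    (hb : ∀ T ⊆ (A * U) \ Ri,
      μ * (T.card : ℝ) ≤ ((U.filter (fun u => ∃ a ∈ A, a * u ∈ T)).card : ℝ))
    (hf : ∀ T ⊆ (A * U) \ Ri, (T.card : ℝ) ≤ μ * (((A * T) \ N).card : ℝ)) :
    μ * (((A * ((A * U) \ Ri)) \ N).card : ℝ) ≤ (((A * U) \ Ri).card : ℝ) := by
  set S := (A * U) \ Ri with hS
  set W := (A * S) \ N with hW
  -- backward
  have hback : μ * ∑ v ∈ S, ((A.filter (fun a => a * v ∈ W)).card : ℝ) ≤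
      ∑ u ∈ U, ((A.filter (fun a => a * u ∈ S)).card : ℝ) := by
    refine pl_hall S U (fun v u => ∃ a ∈ A, a * u = v) μ ?_
      (fun v => (A.filter (fun a => a * v ∈ W)).card)
      (fun u => (A.filter (fun a => a * u ∈ S)).card) ?_
    · intro T hT
      refine (hb T hT).trans (le_of_eq ?_)
      congr 3
      ext u
      constructor
      · rintro ⟨a, ha, h⟩
        exact ⟨_, h, a, ha, rfl⟩
      · rintro ⟨v, hv, a, ha, rfl⟩
        exact ⟨a, ha, hv⟩
    · rintro v hv u hu ⟨a, ha, rfl⟩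
      apply Finset.card_le_card
      intro a' ha'
      simp only [Finset.mem_filter] at ha' ⊢
      refine ⟨ha'.1, Finset.mem_sdiff.2 ⟨Finset.mul_mem_mul ha'.1 hu, fun h => ?_⟩⟩
      apply (Finset.mem_sdiff.1 ha'.2).2
      apply hN
      rw [mul_left_comm]
      exact Finset.mul_mem_mul ha h
  have hfor : μ⁻¹ * ∑ v ∈ S, (((A.filter (fun a => a⁻¹ * v ∈ U)).card - 1 : ℕ) : ℝ) ≤
      ∑ w ∈ W, (((A.filter (fun a => a⁻¹ * w ∈ S)).card - 1 : ℕ) : ℝ) := by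
    refine pl_hall S W (fun v w => ∃ a ∈ A, a * v = w) μ⁻¹ ?_
      (fun v => (A.filter (fun a => a⁻¹ * v ∈ U)).card - 1)
      (fun w => (A.filter (fun a => a⁻¹ * w ∈ S)).card - 1) ?_
    · intro T hT
      have := hf T hT
      rw [inv_mul_le_iff₀ hμ]
      refine this.trans (le_of_eq ?_)
      congr 3
      ext w
      simp only [Finset.mem_sdiff, Finset.mem_mul, Finset.mem_filter, hW]
      constructor
      · rintro ⟨⟨a, ha, v, hv, rfl⟩, h⟩
        exact ⟨⟨⟨a, ha, v, hT hv, rfl⟩, h⟩, v, hv, a, ha, rfl⟩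
      · rintro ⟨⟨-, h⟩, v, hv, a, ha, rfl⟩
        exact ⟨⟨a, ha, v, hv, rfl⟩, h⟩
    · rintro v hv w hw ⟨a, ha, rfl⟩
      apply Nat.sub_le_sub_right
      apply Finset.card_le_card
      intro a' ha'
      simp only [Finset.mem_filter] at ha' ⊢
      refine ⟨ha'.1, Finset.mem_sdiff.2 ⟨?_, fun h => ?_⟩⟩
      · rw [mul_left_comm]
        exact Finset.mul_mem_mul ha ha'.2
      · apply (Finset.mem_sdiff.1 hw).2
        apply hN
        have := Finset.mul_mem_mul ha'.1 h
        simpa using this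
  have e1 : ∑ v ∈ S, (((A.filter (fun a => a⁻¹ * v ∈ U)).card - 1 : ℕ) : ℝ) =
      ∑ v ∈ S, ((A.filter (fun a => a⁻¹ * v ∈ U)).card : ℝ) - S.card := by
    rw [Finset.card_eq_sum_ones, Nat.cast_sum, ← Finset.sum_sub_distrib]
    refine Finset.sum_congr rfl fun v hv => ?_
    rw [Nat.cast_sub]
    apply Finset.card_pos.2
    obtain ⟨a, ha, u, hu, rfl⟩ := Finset.mem_mul.1 (Finset.mem_sdiff.1 hv).1
    exact ⟨a, by simp [ha, hu]⟩
  have e2 : ∑ w ∈ W, (((A.filter (fun a => a⁻¹ * w ∈ S)).card - 1 : ℕ) : ℝ) =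
      ∑ w ∈ W, ((A.filter (fun a => a⁻¹ * w ∈ S)).card : ℝ) - W.card := by
    rw [Finset.card_eq_sum_ones, Nat.cast_sum, ← Finset.sum_sub_distrib]
    refine Finset.sum_congr rfl fun v hv => ?_
    rw [Nat.cast_sub]
    apply Finset.card_pos.2
    obtain ⟨a, ha, u, hu, rfl⟩ := Finset.mem_mul.1 (Finset.mem_sdiff.1 hv).1
    exact ⟨a, by rw [Finset.mem_filter]; exact ⟨ha, by simpa using hu⟩⟩
  rw [e1, e2, inv_mul_le_iff₀ hμ, ← pl_double A W S] at hfor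
  rw [pl_double A S U] at hback
  linarith

end PlunneckeFinite

section PlunneckeGlobal

theorem pl_sum_diff (a b : ℕ → ℝ) (n p : ℕ) (hp : p + 1 < n)
    (hab : ∀ i, i ≠ p → i ≠ p + 1 → a i = b i) :
    ∑ i ∈ Finset.range n, a i - ∑ i ∈ Finset.range n, b i =
      (a p - b p) + (a (p + 1) - b (p + 1)) := by
  rw [← Finset.sum_sub_distrib]
  have hsub : ({p, p + 1} : Finset ℕ) ⊆ Finset.range n := by
    intro x hx
    simp at hx ⊢
    omega
  rw [← Finset.sum_subset hsub, Finset.sum_pair (by omega)]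
  intro x _ hx
  simp at hx
  rw [hab x hx.1 hx.2, sub_self]

open Classical in
/-- source sets of a cut configuration -/
noncomputable def plSrc {G : Type*} [CommGroup G] (A B : Finset G) (R : ℕ → Finset G) :
    ℕ → Finset G
  | 0 => B
  | i + 1 => A * R i

open Classical in
/-- weighted size of the cut described by `R` -/
noncomputable def plCost {G : Type*} [CommGroup G] (A B : Finset G) (μ : ℝ) (h : ℕ)
    (R : ℕ → Finset G) : ℝ :=
  ∑ i ∈ Finset.range (h + 1), μ ^ i * ((plSrc A B R i \ R i).card : ℝ)

open Classical in
/-- admissible configurations -/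
def plValid {G : Type*} [CommGroup G] (A B : Finset G) (h : ℕ) (R : ℕ → Finset G) : Prop :=
  ∀ i, R i ⊆ A ^ i * B ∧ (h ≤ i → R i = ∅)

open Classical in
theorem pl_exists_min {G : Type*} [CommGroup G] (A B : Finset G) (μ : ℝ) (h : ℕ) :
    ∃ R, plValid A B h R ∧ ∀ R', plValid A B h R' → plCost A B μ h R ≤ plCost A B μ h R' := by
  have hfin : {R | plValid A B h R}.Finite := by
    have h1 : (Set.pi Set.univ (fun i : Fin h =>
        (((A ^ (i : ℕ) * B).powerset : Finset (Finset G)) : Set (Finset G)))).Finite :=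
      Set.Finite.pi fun i => Finset.finite_toSet _
    refine (h1.image (fun f i => if hi : i < h then f ⟨i, hi⟩ else ∅)).subset ?_
    intro R hR
    refine ⟨fun i => R i, ?_, ?_⟩
    · intro i _
      exact Finset.mem_coe.2 (Finset.mem_powerset.2 (hR i).1)
    · funext i
      by_cases hi : i < h
      · simp [hi]
      · simp [hi, (hR i).2 (not_lt.1 hi)]
  obtain ⟨R, hR, hmin⟩ := Set.exists_min_image _ (plCost A B μ h) hfin
    ⟨fun _ => ∅, fun i => ⟨Finset.empty_subset _, fun _ => rfl⟩⟩
  exact ⟨R, hR, hmin⟩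

open Classical in
theorem pl_step {G : Type*} [CommGroup G] (A B : Finset G) (μ : ℝ) (hμ : 0 < μ) (h : ℕ)
    (R : ℕ → Finset G) (hR : plValid A B h R)
    (hmin : ∀ R', plValid A B h R' → plCost A B μ h R ≤ plCost A B μ h R')
    (p : ℕ) (hp : p + 2 ≤ h) :
    plValid A B h (Function.update R (p + 1) (R (p + 1) ∪ (A * R p))) ∧
    plCost A B μ h (Function.update R (p + 1) (R (p + 1) ∪ (A * R p))) ≤ plCost A B μ h R := by
  -- forward moves
  have hvalid : ∀ T ⊆ A * R p, plValid A B h (Function.update R (p + 1) (R (p + 1) ∪ T)) := by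
    intro T hT i
    by_cases hi : i = p + 1
    · subst hi
      simp only [Function.update_self]
      refine ⟨Finset.union_subset (hR _).1 (hT.trans ?_), fun h' => by omega⟩
      rw [pow_succ', mul_assoc]
      exact Finset.mul_subset_mul_left (hR p).1
    · rw [Function.update_of_ne hi]
      exact hR i
  have hforward : ∀ T ⊆ A * R p,
      plCost A B μ h (Function.update R (p + 1) (R (p + 1) ∪ T)) - plCost A B μ h R ≤
        μ ^ (p + 1) * (μ * ((A * T) \ (R (p + 2) ∪ ((A * R (p + 1)) \ R (p + 2)))).card
          - (T \ R (p + 1)).card) := by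
    intro T hT
    unfold plCost
    rw [pl_sum_diff _ _ (h + 1) (p + 1) (by omega)]
    · have e1 : (plSrc A B (Function.update R (p + 1) (R (p + 1) ∪ T)) (p + 1) \
          Function.update R (p + 1) (R (p + 1) ∪ T) (p + 1)) =
          ((A * R p) \ R (p + 1)) \ (T \ R (p + 1)) := by
        simp only [plSrc, Function.update_self]
        rw [Function.update_of_ne (by omega)]
        ext x
        simp only [Finset.mem_sdiff, Finset.mem_union]
        tauto
      have e1c : ((plSrc A B (Function.update R (p + 1) (R (p + 1) ∪ T)) (p + 1) \
          Function.update R (p + 1) (R (p + 1) ∪ T) (p + 1)).card : ℝ) =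
          (((A * R p) \ R (p + 1)).card : ℝ) - ((T \ R (p + 1)).card : ℝ) := by
        rw [e1, Finset.card_sdiff_of_subset (Finset.sdiff_subset_sdiff hT le_rfl),
          Nat.cast_sub (Finset.card_le_card (Finset.sdiff_subset_sdiff hT le_rfl))]
      have e2 : (plSrc A B (Function.update R (p + 1) (R (p + 1) ∪ T)) (p + 1 + 1) \
          Function.update R (p + 1) (R (p + 1) ∪ T) (p + 1 + 1)) ⊆
          ((A * R (p + 1)) \ R (p + 2)) ∪
            (A * T) \ (R (p + 2) ∪ ((A * R (p + 1)) \ R (p + 2))) := by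
        simp only [plSrc, Function.update_self]
        rw [Function.update_of_ne (by omega), Finset.mul_union]
        intro x
        simp only [Finset.mem_sdiff, Finset.mem_union]
        tauto
      have e2c := (Finset.card_le_card e2).trans (Finset.card_union_le _ _)
      have e2d : ((plSrc A B (Function.update R (p + 1) (R (p + 1) ∪ T)) (p + 1 + 1) \
          Function.update R (p + 1) (R (p + 1) ∪ T) (p + 1 + 1)).card : ℝ) ≤
          (((A * R (p + 1)) \ R (p + 2)).card : ℝ) +
            ((A * T) \ (R (p + 2) ∪ ((A * R (p + 1)) \ R (p + 2)))).card := by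
        exact_mod_cast e2c
      rw [e1c]
      have := mul_le_mul_of_nonneg_left e2d (pow_pos hμ (p + 1 + 1)).le
      have e3 : plSrc A B R (p + 1) = A * R p := rfl
      have e4 : plSrc A B R (p + 1 + 1) = A * R (p + 1) := rfl
      rw [e3, e4]
      have e5 : μ ^ (p + 1 + 1) = μ ^ (p + 1) * μ := pow_succ _ _
      rw [e5] at this ⊢
      linarith
    · intro i hi1 hi2
      have : plSrc A B (Function.update R (p + 1) (R (p + 1) ∪ T)) i = plSrc A B R i := by
        cases i with
        | zero => rfl
        | succ i =>
          simp only [plSrc]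
          rw [Function.update_of_ne (by omega)]
      rw [this, Function.update_of_ne hi1]
  -- backward moves
  have hbackward : ∀ T ⊆ (A * R p) \ R (p + 1),
      μ * (T.card : ℝ) ≤ (((R p).filter (fun u => ∃ a ∈ A, a * u ∈ T)).card : ℝ) := by
    intro T hT
    set I := (R p).filter (fun u => ∃ a ∈ A, a * u ∈ T) with hI
    have hv : plValid A B h (Function.update R p (R p \ I)) := by
      intro i
      by_cases hi : i = p
      · subst hi
        simp only [Function.update_self]
        exact ⟨Finset.sdiff_subset.trans (hR i).1, fun h' => by omega⟩
      · rw [Function.update_of_ne hi]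
        exact hR i
    have hc := hmin _ hv
    rw [← sub_nonneg] at hc
    unfold plCost at hc
    rw [pl_sum_diff _ _ (h + 1) p (by omega)] at hc
    · have e1 : (plSrc A B (Function.update R p (R p \ I)) p \
          Function.update R p (R p \ I) p) ⊆ (plSrc A B R p \ R p) ∪ I := by
        have : plSrc A B (Function.update R p (R p \ I)) p = plSrc A B R p := by
          cases p with
          | zero => rfl
          | succ p =>
            simp only [plSrc]
            rw [Function.update_of_ne (by omega)]
        rw [this, Function.update_self]
        intro x
        simp only [Finset.mem_sdiff, Finset.mem_union]
        tauto
      have e1c : ((plSrc A B (Function.update R p (R p \ I)) p \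
          Function.update R p (R p \ I) p).card : ℝ) ≤ ((plSrc A B R p \ R p).card : ℝ) + I.card := by
        exact_mod_cast (Finset.card_le_card e1).trans (Finset.card_union_le _ _)
      have e2 : (plSrc A B (Function.update R p (R p \ I)) (p + 1) \
          Function.update R p (R p \ I) (p + 1)) ⊆ (plSrc A B R (p + 1) \ R (p + 1)) \ T := by
        simp only [plSrc, Function.update_self]
        rw [Function.update_of_ne (by omega)]
        intro x hx
        rw [Finset.mem_sdiff] at hx
        obtain ⟨a, ha, u, hu, rfl⟩ := Finset.mem_mul.1 hx.1
        rw [Finset.mem_sdiff] at hu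
        refine Finset.mem_sdiff.2 ⟨Finset.mem_sdiff.2 ⟨Finset.mul_mem_mul ha hu.1, hx.2⟩, ?_⟩
        intro hT'
        exact hu.2 (Finset.mem_filter.2 ⟨hu.1, a, ha, hT'⟩)
      have e2c : ((plSrc A B (Function.update R p (R p \ I)) (p + 1) \
          Function.update R p (R p \ I) (p + 1)).card : ℝ) ≤
          ((plSrc A B R (p + 1) \ R (p + 1)).card : ℝ) - T.card := by
        have hT2 : T ⊆ plSrc A B R (p + 1) \ R (p + 1) := hT
        have := Finset.card_le_card e2
        rw [Finset.card_sdiff_of_subset hT2] at this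
        have h2 := Finset.card_le_card hT2
        rw [← Nat.cast_sub h2]
        exact_mod_cast this
      have m1 := mul_le_mul_of_nonneg_left e1c (pow_pos hμ p).le
      have m2 := mul_le_mul_of_nonneg_left e2c (pow_pos hμ (p + 1)).le
      have m3 : 0 ≤ μ ^ p * ((I.card : ℝ) - μ * T.card) := by
        rw [pow_succ] at m2 hc
        linarith
      have := nonneg_of_mul_nonneg_right m3 (pow_pos hμ p)
      linarith
    · intro i hi1 hi2
      have : plSrc A B (Function.update R p (R p \ I)) i = plSrc A B R i := by
        cases i with
        | zero => rfl
        | succ i =>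
          simp only [plSrc]
          rw [Function.update_of_ne (by omega)]
      rw [this, Function.update_of_ne hi1]
  have hloc := pl_local A (R p) (R (p + 1)) (R (p + 2) ∪ ((A * R (p + 1)) \ R (p + 2)))
    (by rw [Finset.union_sdiff_self_eq_union]; exact Finset.subset_union_right) μ hμ hbackward
    (by
      intro T hT
      have hT' : T ⊆ A * R p := hT.trans Finset.sdiff_subset
      have h1 := hforward T hT'
      have h2 := hmin _ (hvalid T hT')
      have h3 : T \ R (p + 1) = T := by
        rw [Finset.sdiff_eq_self_iff_disjoint]
        exact Finset.disjoint_of_subset_left hT Finset.sdiff_disjoint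
      rw [h3] at h1
      have h4 := nonneg_of_mul_nonneg_right ((sub_nonneg.2 h2).trans h1) (pow_pos hμ (p + 1))
      linarith)
  have hu : R (p + 1) ∪ (A * R p) = R (p + 1) ∪ ((A * R p) \ R (p + 1)) := by
    rw [Finset.union_sdiff_self_eq_union]
  refine ⟨hvalid _ le_rfl, ?_⟩
  have h1 := hforward _ (Finset.sdiff_subset : (A * R p) \ R (p + 1) ⊆ A * R p)
  rw [← hu] at h1
  have h3 : ((A * R p) \ R (p + 1)) \ R (p + 1) = (A * R p) \ R (p + 1) := by
    rw [Finset.sdiff_eq_self_iff_disjoint]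
    exact Finset.sdiff_disjoint
  rw [h3] at h1
  have := mul_nonpos_of_nonneg_of_nonpos (pow_pos hμ (p + 1)).le (sub_nonpos.2 hloc)
  linarith

open Classical in
theorem pl_main {G : Type*} [CommGroup G] (A B : Finset G) (μ : ℝ) (hμ : 0 < μ) (j h : ℕ)
    (hj : 0 < j) (hjh : j < h) :
    ∃ Z ⊆ B, (B.card : ℝ) - Z.card + μ ^ h * ((A ^ h * Z).card : ℝ) ≤
      μ ^ j * ((A ^ j * B).card : ℝ) := by
  have hex : ∀ m, m + 1 ≤ h → ∃ R, plValid A B h R ∧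
      (∀ R', plValid A B h R' → plCost A B μ h R ≤ plCost A B μ h R') ∧
      ∀ i < m, A * R i ⊆ R (i + 1) := by
    intro m
    induction m with
    | zero =>
      intro _
      obtain ⟨R, h1, h2⟩ := pl_exists_min A B μ h
      exact ⟨R, h1, h2, by simp⟩
    | succ m ih =>
      intro hm
      obtain ⟨R, h1, h2, h3⟩ := ih (by omega)
      obtain ⟨g1, g2⟩ := pl_step A B μ hμ h R h1 h2 m (by omega)
      refine ⟨_, g1, fun R' hR' => g2.trans (h2 R' hR'), ?_⟩
      intro i hi
      by_cases him : i = m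
      · subst him
        rw [Function.update_self, Function.update_of_ne (by omega)]
        exact Finset.subset_union_right
      · rw [Function.update_of_ne (by omega), Function.update_of_ne (by omega)]
        exact h3 i (by omega)
  obtain ⟨h', rfl⟩ : ∃ h', h = h' + 1 := ⟨h - 1, by omega⟩
  obtain ⟨R, hR, hmin, hch⟩ := hex h' le_rfl
  have hpow : ∀ i ≤ h', A ^ i * R 0 ⊆ R i := by
    intro i
    induction i with
    | zero => intro _; simp
    | succ i ih =>
      intro hi
      rw [pow_succ', mul_assoc]
      exact (Finset.mul_subset_mul_left (ih (by omega))).trans (hch i (by omega))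
  have hR0 : R 0 ⊆ B := by simpa using (hR 0).1
  refine ⟨R 0, hR0, ?_⟩
  have hlow : (B.card : ℝ) - (R 0).card + μ ^ (h' + 1) * ((A ^ (h' + 1) * R 0).card : ℝ) ≤
      plCost A B μ (h' + 1) R := by
    unfold plCost
    rw [Finset.sum_range_succ, Finset.sum_range_succ']
    have e0 : ((plSrc A B R 0 \ R 0).card : ℝ) = (B.card : ℝ) - (R 0).card := by
      show ((B \ R 0).card : ℝ) = _
      rw [Finset.card_sdiff_of_subset hR0, Nat.cast_sub (Finset.card_le_card hR0)]
    have e1 : ((A ^ (h' + 1) * R 0).card : ℝ) ≤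
        ((plSrc A B R (h' + 1) \ R (h' + 1)).card : ℝ) := by
      rw [(hR (h' + 1)).2 le_rfl, Finset.sdiff_empty]
      show ((A ^ (h' + 1) * R 0).card : ℝ) ≤ ((A * R h').card : ℝ)
      rw [pow_succ', mul_assoc]
      exact_mod_cast Finset.card_le_card (Finset.mul_subset_mul_left (hpow h' le_rfl))
    have e2 := mul_le_mul_of_nonneg_left e1 (pow_pos hμ (h' + 1)).le
    have e3 : 0 ≤ ∑ i ∈ Finset.range h', μ ^ (i + 1) *
        ((plSrc A B R (i + 1) \ R (i + 1)).card : ℝ) :=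
      Finset.sum_nonneg fun i _ => by positivity
    rw [e0]
    linarith
  refine hlow.trans ?_
  have hv : plValid A B (h' + 1) (fun i => if i < j then A ^ i * B else ∅) := by
    intro i
    by_cases hi : i < j
    · simp [hi]; omega
    · simp [hi]
  refine (hmin _ hv).trans (le_of_eq ?_)
  unfold plCost
  rw [Finset.sum_eq_single j]
  · obtain ⟨j', rfl⟩ : ∃ j', j = j' + 1 := ⟨j - 1, by omega⟩
    simp [plSrc, pow_succ', mul_assoc]
  · intro i _ hij
    have : plSrc A B (fun i => if i < j then A ^ i * B else ∅) i ⊆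
        (fun i => if i < j then A ^ i * B else ∅) i := by
      cases i with
      | zero => simp [plSrc, hj]
      | succ i =>
        by_cases h1 : i + 1 < j
        · have h2 : i < j := by omega
          simp [plSrc, h1, h2, pow_succ', mul_assoc]
        · have h2 : ¬ i < j := by omega
          simp [plSrc, h2]
    rw [Finset.sdiff_eq_empty_iff_subset.2 this]
    simp
  · intro hn
    simp at hn
    omega

end PlunneckeGlobal

section BanachCore

open Classical in
/-- number of elements of `F` in `S` -/
noncomputable def bcnt {G : Type*} (S : Set G) (F : Finset G) : ℝ :=
  ((F.filter (fun x => x ∈ S)).card : ℝ)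

open Classical in
/-- number of `t ∈ F` with `w * t ∈ S` -/
noncomputable def scnt {G : Type*} [CommGroup G] (S : Set G) (w : G) (F : Finset G) : ℝ :=
  ((F.filter (fun t => w * t ∈ S)).card : ℝ)

open Classical in
/-- `F` is nonempty and almost invariant under `K` -/
def BInv {G : Type*} [CommGroup G] (K : Finset G) (ε : ℝ) (F : Finset G) : Prop :=
  F.Nonempty ∧ ∀ g ∈ K, ((F \ (g • F)).card : ℝ) ≤ ε * F.card

theorem scnt_nonneg {G : Type*} [CommGroup G] (S : Set G) (w : G) (F : Finset G) :
    0 ≤ scnt S w F := by unfold scnt; positivity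

open Classical in
theorem scnt_eq_bcnt {G : Type*} [CommGroup G] (S : Set G) (w : G) (F : Finset G) :
    scnt S w F = bcnt S (w • F) := by
  unfold scnt bcnt
  congr 1
  refine Finset.card_bij (fun t _ => w * t) ?_ ?_ ?_
  · intro t ht
    simp only [Finset.mem_filter] at ht ⊢
    exact ⟨Finset.smul_mem_smul_finset ht.1, ht.2⟩
  · intro a _ b _ h
    exact mul_left_cancel h
  · intro x hx
    simp only [Finset.mem_filter] at hx
    obtain ⟨t, ht, rfl⟩ := Finset.mem_smul_finset.1 hx.1
    exact ⟨t, Finset.mem_filter.2 ⟨ht, hx.2⟩, rfl⟩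

open Classical in
theorem card_sdiff_smul {G : Type*} [CommGroup G] (w : G) (F : Finset G) :
    ((w • F) \ F).card = (F \ (w • F)).card :=
  Finset.card_sdiff_comm (Finset.card_smul_finset w F)

open Classical in
theorem scnt_ge {G : Type*} [CommGroup G] (S : Set G) (w : G) (F : Finset G) :
    bcnt S F - ((F \ (w • F)).card : ℝ) ≤ scnt S w F := by
  rw [scnt_eq_bcnt, sub_le_iff_le_add]
  unfold bcnt
  have : F.filter (fun x => x ∈ S) ⊆ (w • F).filter (fun x => x ∈ S) ∪ (F \ (w • F)) := by
    intro x
    simp only [Finset.mem_filter, Finset.mem_union, Finset.mem_sdiff]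
    tauto
  exact_mod_cast (Finset.card_le_card this).trans (Finset.card_union_le _ _)

open Classical in
theorem scnt_le {G : Type*} [CommGroup G] (S : Set G) (w : G) (F : Finset G) :
    scnt S w F ≤ bcnt S F + ((F \ (w • F)).card : ℝ) := by
  rw [scnt_eq_bcnt, ← card_sdiff_smul]
  unfold bcnt
  have : (w • F).filter (fun x => x ∈ S) ⊆ F.filter (fun x => x ∈ S) ∪ ((w • F) \ F) := by
    intro x
    simp only [Finset.mem_filter, Finset.mem_union, Finset.mem_sdiff]
    tauto
  exact_mod_cast (Finset.card_le_card this).trans (Finset.card_union_le _ _)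

theorem scnt_double {G : Type*} [CommGroup G] (S : Set G) (W F : Finset G) :
    ∑ t ∈ F, scnt S t W = ∑ w ∈ W, scnt S w F := by
  classical
  have := Finset.sum_card_bipartiteAbove_eq_sum_card_bipartiteBelow
    (s := F) (t := W) (fun t w => t * w ∈ S)
  unfold Finset.bipartiteAbove Finset.bipartiteBelow at this
  unfold scnt
  have h2 : ∀ w ∈ W, (F.filter (fun t => w * t ∈ S)).card = (F.filter (fun t => t * w ∈ S)).card := by
    intro w _
    simp only [mul_comm]
  rw [← Nat.cast_sum, ← Nat.cast_sum, Finset.sum_congr rfl h2, ← this]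

open Classical in
theorem BInv.smul {G : Type*} [CommGroup G] {K : Finset G} {ε : ℝ} {F : Finset G}
    (h : BInv K ε F) (t : G) : BInv K ε (t • F) := by
  obtain ⟨h1, h2⟩ := h
  refine ⟨h1.smul_finset, fun g hg => ?_⟩
  have := h2 g hg
  have e : ((t • F) \ (g • t • F)) = t • (F \ (g • F)) := by
    rw [Finset.smul_finset_sdiff, smul_comm]
  rw [e, Finset.card_smul_finset, Finset.card_smul_finset]
  exact this

theorem BInv.mono {G : Type*} [CommGroup G] {K K' : Finset G} {ε ε' : ℝ} {F : Finset G}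
    (h : BInv K ε F) (hK : K' ⊆ K) (hε : ε ≤ ε') : BInv K' ε' F :=
  ⟨h.1, fun g hg => (h.2 g (hK hg)).trans (by gcongr)⟩

open Classical in
theorem window_lemma {G : Type*} [CommGroup G] (W D F Z P bad : Finset G) (a b e κ : ℝ)
    (ha : 0 ≤ a) (hb : 0 ≤ b) (hW : W.Nonempty) (hDn : D.Nonempty) (hZF : Z ⊆ F)
    (hD : ∀ w ∈ W, a * D.card ≤ scnt (P : Set G) w⁻¹ D)
    (hF : ∀ w ∈ W, ((F \ (w • F)).card : ℝ) ≤ e * F.card)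
    (hbadF : bad ⊆ F)
    (hbad : (bad.card : ℝ) ≤ κ * F.card)
    (hgood : ∀ t ∈ F, t ∉ bad → scnt (Z : Set G) t W ≤ b * W.card) :
    a * (Z.card - (e + κ) * F.card) ≤ b * ((P * Z).card : ℝ) := by
  have hWp : (0:ℝ) < W.card := by exact_mod_cast hW.card_pos
  have hDp : (0:ℝ) < D.card := by exact_mod_cast hDn.card_pos
  have hZb : bcnt (Z : Set G) F = Z.card := by
    unfold bcnt
    congr 2
    ext x
    simp only [Finset.mem_filter, Finset.mem_coe]
    exact ⟨fun h => h.2, fun h => ⟨hZF h, h⟩⟩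
  have h1 : (W.card : ℝ) * (Z.card - e * F.card) ≤ ∑ t ∈ F, scnt (Z : Set G) t W := by
    rw [scnt_double, ← nsmul_eq_mul]
    refine Finset.card_nsmul_le_sum _ _ _ fun w hw => ?_
    have := scnt_ge (Z : Set G) w F
    have := hF w hw
    linarith
  have h2 : ∑ t ∈ bad, scnt (Z : Set G) t W ≤ bad.card * W.card := by
    rw [← nsmul_eq_mul]
    refine Finset.sum_le_card_nsmul _ _ _ fun t _ => ?_
    unfold scnt
    exact_mod_cast Finset.card_filter_le _ _
  have h3 := Finset.sum_sdiff hbadF (f := fun t => scnt (Z : Set G) t W)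
  have h4 : ∑ t ∈ F \ bad, (a * D.card) * scnt (Z : Set G) t W ≤
      ∑ t ∈ F \ bad, (b * W.card) * scnt ((P * Z : Finset G) : Set G) t D := by
    refine Finset.sum_le_sum fun t ht => ?_
    rw [Finset.mem_sdiff] at ht
    by_cases hz : scnt (Z : Set G) t W = 0
    · rw [hz, mul_zero]
      have := scnt_nonneg ((P * Z : Finset G) : Set G) t D
      positivity
    · have hg := hgood t ht.1 ht.2
      have : (W.filter (fun w => t * w ∈ (Z : Set G))).Nonempty := by
        rw [← Finset.card_pos]
        unfold scnt at hz
        apply Nat.pos_of_ne_zero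
        exact_mod_cast hz
      obtain ⟨w, hw⟩ := this
      rw [Finset.mem_filter] at hw
      have hge : a * D.card ≤ scnt ((P * Z : Finset G) : Set G) t D := by
        refine (hD w hw.1).trans ?_
        unfold scnt
        norm_cast
        apply Finset.card_le_card
        intro d hd
        rw [Finset.mem_filter] at hd ⊢
        refine ⟨hd.1, ?_⟩
        have : t * d = (w⁻¹ * d) * (t * w) := by
          rw [mul_comm t w]
          simp [mul_comm, mul_left_comm]
        rw [this]
        exact Finset.mem_coe.2 (Finset.mul_mem_mul hd.2 hw.2)
      calc (a * D.card) * scnt (Z : Set G) t W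
          ≤ scnt ((P * Z : Finset G) : Set G) t D * (b * W.card) :=
            mul_le_mul hge hg (scnt_nonneg _ _ _) (scnt_nonneg _ _ _)
        _ = _ := mul_comm _ _
  have h5 : ∑ t ∈ F \ bad, scnt ((P * Z : Finset G) : Set G) t D ≤ D.card * ((P * Z).card : ℝ) := by
    refine (Finset.sum_le_sum_of_subset_of_nonneg Finset.sdiff_subset
      (fun _ _ _ => scnt_nonneg _ _ _)).trans ?_
    rw [scnt_double, ← nsmul_eq_mul]
    refine Finset.sum_le_card_nsmul _ _ _ fun d _ => ?_
    rw [scnt_eq_bcnt]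
    unfold bcnt
    norm_cast
    apply Finset.card_le_card
    intro x hx
    exact Finset.mem_coe.1 (Finset.mem_filter.1 hx).2
  rw [← Finset.mul_sum, ← Finset.mul_sum] at h4
  have h6 : (W.card : ℝ) * (Z.card - (e + κ) * F.card) ≤ ∑ t ∈ F \ bad, scnt (Z : Set G) t W := by
    have := mul_le_mul_of_nonneg_left hbad hWp.le
    linarith
  have h7 := mul_le_mul_of_nonneg_left h6 (mul_nonneg ha hDp.le)
  have h8 := mul_le_mul_of_nonneg_left h5 (mul_nonneg hb hWp.le)
  have h9 : (D.card * W.card : ℝ) * (a * (Z.card - (e + κ) * F.card)) ≤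
      (D.card * W.card : ℝ) * (b * ((P * Z).card : ℝ)) := by linarith
  exact le_of_mul_le_mul_left h9 (mul_pos hDp hWp)

open Classical in
theorem bad_lemma {G : Type*} [CommGroup G] (C : Set G) (W F : Finset G) (c ε ε' e : ℝ)
    (hε' : 0 ≤ ε') (hW : W.Nonempty)
    (hlow : ∀ t, (c - ε') * W.card ≤ scnt C t W)
    (hF : ∀ w ∈ W, ((F \ (w • F)).card : ℝ) ≤ e * F.card)
    (hC : bcnt C F ≤ (c + e) * F.card) :
    ε * ((F.filter (fun t => ¬ scnt C t W ≤ (c + ε) * W.card)).card : ℝ) ≤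
      (2 * e + ε') * F.card := by
  have hWp : (0:ℝ) < W.card := by exact_mod_cast hW.card_pos
  set bad := F.filter (fun t => ¬ scnt C t W ≤ (c + ε) * W.card) with hbad
  have h1 : ∑ t ∈ F, scnt C t W ≤ W.card * ((c + 2 * e) * F.card) := by
    rw [scnt_double, ← nsmul_eq_mul]
    refine Finset.sum_le_card_nsmul _ _ _ fun w hw => ?_
    have := scnt_le C w F
    have := hF w hw
    linarith
  have h2 : ∑ t ∈ bad, (ε + ε') * W.card ≤ ∑ t ∈ bad, (scnt C t W - (c - ε') * W.card) := by
    refine Finset.sum_le_sum fun t ht => ?_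
    have := (Finset.mem_filter.1 ht).2
    push Not at this
    linarith
  have h3 : ∑ t ∈ bad, (scnt C t W - (c - ε') * W.card) ≤
      ∑ t ∈ F, (scnt C t W - (c - ε') * W.card) :=
    Finset.sum_le_sum_of_subset_of_nonneg (Finset.filter_subset _ _)
      (fun t _ _ => sub_nonneg.2 (hlow t))
  replace h3 := h2.trans h3
  rw [Finset.sum_sub_distrib, Finset.sum_const, Finset.sum_const, nsmul_eq_mul,
    nsmul_eq_mul] at h3
  have h4 : (W.card : ℝ) * ((ε + ε') * bad.card) ≤ W.card * ((2 * e + ε') * F.card) := by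
    linarith
  have h5 := le_of_mul_le_mul_left h4 hWp
  have : 0 ≤ ε' * (bad.card : ℝ) := by positivity
  linarith

open Classical in
theorem exists_finset_pow {G : Type*} [CommGroup G] (A : Set G) (k : ℕ) (Q : Finset G)
    (hQ : (Q : Set G) ⊆ A ^ k) : ∃ A' : Finset G, (A' : Set G) ⊆ A ∧ Q ⊆ A' ^ k := by
  have h1 : ∀ (k : ℕ) (x : G), x ∈ A ^ k → ∃ A' : Finset G, (A' : Set G) ⊆ A ∧ x ∈ A' ^ k := by
    intro k
    induction k with
    | zero => intro x hx; exact ⟨∅, by simp, by simpa using hx⟩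
    | succ k ih =>
      intro x hx
      rw [pow_succ] at hx
      obtain ⟨y, hy, a, ha, rfl⟩ := Set.mem_mul.1 hx
      obtain ⟨A', h1, h2⟩ := ih y hy
      refine ⟨insert a A', ?_, ?_⟩
      · rw [Finset.coe_insert]
        exact Set.insert_subset ha h1
      · rw [pow_succ]
        exact Finset.mul_mem_mul (Finset.pow_subset_pow_left (Finset.subset_insert _ _) h2)
          (Finset.mem_insert_self _ _)
  induction Q using Finset.induction_on with
  | empty => exact ⟨∅, by simp, by simp⟩
  | insert q Q _ ih =>
    rw [Finset.coe_insert, Set.insert_subset_iff] at hQ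
    obtain ⟨A1, h2, h3⟩ := ih hQ.2
    obtain ⟨A2, h4, h5⟩ := h1 k q hQ.1
    refine ⟨A1 ∪ A2, ?_, ?_⟩
    · rw [Finset.coe_union]
      exact Set.union_subset h2 h4
    · rw [Finset.insert_subset_iff]
      exact ⟨Finset.pow_subset_pow_left Finset.subset_union_right h5,
        h3.trans (Finset.pow_subset_pow_left Finset.subset_union_left)⟩

end BanachCore

section BanachCore2

open Classical in
theorem core_fixed {G : Type*} [CommGroup G] (A B : Set G) (j k : ℕ) (hj : 0 < j) (hjk : j < k)
    (c α b η μ : ℝ) (hb0 : 0 ≤ b) (hη : 0 < η) (hμ : 0 < μ) (hαη : 0 < α - 2 * η)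
    (hμk : b + η ≤ μ ^ k * (α - 2 * η))
    (hC1 : ∀ ε > 0, ∃ K : Finset G, ∃ δ > 0, ∀ F, BInv K δ F →
      (c - ε) * F.card ≤ bcnt (A ^ j * B) F)
    (hA : ∀ ε > 0, ∀ K : Finset G, ∃ F, BInv K ε F ∧ (α - ε) * F.card ≤ bcnt (A ^ k) F)
    (hP1 : ∀ ε > 0, ∀ K : Finset G, ∃ F, BInv K ε F ∧
      bcnt (A ^ j * B) F ≤ (c + ε) * F.card ∧ (b - ε) * F.card ≤ bcnt B F)
    (hP2 : ∀ η > 0, ∃ ε > 0, ∃ K : Finset G, ∀ F, BInv K ε F →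
      bcnt (A ^ j * B) F ≤ (c + ε) * F.card → bcnt B F ≤ (b + η) * F.card) :
    b ≤ μ ^ j * c := by
  obtain ⟨ε, hε, K, hP2⟩ := hP2 η hη
  have main : ∀ ε' > 0, b - (3 + 3 / ε) * ε' ≤ μ ^ j * (c + ε') := by
    intro ε' hε'
    obtain ⟨K1, δ, hδ, hlow⟩ := hC1 ε' hε'
    obtain ⟨W, hW, -, -⟩ := hP1 (min ε δ) (lt_min hε hδ) (K ∪ K1)
    have hlow' : ∀ t, (c - ε') * W.card ≤ scnt (A ^ j * B) t W := by
      intro t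
      have := hlow (t • W) ((hW.mono Finset.subset_union_right (min_le_right _ _)).smul t)
      rwa [Finset.card_smul_finset, ← scnt_eq_bcnt] at this
    have hP2' : ∀ t, scnt (A ^ j * B) t W ≤ (c + ε) * W.card →
        scnt B t W ≤ (b + η) * W.card := by
      intro t ht
      have := hP2 (t • W) ((hW.mono Finset.subset_union_left (min_le_left _ _)).smul t)
      rw [Finset.card_smul_finset, ← scnt_eq_bcnt, ← scnt_eq_bcnt] at this
      exact this ht
    obtain ⟨D, hD, hDA⟩ := hA η hη (W.image (fun w => w⁻¹))
    have hD' : ∀ w ∈ W, (α - 2 * η) * D.card ≤ scnt (A ^ k) w⁻¹ D := by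
      intro w hw
      have h1 := hD.2 w⁻¹ (Finset.mem_image_of_mem _ hw)
      have h2 := scnt_ge (A ^ k) w⁻¹ D
      linarith
    obtain ⟨A', hA'A, hA'⟩ := exists_finset_pow A k
      ((W.biUnion (fun w => D.image (fun d => w⁻¹ * d))).filter (fun x => x ∈ A ^ k))
      (by intro x hx; exact (Finset.mem_filter.1 (Finset.mem_coe.1 hx)).2)
    have hD'' : ∀ w ∈ W, (α - 2 * η) * D.card ≤ scnt ((A' ^ k : Finset G) : Set G) w⁻¹ D := by
      intro w hw
      refine (hD' w hw).trans ?_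
      unfold scnt
      norm_cast
      apply Finset.card_le_card
      intro d hd
      rw [Finset.mem_filter] at hd ⊢
      refine ⟨hd.1, Finset.mem_coe.2 (hA' (Finset.mem_filter.2 ⟨?_, hd.2⟩))⟩
      exact Finset.mem_biUnion.2 ⟨w, hw, Finset.mem_image_of_mem _ hd.1⟩
    set e : ℝ := ε' / ((A' ^ j).card + 1) with he
    have hepos : 0 < e := by positivity
    have hmul : ((A' ^ j).card : ℝ) * e + e = ε' := by
      rw [he]; field_simp
    have hele : e ≤ ε' := by
      have : 0 ≤ ((A' ^ j).card : ℝ) * e := by positivity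
      linarith
    obtain ⟨F, hF, hFC, hFB⟩ := hP1 e hepos (W ∪ A' ^ j)
    have hFpos : (0:ℝ) < F.card := by exact_mod_cast hF.1.card_pos
    have hFW : ∀ w ∈ W, ((F \ (w • F)).card : ℝ) ≤ e * F.card :=
      fun w hw => hF.2 w (Finset.mem_union_left _ hw)
    set B1 := F.filter (fun x => x ∈ B ∧ ∀ q ∈ A' ^ j, q * x ∈ F) with hB1
    have hB1card : (b - ε') * F.card ≤ B1.card := by
      obtain ⟨N, hN⟩ : ∃ N : Set G, ∀ x, x ∈ N ↔ x ∉ F := ⟨(F : Set G)ᶜ, by simp⟩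
      have hsub : F.filter (fun x => x ∈ B) ⊆
          B1 ∪ (A' ^ j).biUnion (fun q => F.filter (fun x => q * x ∈ N)) := by
        intro x hx
        rw [Finset.mem_filter] at hx
        by_cases h : ∀ q ∈ A' ^ j, q * x ∈ F
        · exact Finset.mem_union_left _ (Finset.mem_filter.2 ⟨hx.1, hx.2, h⟩)
        · push Not at h
          obtain ⟨q, hq, hqx⟩ := h
          refine Finset.mem_union_right _ (Finset.mem_biUnion.2 ⟨q, hq, ?_⟩)
          exact Finset.mem_filter.2 ⟨hx.1, (hN _).2 hqx⟩
      have h1 := (Finset.card_le_card hsub).trans (Finset.card_union_le _ _)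
      have h2 : (((A' ^ j).biUnion
          (fun q => F.filter (fun x => q * x ∈ N))).card : ℝ) ≤
          (A' ^ j).card * (e * F.card) := by
        have h3 : (((A' ^ j).biUnion
          (fun q => F.filter (fun x => q * x ∈ N))).card : ℝ) ≤
            ∑ q ∈ A' ^ j, scnt N q F := by
          unfold scnt
          exact_mod_cast Finset.card_biUnion_le
        refine h3.trans ?_
        rw [← nsmul_eq_mul]
        refine Finset.sum_le_card_nsmul _ _ _ fun q hq => ?_
        refine (scnt_le _ q F).trans ?_
        have : bcnt N F = 0 := by
          unfold bcnt
          rw [Finset.filter_false_of_mem]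
          · simp
          · intro x hx h; exact (hN x).1 h hx
        rw [this, zero_add]
        exact hF.2 q (Finset.mem_union_right _ hq)
      have h4 : bcnt B F ≤ B1.card + (A' ^ j).card * (e * F.card) := by
        unfold bcnt
        refine le_trans ?_ (add_le_add_right h2 _)
        exact_mod_cast h1
      have h5 : ((A' ^ j).card * e + e) * F.card = ε' * F.card := by rw [hmul]
      linarith
    have hB1C : ((A' ^ j * B1).card : ℝ) ≤ bcnt (A ^ j * B) F := by
      unfold bcnt
      norm_cast
      apply Finset.card_le_card
      intro y hy
      obtain ⟨q, hq, x, hx, rfl⟩ := Finset.mem_mul.1 hy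
      have hx' := Finset.mem_filter.1 hx
      refine Finset.mem_filter.2 ⟨hx'.2.2 q hq, Set.mul_mem_mul ?_ hx'.2.1⟩
      have : q ∈ ((A' ^ j : Finset G) : Set G) := hq
      rw [Finset.coe_pow] at this
      exact Set.pow_subset_pow_left hA'A this
    obtain ⟨Z, hZ, hZle⟩ := pl_main A' B1 μ hμ j k hj hjk
    set bad := F.filter (fun t => ¬ scnt (A ^ j * B) t W ≤ (c + ε) * W.card) with hbad
    have hbadc := bad_lemma (A ^ j * B) W F c ε ε' e hε'.le hW.1 hlow' hFW hFC
    rw [← hbad] at hbadc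
    have hbadc' : (bad.card : ℝ) ≤ (3 * ε' / ε) * F.card := by
      rw [div_mul_eq_mul_div, le_div_iff₀ hε]
      have : (2 * e + ε') * F.card ≤ 3 * ε' * F.card := by gcongr; linarith
      linarith
    have hwin := window_lemma W D F Z (A' ^ k) bad (α - 2 * η) (b + η) e (3 * ε' / ε) hαη.le
      (by linarith) hW.1 hD.1 (hZ.trans (Finset.filter_subset _ _)) hD'' hFW
      (Finset.filter_subset _ _) hbadc' (by
        intro t ht htb
        have h1 : scnt (A ^ j * B) t W ≤ (c + ε) * W.card := by
          by_contra h
          exact htb (Finset.mem_filter.2 ⟨ht, h⟩)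
        refine le_trans ?_ (hP2' t h1)
        unfold scnt
        norm_cast
        apply Finset.card_le_card
        intro w hw
        rw [Finset.mem_filter] at hw ⊢
        exact ⟨hw.1, (Finset.mem_filter.1 (hZ (Finset.mem_coe.1 hw.2))).2.1⟩)
    have hwin2 : (α - 2 * η) * (Z.card - (e + 3 * ε' / ε) * F.card) ≤
        (α - 2 * η) * (μ ^ k * ((A' ^ k * Z).card : ℝ)) := by
      refine hwin.trans ?_
      have : (b + η) * ((A' ^ k * Z).card : ℝ) ≤ μ ^ k * (α - 2 * η) * ((A' ^ k * Z).card : ℝ) := by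
        gcongr
      linarith
    have hwin3 := le_of_mul_le_mul_left hwin2 hαη
    have hfin1 : μ ^ j * ((A' ^ j * B1).card : ℝ) ≤ μ ^ j * ((c + ε') * F.card) := by
      have : (c + e) * F.card ≤ (c + ε') * F.card := by gcongr
      gcongr
      linarith
    have heF : e * F.card ≤ ε' * F.card := by gcongr
    have hε'F : 0 ≤ ε' * F.card := by positivity
    have hfin : (b - (3 + 3 / ε) * ε') * F.card ≤ (μ ^ j * (c + ε')) * F.card := by
      have : 3 * ε' / ε = 3 / ε * ε' := by ring
      rw [this] at hwin3
      linarith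
    exact le_of_mul_le_mul_right hfin hFpos
  have t1 : Filter.Tendsto (fun ε' : ℝ => b - (3 + 3 / ε) * ε') (nhdsWithin 0 (Set.Ioi 0))
      (nhds (b - (3 + 3 / ε) * 0)) :=
    (Continuous.tendsto (by fun_prop) 0).mono_left nhdsWithin_le_nhds
  have t2 : Filter.Tendsto (fun ε' : ℝ => μ ^ j * (c + ε')) (nhdsWithin 0 (Set.Ioi 0))
      (nhds (μ ^ j * (c + 0))) :=
    (Continuous.tendsto (by fun_prop) 0).mono_left nhdsWithin_le_nhds
  have := le_of_tendsto_of_tendsto t1 t2 (by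
    filter_upwards [self_mem_nhdsWithin] with x hx using main x hx)
  simpa using this

theorem core_analytic (j k : ℕ) (hj : 0 < j) (hjk : j < k) (c α b : ℝ) (hα : 0 < α) (hb : 0 < b)
    (h : ∀ η μ : ℝ, 0 < η → 0 < μ → 0 < α - 2 * η → b + η ≤ μ ^ k * (α - 2 * η) → b ≤ μ ^ j * c) :
    α ^ ((j : ℝ) / k) * b ^ (1 - (j : ℝ) / k) ≤ c := by
  have hk : (0:ℝ) < k := by exact_mod_cast hj.trans hjk
  have hr : (0:ℝ) < (j : ℝ) / k := div_pos (by exact_mod_cast hj) hk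
  have key : ∀ η : ℝ, 0 < η → 0 < α - 2 * η →
      b ≤ ((b + η) / (α - 2 * η)) ^ ((j : ℝ) / k) * c := by
    intro η hη hη2
    have hpos : 0 < (b + η) / (α - 2 * η) := by positivity
    have := h η (((b + η) / (α - 2 * η)) ^ (1 / (k : ℝ))) hη (Real.rpow_pos_of_pos hpos _) hη2 (by
      rw [← Real.rpow_natCast, ← Real.rpow_mul hpos.le, one_div, inv_mul_cancel₀ hk.ne',
        Real.rpow_one, div_mul_cancel₀ _ hη2.ne'])
    rw [← Real.rpow_natCast, ← Real.rpow_mul hpos.le] at this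
    convert this using 3
    ring
  have t : Filter.Tendsto (fun η : ℝ => ((b + η) / (α - 2 * η)) ^ ((j : ℝ) / k) * c)
      (nhdsWithin 0 (Set.Ioi 0)) (nhds (((b + 0) / (α - 2 * 0)) ^ ((j : ℝ) / k) * c)) := by
    refine Filter.Tendsto.mono_left ?_ nhdsWithin_le_nhds
    refine Filter.Tendsto.mul_const _ ?_
    refine Filter.Tendsto.rpow_const ?_ (Or.inr hr.le)
    refine Filter.Tendsto.div ?_ ?_ (by simpa using hα.ne')
    · exact Continuous.tendsto (by fun_prop) 0
    · exact Continuous.tendsto (by fun_prop) 0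
  have hle : b ≤ ((b + 0) / (α - 2 * 0)) ^ ((j : ℝ) / k) * c := by
    refine ge_of_tendsto t ?_
    have h2 : Set.Ioo (0:ℝ) (α / 2) ∈ nhdsWithin (0:ℝ) (Set.Ioi 0) :=
      Ioo_mem_nhdsGT (by positivity)
    filter_upwards [h2] with η hη
    exact key η hη.1 (by linarith [hη.2])
  rw [add_zero, mul_zero, sub_zero, Real.div_rpow hb.le hα.le] at hle
  have hαr := Real.rpow_pos_of_pos hα ((j : ℝ) / k)
  have hbr := Real.rpow_pos_of_pos hb ((j : ℝ) / k)
  rw [Real.rpow_sub hb, Real.rpow_one, ← mul_div_assoc, div_le_iff₀ hbr]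
  rw [div_mul_eq_mul_div, le_div_iff₀ hαr] at hle
  linarith

theorem core_density {G : Type*} [CommGroup G] (A B : Set G) (j k : ℕ) (hj : 0 < j) (hjk : j < k)
    (c α β : ℝ) (hc : 0 ≤ c) (hα : 0 ≤ α) (hβ : 0 ≤ β)
    (hC1 : ∀ ε > 0, ∃ K : Finset G, ∃ δ > 0, ∀ F, BInv K δ F →
      (c - ε) * F.card ≤ bcnt (A ^ j * B) F)
    (hC2 : ∀ ε > 0, ∀ K : Finset G, ∃ F, BInv K ε F ∧ bcnt (A ^ j * B) F ≤ (c + ε) * F.card)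
    (hA : ∀ ε > 0, ∀ K : Finset G, ∃ F, BInv K ε F ∧ (α - ε) * F.card ≤ bcnt (A ^ k) F)
    (hB : ∀ ε > 0, ∃ K : Finset G, ∃ δ > 0, ∀ F, BInv K δ F →
      (β - ε) * F.card ≤ bcnt B F) :
    α ^ ((j : ℝ) / k) * β ^ (1 - (j : ℝ) / k) ≤ c := by
  classical
  have hk : (0:ℝ) < k := by exact_mod_cast hj.trans hjk
  have hr : (0:ℝ) < (j : ℝ) / k := div_pos (by exact_mod_cast hj) hk
  have hr1 : (0:ℝ) < 1 - (j : ℝ) / k := by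
    rw [sub_pos, div_lt_one hk]
    exact_mod_cast hjk
  rcases hα.eq_or_lt with h0 | hαpos
  · rw [← h0, Real.zero_rpow hr.ne', zero_mul]
    exact hc
  rcases hβ.eq_or_lt with h0 | hβpos
  · rw [← h0, Real.zero_rpow hr1.ne', mul_zero]
    exact hc
  set P : Set ℝ := {b | ∀ ε > 0, ∀ K : Finset G, ∃ F, BInv K ε F ∧
      bcnt (A ^ j * B) F ≤ (c + ε) * F.card ∧ (b - ε) * F.card ≤ bcnt B F} with hP
  have hβP : β ∈ P := by
    intro ε hε K
    obtain ⟨K1, δ, hδ, h⟩ := hB ε hε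
    obtain ⟨F, hF, hFC⟩ := hC2 (min ε δ) (lt_min hε hδ) (K ∪ K1)
    refine ⟨F, hF.mono Finset.subset_union_left (min_le_left _ _), hFC.trans ?_,
      h F (hF.mono Finset.subset_union_right (min_le_right _ _))⟩
    gcongr
    exact min_le_left _ _
  have hbdd : BddAbove P := by
    refine ⟨2, fun b hb => ?_⟩
    obtain ⟨F, hF, -, h⟩ := hb 1 one_pos ∅
    have hFpos : (0:ℝ) < F.card := by exact_mod_cast hF.1.card_pos
    have : bcnt B F ≤ 1 * F.card := by
      rw [one_mul]
      unfold bcnt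
      exact_mod_cast Finset.card_filter_le _ _
    have := le_of_mul_le_mul_right (h.trans this) hFpos
    linarith
  set b := sSup P with hb
  have hβb : β ≤ b := le_csSup hbdd hβP
  have hP1 : ∀ ε > 0, ∀ K : Finset G, ∃ F, BInv K ε F ∧
      bcnt (A ^ j * B) F ≤ (c + ε) * F.card ∧ (b - ε) * F.card ≤ bcnt B F := by
    intro ε hε K
    obtain ⟨b', hb', hlt⟩ := exists_lt_of_lt_csSup ⟨β, hβP⟩ (show b - ε / 2 < sSup P by linarith)
    obtain ⟨F, h1, h2, h3⟩ := hb' (ε / 2) (by positivity) K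
    refine ⟨F, h1.mono le_rfl (by linarith), h2.trans ?_, le_trans ?_ h3⟩
    · gcongr; linarith
    · gcongr ?_ * _; linarith
  have hP2 : ∀ η > 0, ∃ ε > 0, ∃ K : Finset G, ∀ F, BInv K ε F →
      bcnt (A ^ j * B) F ≤ (c + ε) * F.card → bcnt B F ≤ (b + η) * F.card := by
    intro η hη
    have : b + η ∉ P := fun h => by linarith [le_csSup hbdd h]
    rw [hP] at this
    simp only [Set.mem_ofPred_eq] at this
    push Not at this
    obtain ⟨ε, hε, K, h⟩ := this
    refine ⟨ε, hε, K, fun F hF hC => (h F hF hC).le.trans ?_⟩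
    gcongr ?_ * _; linarith
  have hbpos : 0 < b := hβpos.trans_le hβb
  have := core_analytic j k hj hjk c α b hαpos hbpos (fun η μ h1 h2 h3 h4 =>
    core_fixed A B j k hj hjk c α b η μ hbpos.le h1 h2 h3 h4 hC1 hA hP1 hP2)
  refine le_trans ?_ this
  gcongr

end BanachCore2

section FolnerLink

open Classical in
theorem folner_ratio {G : Type*} [CommGroup G] (F : Finset G) (hF : F.Nonempty) (g : G) :
    ((((F : Set G)) ∩ (g • (F : Set G))).ncard : ℝ) / F.card =
      1 - ((F \ (g • F)).card : ℝ) / F.card := by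
  have hFpos : (0:ℝ) < F.card := by exact_mod_cast hF.card_pos
  rw [← Finset.coe_smul_finset, ← Finset.coe_inter, Set.ncard_coe_finset]
  have h := Finset.card_sdiff_add_card_inter F (g • F)
  have h' : ((F \ (g • F)).card : ℝ) + ((F ∩ (g • F)).card : ℝ) = F.card := by exact_mod_cast h
  field_simp
  linarith

theorem density_eq {G : Type*} (F : Finset G) (S : Set G) :
    (((F : Set G) ∩ S).ncard : ℝ) = bcnt S F := by
  classical
  unfold bcnt
  rw [← Set.ncard_coe_finset]
  congr 2
  ext x
  simp

theorem density_nonneg {G : Type*} (F : Finset G) (S : Set G) :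
    0 ≤ (((F : Set G) ∩ S).ncard : ℝ) / F.card := by positivity

theorem density_le_one {G : Type*} (F : Finset G) (S : Set G) :
    (((F : Set G) ∩ S).ncard : ℝ) / F.card ≤ 1 := by
  classical
  rw [density_eq]
  refine div_le_one_of_le₀ ?_ (by positivity)
  unfold bcnt
  exact_mod_cast Finset.card_filter_le _ _

theorem folner_eventually {G : Type*} [CommGroup G] (F : ℕ → Finset G) (hF : IsFolner F)
    (K : Finset G) (ε : ℝ) (hε : 0 < ε) : ∀ᶠ n in atTop, BInv K ε (F n) := by
  have h : ∀ g ∈ K, ∀ᶠ n in atTop,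
      1 - ε < ((((F n : Set G)) ∩ (g • (F n : Set G))).ncard : ℝ) / (F n).card := by
    intro g _
    exact (hF.2 g).eventually_const_lt (by linarith)
  have h2 := (Finset.eventually_all K).2 h
  filter_upwards [h2] with n hn
  refine ⟨hF.1 n, fun g hg => ?_⟩
  have := hn g hg
  rw [folner_ratio _ (hF.1 n)] at this
  have hFpos : (0:ℝ) < (F n).card := by exact_mod_cast (hF.1 n).card_pos
  rw [← div_le_iff₀ hFpos]
  linarith

theorem folner_construct {G : Type*} [CommGroup G] [Countable G] (Q : Finset G → Prop)
    (hQ : ∀ K : Finset G, ∀ δ > 0, ∃ F, BInv K δ F ∧ Q F) :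
    ∃ F : ℕ → Finset G, IsFolner F ∧ ∀ n, Q (F n) := by
  classical
  obtain ⟨f, hf⟩ := exists_surjective_nat G
  have h1 : ∀ n : ℕ, ∃ F, BInv ((Finset.range (n + 1)).image f) (1 / ((n : ℝ) + 1)) F ∧ Q F :=
    fun n => hQ _ _ (by positivity)
  choose F hF hQF using h1
  refine ⟨F, ⟨fun n => (hF n).1, fun g => ?_⟩, hQF⟩
  obtain ⟨m, rfl⟩ := hf g
  have hlow : Filter.Tendsto (fun n : ℕ => 1 - 1 / ((n : ℝ) + 1)) atTop (nhds 1) := by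
    have := (tendsto_one_div_add_atTop_nhds_zero_nat (𝕜 := ℝ)).const_sub 1
    simpa using this
  refine tendsto_of_tendsto_of_tendsto_of_le_of_le' hlow tendsto_const_nhds ?_ ?_
  · filter_upwards [eventually_ge_atTop m] with n hn
    rw [folner_ratio _ (hF n).1]
    have hFpos : (0:ℝ) < (F n).card := by exact_mod_cast (hF n).1.card_pos
    have := (hF n).2 (f m) (Finset.mem_image_of_mem _ (Finset.mem_range.2 (by omega)))
    have h3 := (div_le_iff₀ hFpos).2 this
    refine sub_le_sub_left (le_trans (le_of_eq ?_) h3) 1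
    congr!
  · filter_upwards with n
    exact density_le_one _ _

theorem bdd_below_density {G : Type*} (F : ℕ → Finset G) (S : Set G) :
    IsBoundedUnder (· ≥ ·) atTop (fun n => (((F n : Set G) ∩ S).ncard : ℝ) / (F n).card) :=
  isBoundedUnder_of ⟨0, fun n => density_nonneg _ _⟩

theorem bdd_above_density {G : Type*} (F : ℕ → Finset G) (S : Set G) :
    IsBoundedUnder (· ≤ ·) atTop (fun n => (((F n : Set G) ∩ S).ncard : ℝ) / (F n).card) :=
  isBoundedUnder_of ⟨1, fun n => density_le_one _ _⟩

theorem liminf_density_nonneg {G : Type*} (F : ℕ → Finset G) (S : Set G) :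
    0 ≤ Filter.liminf (fun n => (((F n : Set G) ∩ S).ncard : ℝ) / (F n).card) atTop :=
  le_liminf_of_le (bdd_above_density F S).isCoboundedUnder_ge
    (Eventually.of_forall fun _ => density_nonneg _ _)

theorem limsup_density_nonneg {G : Type*} (F : ℕ → Finset G) (S : Set G) :
    0 ≤ Filter.limsup (fun n => (((F n : Set G) ∩ S).ncard : ℝ) / (F n).card) atTop :=
  le_limsup_of_le (bdd_above_density F S) (fun b hb => by
    obtain ⟨n, hn⟩ := hb.exists
    exact (density_nonneg _ _).trans hn)

theorem lower_nonneg {G : Type*} [CommGroup G] (S : Set G) : 0 ≤ lowerBanachDensity S := by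
  apply Real.sInf_nonneg
  rintro d ⟨F, -, rfl⟩
  exact liminf_density_nonneg F S

theorem upper_nonneg {G : Type*} [CommGroup G] (S : Set G) : 0 ≤ upperBanachDensity S := by
  apply Real.sSup_nonneg
  rintro d ⟨F, -, rfl⟩
  exact limsup_density_nonneg F S

theorem lower_uniform {G : Type*} [CommGroup G] [Countable G] (S : Set G) (ε : ℝ) (hε : 0 < ε) :
    ∃ K : Finset G, ∃ δ > 0, ∀ F, BInv K δ F → (lowerBanachDensity S - ε) * F.card ≤ bcnt S F := by
  by_contra hcon
  push Not at hcon
  obtain ⟨F, hF, hQ⟩ := folner_construct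
    (fun F => bcnt S F < (lowerBanachDensity S - ε) * F.card) hcon
  have h1 : lowerBanachDensity S ≤
      Filter.liminf (fun n => (((F n : Set G) ∩ S).ncard : ℝ) / (F n).card) atTop := by
    refine csInf_le ⟨0, ?_⟩ ⟨F, hF, rfl⟩
    rintro d ⟨F, -, rfl⟩
    exact liminf_density_nonneg F S
  have h2 : Filter.liminf (fun n => (((F n : Set G) ∩ S).ncard : ℝ) / (F n).card) atTop ≤
      lowerBanachDensity S - ε := by
    refine liminf_le_of_le (bdd_below_density F S) (fun b hb => ?_)
    obtain ⟨n, hn⟩ := hb.exists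
    refine hn.trans ?_
    have hFpos : (0:ℝ) < (F n).card := by exact_mod_cast (hF.1 n).card_pos
    rw [density_eq, div_le_iff₀ hFpos]
    exact (hQ n).le
  linarith

theorem lower_attain {G : Type*} [CommGroup G] (S : Set G) (hex : ∃ F : ℕ → Finset G, IsFolner F)
    (ε : ℝ) (hε : 0 < ε) (K : Finset G) :
    ∃ F, BInv K ε F ∧ bcnt S F ≤ (lowerBanachDensity S + ε) * F.card := by
  obtain ⟨F0, hF0⟩ := hex
  obtain ⟨d, ⟨F, hF, rfl⟩, hd⟩ := exists_lt_of_csInf_lt (s := {d : ℝ | ∃ F : ℕ → Finset G, IsFolner F ∧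
    d = Filter.liminf (fun n => (((F n : Set G) ∩ S).ncard : ℝ) / (F n).card) Filter.atTop})
    ⟨_, F0, hF0, rfl⟩ (show lowerBanachDensity S < lowerBanachDensity S + ε by linarith)
  have hfr := frequently_lt_of_liminf_lt (bdd_above_density F S).isCoboundedUnder_ge hd
  obtain ⟨n, hn, hI⟩ := (hfr.and_eventually (folner_eventually F hF K ε hε)).exists
  have hFpos : (0:ℝ) < (F n).card := by exact_mod_cast (hF.1 n).card_pos
  rw [density_eq, div_lt_iff₀ hFpos] at hn
  exact ⟨F n, hI, hn.le⟩

theorem upper_attain {G : Type*} [CommGroup G] (S : Set G) (hex : ∃ F : ℕ → Finset G, IsFolner F)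
    (ε : ℝ) (hε : 0 < ε) (K : Finset G) :
    ∃ F, BInv K ε F ∧ (upperBanachDensity S - ε) * F.card ≤ bcnt S F := by
  obtain ⟨F0, hF0⟩ := hex
  obtain ⟨d, ⟨F, hF, rfl⟩, hd⟩ := exists_lt_of_lt_csSup (s := {d : ℝ | ∃ F : ℕ → Finset G, IsFolner F ∧
    d = Filter.limsup (fun n => (((F n : Set G) ∩ S).ncard : ℝ) / (F n).card) Filter.atTop})
    ⟨_, F0, hF0, rfl⟩ (show upperBanachDensity S - ε < upperBanachDensity S by linarith)
  have hfr := frequently_lt_of_lt_limsup (bdd_below_density F S).isCoboundedUnder_le hd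
  obtain ⟨n, hn, hI⟩ := (hfr.and_eventually (folner_eventually F hF K ε hε)).exists
  have hFpos : (0:ℝ) < (F n).card := by exact_mod_cast (hF.1 n).card_pos
  rw [density_eq, lt_div_iff₀ hFpos] at hn
  exact ⟨F n, hI, hn.le⟩

end FolnerLink

/-- For a countable abelian group `G` and `A, B ⊆ G`, for all integers `0 < j < k`,
`d_*(A^j B) ≥ d*(A^k)^(j/k) · d_*(B)^(1 - j/k)`. -/
theorem lower_banach_density_plunnecke [CommGroup G] [Countable G]
    (A B : Set G) (j k : ℕ) (hj : 0 < j) (hjk : j < k) :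
    lowerBanachDensity (A ^ j * B) ≥
      upperBanachDensity (A ^ k) ^ ((j : ℝ) / k) *
        lowerBanachDensity B ^ (1 - (j : ℝ) / k) := by

  by_cases hex : ∃ F : ℕ → Finset G, IsFolner F
  · exact core_density A B j k hj hjk _ _ _ (lower_nonneg _) (upper_nonneg _) (lower_nonneg _)
      (fun ε hε => lower_uniform _ ε hε) (fun ε hε K => lower_attain _ hex ε hε K)
      (fun ε hε K => upper_attain _ hex ε hε K) (fun ε hε => lower_uniform _ ε hε)
  · have h0 : upperBanachDensity (A ^ k) = 0 := by
      unfold upperBanachDensity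
      convert Real.sSup_empty
      refine Set.eq_empty_iff_forall_notMem.2 ?_
      rintro d ⟨F, hF, -⟩
      exact hex ⟨F, hF⟩
    have hk : (0:ℝ) < k := by exact_mod_cast hj.trans hjk
    have hr : (0:ℝ) < (j : ℝ) / k := div_pos (by exact_mod_cast hj) hk
    rw [h0, Real.zero_rpow hr.ne', zero_mul]
    exact lower_nonneg _
end

section
/- Let G be a countable abelian group acting on a measure space (X, 𝓑, μ), let A ⊆ G be finite, and let B ∈ 𝓑 have positive finite measure. Then for all positive integers j < k one has c(A^k, B)^{1/k} ≤ c(A^j, B)^{1/j}. -/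
open Filter MeasureTheory Pointwise ENNReal

/-- The magnification ratio `c(A, B) = inf { μ(A B') / μ(B') : B' ⊆ B measurable, μ(B') > 0 }`,
where `A B' = ⋃_{a ∈ A} a • B'`. -/
noncomputable def magRatio {G X : Type*} [SMul G X] [MeasurableSpace X]
    (μ : Measure X) (A : Set G) (B : Set X) : ℝ≥0∞ :=
  sInf {r : ℝ≥0∞ | ∃ B' : Set X, B' ⊆ B ∧ MeasurableSet B' ∧ 0 < μ B' ∧
    r = μ (A • B') / μ B'}


section Aux
set_option linter.unusedSectionVars false
variable {G X : Type*} [CommGroup G] [MulAction G X] [MeasurableSpace X]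

theorem aux_meas_smul (hmeas : ∀ g : G, Measurable (fun x : X => g • x)) (g : G) {S : Set X}
    (hS : MeasurableSet S) : MeasurableSet (g • S) := by
  rw [← Set.preimage_smul_inv]
  exact hmeas _ hS

theorem aux_meas_set (hmeas : ∀ g : G, Measurable (fun x : X => g • x)) (F : Finset G) {S : Set X}
    (hS : MeasurableSet S) : MeasurableSet ((F : Set G) • S) := by
  rw [← Set.iUnion_smul_set]
  exact Finset.measurableSet_biUnion F (fun g _ => aux_meas_smul hmeas g hS)

theorem aux_fin_set (μ : Measure X)
    (hinv : ∀ (g : G) (S : Set X), MeasurableSet S → μ (g • S) = μ S)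
    (F : Finset G) {S : Set X}
    (hS : MeasurableSet S) (hf : μ S ≠ ⊤) : μ ((F : Set G) • S) ≠ ⊤ := by
  rw [← Set.iUnion_smul_set]
  refine ((measure_biUnion_finset_le F (fun g => g • S)).trans_lt ?_).ne
  refine ENNReal.sum_lt_top.2 (fun g _ => ?_)
  rw [hinv g S hS]
  exact hf.lt_top

open Classical in
/-- number of `a ∈ F` with `x ∈ E a`. -/
noncomputable def auxDeg (F : Finset G) (E : G → Set X) (x : X) : ℕ :=
  (F.filter (fun a => x ∈ E a)).card


theorem auxDeg_le (F : Finset G) (E : G → Set X) (x : X) : auxDeg F E x ≤ F.card := by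
  classical
  exact Finset.card_filter_le _ _

theorem auxDeg_mono (F : Finset G) (E E' : G → Set X) (x y : X)
    (h : ∀ a ∈ F, x ∈ E a → y ∈ E' a) : auxDeg F E x ≤ auxDeg F E' y := by
  classical
  refine Finset.card_le_card ?_
  intro a ha
  rw [Finset.mem_filter] at ha ⊢
  exact ⟨ha.1, h a ha.1 ha.2⟩

theorem auxDeg_pos (F : Finset G) (E : G → Set X) (x : X) (a : G) (ha : a ∈ F)
    (hx : x ∈ E a) : 0 + 1 ≤ auxDeg F E x := by
  classical
  exact Finset.card_pos.2 ⟨a, Finset.mem_filter.2 ⟨ha, hx⟩⟩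

theorem auxDeg_meas (F : Finset G) (E : G → Set X) (hE : ∀ a, MeasurableSet (E a)) :
    Measurable (auxDeg F E) := by
  classical
  have : auxDeg F E = fun x => ∑ a ∈ F, (E a).indicator (fun _ => 1) x := by
    funext x
    simp [auxDeg, Set.indicator_apply]
  rw [this]
  exact Finset.measurable_sum _ (fun a _ => measurable_const.indicator (hE a))

theorem aux_layer (μ : Measure X) (F : Finset G) (E : G → Set X)
    (hE : ∀ a, MeasurableSet (E a)) (hfin : ∀ a, μ (E a) ≠ ⊤) :
    ∑ t ∈ Finset.range F.card, μ.real {x | t + 1 ≤ auxDeg F E x} = ∑ a ∈ F, μ.real (E a) := by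
  classical
  have hm : ∀ t, MeasurableSet {x | t + 1 ≤ auxDeg F E x} := fun t =>
    (auxDeg_meas F E hE) (measurableSet_Ici (a := t + 1))
  have key : ∑ t ∈ Finset.range F.card, μ {x | t + 1 ≤ auxDeg F E x} = ∑ a ∈ F, μ (E a) := by
    have h1 : ∀ t, μ {x | t + 1 ≤ auxDeg F E x} =
        ∫⁻ x, ({x | t + 1 ≤ auxDeg F E x}).indicator (fun _ => (1 : ℝ≥0∞)) x ∂μ := fun t => by
      rw [lintegral_indicator_const (hm t), one_mul]
    have h2 : ∀ a, μ (E a) = ∫⁻ x, (E a).indicator (fun _ => (1 : ℝ≥0∞)) x ∂μ := fun a => by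
      rw [lintegral_indicator_const (hE a), one_mul]
    simp_rw [h1, h2]
    rw [← lintegral_finsetSum _ (fun t _ => measurable_const.indicator (hm t)),
      ← lintegral_finsetSum _ (fun a _ => measurable_const.indicator (hE a))]
    congr 1
    funext x
    have e1 : ∑ a ∈ F, (E a).indicator (fun _ => (1 : ℝ≥0∞)) x = auxDeg F E x := by
      simp [auxDeg, Set.indicator_apply]
    have e2 : ∑ t ∈ Finset.range F.card,
        ({x | t + 1 ≤ auxDeg F E x}).indicator (fun _ => (1 : ℝ≥0∞)) x = auxDeg F E x := by
      simp only [Set.indicator_apply, Set.mem_ofPred_eq]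
      rw [Finset.sum_boole]
      congr 1
      have : (Finset.range F.card).filter (fun t => t + 1 ≤ auxDeg F E x)
          = Finset.range (auxDeg F E x) := by
        ext t
        have := auxDeg_le F E x
        simp only [Finset.mem_filter, Finset.mem_range]
        omega
      rw [this, Finset.card_range]
    rw [e1, e2]
  have hle : ∀ t, μ {x | t + 1 ≤ auxDeg F E x} ≠ ⊤ := by
    intro t
    refine ne_top_of_le_ne_top (b := ∑ a ∈ F, μ (E a)) (ENNReal.sum_lt_top.2
      (fun a _ => (hfin a).lt_top)).ne ?_
    by_cases ht : t < F.card
    · rw [← key]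
      exact Finset.single_le_sum (f := fun t => μ {x | t + 1 ≤ auxDeg F E x})
        (fun _ _ => zero_le) (Finset.mem_range.2 ht)
    · have : {x | t + 1 ≤ auxDeg F E x} = ∅ := by
        ext x
        have := auxDeg_le F E x
        simp only [Set.mem_ofPred_eq, Set.mem_empty_iff_false, iff_false]
        omega
      rw [this]; simp
  simp only [Measure.real]
  rw [← ENNReal.toReal_sum (fun t _ => hle t), ← ENNReal.toReal_sum (fun a _ => hfin a), key]

theorem aux_core (μ : Measure X) (hmeas : ∀ g : G, Measurable (fun x : X => g • x))
    (hinv : ∀ (g : G) (S : Set X), MeasurableSet S → μ (g • S) = μ S)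
    (F : Finset G) (P Q N S W : Set X) (hP : MeasurableSet P) (hQ : MeasurableSet Q)
    (hN : MeasurableSet N) (hPf : μ P ≠ ⊤)
    (hS : S = (F : Set G) • P \ Q)
    (hW : W = (F : Set G) • S \ ((F : Set G) • Q ∪ N))
    (C δ : ℝ) (hC : 0 < C) (hδ : 0 ≤ δ)
    (hp : ∀ T ⊆ S, MeasurableSet T → μ.real T ≤ C⁻¹ * μ.real (W ∩ (F : Set G) • T) + δ)
    (hq : ∀ T ⊆ S, MeasurableSet T → μ.real T ≤ C * μ.real (P ∩ {u | ∃ a ∈ F, a • u ∈ T}) + δ) :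
    C⁻¹ * μ.real W ≤ μ.real S + (F.card + C⁻¹ * F.card) * δ := by
  classical
  have hSm : MeasurableSet S := hS ▸ (aux_meas_set hmeas F hP).diff hQ
  have hWm : MeasurableSet W := hW ▸ (aux_meas_set hmeas F hSm).diff
    ((aux_meas_set hmeas F hQ).union hN)
  have hSf : μ S ≠ ⊤ := measure_ne_top_of_subset (hS ▸ Set.sdiff_subset)
    (aux_fin_set μ hinv F hP hPf)
  have hWf : μ W ≠ ⊤ := measure_ne_top_of_subset (hW ▸ Set.sdiff_subset)
    (aux_fin_set μ hinv F hSm hSf)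
  -- four families
  let E1 : G → Set X := fun a => S ∩ a • P
  let E2 : G → Set X := fun a => P ∩ a⁻¹ • S
  let E3 : G → Set X := fun a => W ∩ a • S
  let E4 : G → Set X := fun a => S ∩ a⁻¹ • W
  have m1 : ∀ a, MeasurableSet (E1 a) := fun a => hSm.inter (aux_meas_smul hmeas _ hP)
  have m2 : ∀ a, MeasurableSet (E2 a) := fun a => hP.inter (aux_meas_smul hmeas _ hSm)
  have m3 : ∀ a, MeasurableSet (E3 a) := fun a => hWm.inter (aux_meas_smul hmeas _ hSm)
  have m4 : ∀ a, MeasurableSet (E4 a) := fun a => hSm.inter (aux_meas_smul hmeas _ hWm)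
  have f1 : ∀ a, μ (E1 a) ≠ ⊤ := fun a => measure_ne_top_of_subset Set.inter_subset_left hSf
  have f2 : ∀ a, μ (E2 a) ≠ ⊤ := fun a => measure_ne_top_of_subset Set.inter_subset_left hPf
  have f3 : ∀ a, μ (E3 a) ≠ ⊤ := fun a => measure_ne_top_of_subset Set.inter_subset_left hWf
  have f4 : ∀ a, μ (E4 a) ≠ ⊤ := fun a => measure_ne_top_of_subset Set.inter_subset_left hSf
  have l1 := aux_layer μ F E1 m1 f1
  have l2 := aux_layer μ F E2 m2 f2
  have l3 := aux_layer μ F E3 m3 f3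
  have l4 := aux_layer μ F E4 m4 f4
  have e12 : ∀ a, μ.real (E1 a) = μ.real (E2 a) := by
    intro a
    have : E1 a = a • E2 a := by
      simp only [E1, E2, Set.smul_set_inter, smul_inv_smul, Set.inter_comm]
    rw [Measure.real, Measure.real, this, hinv a _ (m2 a)]
  have e34 : ∀ a, μ.real (E3 a) = μ.real (E4 a) := by
    intro a
    have : E3 a = a • E4 a := by
      simp only [E3, E4, Set.smul_set_inter, smul_inv_smul, Set.inter_comm]
    rw [Measure.real, Measure.real, this, hinv a _ (m4 a)]
  have s12 : ∑ a ∈ F, μ.real (E1 a) = ∑ a ∈ F, μ.real (E2 a) :=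
    Finset.sum_congr rfl (fun a _ => e12 a)
  have s34 : ∑ a ∈ F, μ.real (E3 a) = ∑ a ∈ F, μ.real (E4 a) :=
    Finset.sum_congr rfl (fun a _ => e34 a)
  -- supports
  have sub : ∀ (E : G → Set X) (Y : Set X), (∀ a, E a ⊆ Y) → ∀ t,
      {x | t + 1 ≤ auxDeg F E x} ⊆ Y := by
    intro E Y hE t x hx
    have hx' : 0 < auxDeg F E x := by
      have : t + 1 ≤ auxDeg F E x := hx
      omega
    obtain ⟨a, ha⟩ := Finset.card_pos.1 hx'
    exact hE a (Finset.mem_filter.1 ha).2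
  -- the exchange property
  have exch : ∀ u ∈ P, ∀ a ∈ F, ∀ b ∈ F, b • a • u ∈ W → b • u ∈ S := by
    intro u hu a ha b hb hw
    rw [hS]
    refine ⟨Set.smul_mem_smul hb hu, fun hbu => ?_⟩
    rw [hW] at hw
    apply hw.2
    left
    rw [smul_comm]
    exact Set.smul_mem_smul ha hbu
  have p : ∀ t, μ.real {x | t + 1 ≤ auxDeg F E1 x} ≤
      C⁻¹ * μ.real {x | t + 1 ≤ auxDeg F E3 x} + δ := by
    intro t
    refine (hp _ (sub E1 S (fun a => Set.inter_subset_left) t)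
      (auxDeg_meas F E1 m1 (measurableSet_Ici (a := t + 1)))).trans ?_
    have : μ.real (W ∩ (F : Set G) • {x | t + 1 ≤ auxDeg F E1 x}) ≤
        μ.real {x | t + 1 ≤ auxDeg F E3 x} := by
      refine measureReal_mono ?_ (measure_ne_top_of_subset
        (sub E3 W (fun a => Set.inter_subset_left) t) hWf)
      rintro w ⟨hw, hw'⟩
      obtain ⟨b, hb, v, hv, rfl⟩ := Set.mem_smul.1 hw'
      refine le_trans (show t + 1 ≤ auxDeg F E1 v from hv) ?_
      refine auxDeg_mono _ _ _ _ _ ?_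
      rintro a haF ⟨hvS, u, hu, rfl⟩
      exact ⟨hw, b • u, exch u hu a haF b hb hw, smul_comm _ _ _⟩
    gcongr
  have q : ∀ t, μ.real {x | t + 1 ≤ auxDeg F E4 x} ≤
      C * μ.real {x | t + 1 ≤ auxDeg F E2 x} + δ := by
    intro t
    refine (hq _ (sub E4 S (fun a => Set.inter_subset_left) t)
      (auxDeg_meas F E4 m4 (measurableSet_Ici (a := t + 1)))).trans ?_
    have : μ.real (P ∩ {u | ∃ a ∈ F, a • u ∈ {x | t + 1 ≤ auxDeg F E4 x}}) ≤
        μ.real {x | t + 1 ≤ auxDeg F E2 x} := by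
      refine measureReal_mono ?_ (measure_ne_top_of_subset
        (sub E2 P (fun a => Set.inter_subset_left) t) hPf)
      rintro u ⟨hu, a, ha, hv⟩
      refine le_trans (show t + 1 ≤ auxDeg F E4 (a • u) from hv) ?_
      refine auxDeg_mono _ _ _ _ _ ?_
      intro b hbF hb
      refine ⟨hu, ?_⟩
      have h2 : b • a • u ∈ W := Set.mem_inv_smul_set_iff.1 hb.2
      exact Set.mem_inv_smul_set_iff.2 (exch u hu a ha b hbF h2)
    gcongr
  rcases Nat.eq_zero_or_pos F.card with h0 | hpos
  · have hF : F = ∅ := Finset.card_eq_zero.1 h0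
    have : W = ∅ := by rw [hW, hF]; simp
    rw [this, h0]; simp
  -- first layer
  have t1 : S ⊆ {x | 0 + 1 ≤ auxDeg F E1 x} := by
    intro v hv
    have hv' := hv
    rw [hS] at hv'
    obtain ⟨a, ha, u, hu, rfl⟩ := Set.mem_smul.1 hv'.1
    exact auxDeg_pos _ _ _ a ha ⟨hv, Set.smul_mem_smul_set hu⟩
  have t3 : W ⊆ {x | 0 + 1 ≤ auxDeg F E3 x} := by
    intro v hv
    have hv' := hv
    rw [hW] at hv'
    obtain ⟨a, ha, u, hu, rfl⟩ := Set.mem_smul.1 hv'.1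
    exact auxDeg_pos _ _ _ a ha ⟨hv, Set.smul_mem_smul_set hu⟩
  have t1' := (sub E1 S (fun a => Set.inter_subset_left) 0).antisymm t1
  have t3' := (sub E3 W (fun a => Set.inter_subset_left) 0).antisymm t3
  have Q1 : ∑ a ∈ F, μ.real (E3 a) ≤ C * ∑ a ∈ F, μ.real (E1 a) + F.card * δ := by
    rw [s34, s12, ← l4, ← l2, Finset.mul_sum]
    refine (Finset.sum_le_sum (fun t _ => q t)).trans ?_
    rw [Finset.sum_add_distrib]
    simp
  have P1 : C⁻¹ * μ.real W - μ.real S + δ ≤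
      ∑ t ∈ Finset.range F.card, (C⁻¹ * μ.real {x | t + 1 ≤ auxDeg F E3 x}
        - μ.real {x | t + 1 ≤ auxDeg F E1 x} + δ) := by
    have := Finset.single_le_sum (f := fun t => (C⁻¹ * μ.real {x | t + 1 ≤ auxDeg F E3 x}
        - μ.real {x | t + 1 ≤ auxDeg F E1 x} + δ)) (fun t _ => by have := p t; linarith)
        (Finset.mem_range.2 hpos)
    simp only [t1', t3'] at this
    exact this
  rw [Finset.sum_add_distrib, Finset.sum_sub_distrib, ← Finset.mul_sum, l3, l1] at P1
  simp only [Finset.sum_const, Finset.card_range, nsmul_eq_mul] at P1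
  have Q2 : C⁻¹ * ∑ a ∈ F, μ.real (E3 a) ≤ ∑ a ∈ F, μ.real (E1 a) + C⁻¹ * (F.card * δ) := by
    have := mul_le_mul_of_nonneg_left Q1 (inv_pos.2 hC).le
    rwa [mul_add, inv_mul_cancel_left₀ hC.ne'] at this
  nlinarith

end Aux

section Aux2
set_option linter.unusedSectionVars false
variable {G X : Type*} [CommGroup G] [MulAction G X] [MeasurableSpace X]

/-- the set of points reachable at level `i`. -/
def auxLev (A : Set G) (B : Set X) (R : ℕ → Set X) : ℕ → Set X
  | 0 => B
  | i + 1 => A • R i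

/-- weight of the cut determined by `R`. -/
noncomputable def auxCost (μ : Measure X) (A : Set G) (B : Set X) (c : ℝ) (k : ℕ)
    (R : ℕ → Set X) : ℝ :=
  ∑ i ∈ Finset.range (k + 1), c ^ i * μ.real (auxLev A B R i \ R i)

structure AuxAdm (μ : Measure X) (k : ℕ) (R : ℕ → Set X) : Prop where
  meas : ∀ i, MeasurableSet (R i)
  fin : ∀ i, μ (R i) ≠ ⊤
  top : R k = ∅

theorem AuxAdm.update {μ : Measure X} {k : ℕ} {R : ℕ → Set X} (h : AuxAdm μ k R) (i : ℕ)
    (hi : i < k) (Y : Set X) (hY : MeasurableSet Y) (hYf : μ Y ≠ ⊤) :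
    AuxAdm μ k (Function.update R i Y) := by
  refine ⟨fun j => ?_, fun j => ?_, ?_⟩
  · by_cases hj : j = i
    · subst hj; simpa using hY
    · simpa [Function.update_of_ne hj] using h.meas j
  · by_cases hj : j = i
    · subst hj; simpa using hYf
    · simpa [Function.update_of_ne hj] using h.fin j
  · rw [Function.update_of_ne hi.ne']; exact h.top

theorem auxLev_update_ne (A : Set G) (B : Set X) (R : ℕ → Set X) (i j : ℕ) (Y : Set X)
    (h : j ≠ i + 1) : auxLev A B (Function.update R i Y) j = auxLev A B R j := by
  cases j with
  | zero => rfl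
  | succ j =>
    have : j ≠ i := by omega
    simp [auxLev, Function.update_of_ne this]

theorem auxCost_update (μ : Measure X) (A : Set G) (B : Set X) (c : ℝ) (k : ℕ)
    (R : ℕ → Set X) (i : ℕ) (hi : i < k) (Y : Set X) :
    auxCost μ A B c k (Function.update R i Y) - auxCost μ A B c k R =
      c ^ i * (μ.real (auxLev A B R i \ Y) - μ.real (auxLev A B R i \ R i)) +
      c ^ (i + 1) * (μ.real (A • Y \ R (i + 1)) - μ.real (A • R i \ R (i + 1))) := by
  unfold auxCost
  rw [← Finset.sum_sub_distrib]
  rw [Finset.sum_eq_add (a := i) (b := i + 1) (by omega)]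
  · rw [auxLev_update_ne A B R i i Y (by omega)]
    rw [Function.update_self, Function.update_of_ne (show i + 1 ≠ i by omega)]
    simp only [auxLev, Function.update_self]
    ring
  · intro j _ hj
    rw [auxLev_update_ne A B R i j Y hj.2, Function.update_of_ne hj.1]
    ring
  · intro h; exact absurd (Finset.mem_range.2 (by omega)) h
  · intro h; exact absurd (Finset.mem_range.2 (by omega)) h

theorem aux_push (μ : Measure X) (hmeas : ∀ g : G, Measurable (fun x : X => g • x))
    (hinv : ∀ (g : G) (S : Set X), MeasurableSet S → μ (g • S) = μ S)
    (F : Finset G) (B : Set X) (hB : MeasurableSet B) (hBf : μ B ≠ ⊤)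
    (C : ℝ) (hC : 0 < C) (k : ℕ) (R : ℕ → Set X) (hR : AuxAdm μ k R) (ε : ℝ) (hε : 0 ≤ ε)
    (hopt : ∀ R', AuxAdm μ k R' → auxCost μ (F : Set G) B C⁻¹ k R ≤ auxCost μ (F : Set G) B C⁻¹ k R' + ε)
    (i : ℕ) (hi : i + 1 < k) :
    AuxAdm μ k (Function.update R (i + 1) (R (i + 1) ∪ (F : Set G) • R i)) ∧
    auxCost μ (F : Set G) B C⁻¹ k (Function.update R (i + 1) (R (i + 1) ∪ (F : Set G) • R i)) ≤
      auxCost μ (F : Set G) B C⁻¹ k R + (F.card + C⁻¹ * F.card) * ε := by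
  have hAm : ∀ {S : Set X}, MeasurableSet S → MeasurableSet ((F : Set G) • S) :=
    fun h => aux_meas_set hmeas F h
  have hAf : ∀ {S : Set X}, MeasurableSet S → μ S ≠ ⊤ → μ ((F : Set G) • S) ≠ ⊤ :=
    fun h => aux_fin_set μ hinv F h
  have hadm : ∀ T : Set X, MeasurableSet T → μ T ≠ ⊤ →
      AuxAdm μ k (Function.update R (i + 1) (R (i + 1) ∪ T)) := fun T hT hTf =>
    hR.update (i + 1) hi _ ((hR.meas _).union hT) (measure_union_ne_top (hR.fin _) hTf)
  have hPm := hR.meas i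
  have hPf := hR.fin i
  have hQm := hR.meas (i + 1)
  have hQf := hR.fin (i + 1)
  have hNm := hR.meas (i + 2)
  set P := R i with hPdef
  set Q := R (i + 1) with hQdef
  set N := R (i + 2) with hNdef
  obtain ⟨S, hS⟩ : ∃ S, S = (F : Set G) • P \ Q := ⟨_, rfl⟩
  obtain ⟨W, hW⟩ : ∃ W, W = (F : Set G) • S \ ((F : Set G) • Q ∪ N) := ⟨_, rfl⟩
  have hSm : MeasurableSet S := hS ▸ (hAm hPm).diff hQm
  have hSf : μ S ≠ ⊤ := measure_ne_top_of_subset (hS ▸ Set.sdiff_subset) (hAf hPm hPf)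
  have hWf : μ W ≠ ⊤ := measure_ne_top_of_subset (hW ▸ Set.sdiff_subset) (hAf hSm hSf)
  have hCi : 0 < C⁻¹ := inv_pos.2 hC
  -- change of cost when adding T ⊆ S
  have hadd : ∀ T ⊆ S, MeasurableSet T →
      auxCost μ (F : Set G) B C⁻¹ k (Function.update R (i + 1) (Q ∪ T)) - auxCost μ (F : Set G) B C⁻¹ k R ≤
      C⁻¹ ^ (i + 1) * (C⁻¹ * μ.real (W ∩ (F : Set G) • T) - μ.real T) := by
    intro T hT hTm
    rw [auxCost_update μ (F : Set G) B C⁻¹ k R (i + 1) hi]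
    simp only [auxLev, ← hPdef, ← hQdef]
    have h1 : μ.real ((F : Set G) • P \ (Q ∪ T)) = μ.real ((F : Set G) • P \ Q) - μ.real T := by
      rw [← hS, ← Set.sdiff_sdiff, ← hS, measureReal_sdiff hT hTm hSf]
    have h2 : μ.real ((F : Set G) • (Q ∪ T) \ N) ≤
        μ.real ((F : Set G) • Q \ N) + μ.real (W ∩ (F : Set G) • T) := by
      refine (measureReal_mono (s₂ := ((F : Set G) • Q \ N) ∪ (W ∩ (F : Set G) • T)) ?_ ?_).trans
        (measureReal_union_le _ _)
      · rw [Set.smul_union]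
        rintro x ⟨hx, hxN⟩
        by_cases hxQ : x ∈ (F : Set G) • Q
        · exact Or.inl ⟨hxQ, hxN⟩
        · have hxT := hx.resolve_left hxQ
          refine Or.inr ⟨?_, hxT⟩
          rw [hW]
          exact ⟨Set.smul_subset_smul_left hT hxT, fun h => h.elim hxQ hxN⟩
      · exact measure_union_ne_top (measure_ne_top_of_subset Set.sdiff_subset (hAf hQm hQf))
          (measure_ne_top_of_subset Set.inter_subset_left hWf)
    rw [h1]
    have : C⁻¹ ^ (i + 1 + 1) * (μ.real ((F : Set G) • (Q ∪ T) \ N) - μ.real ((F : Set G) • Q \ N))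
        ≤ C⁻¹ ^ (i + 1 + 1) * μ.real (W ∩ (F : Set G) • T) := by
      apply mul_le_mul_of_nonneg_left _ (by positivity)
      linarith
    have e : C⁻¹ ^ (i + 1 + 1) = C⁻¹ ^ (i + 1) * C⁻¹ := pow_succ _ _
    rw [e] at this ⊢
    linarith
  have hpow : C ^ (i + 1) * C⁻¹ ^ (i + 1) = 1 := by
    rw [← mul_pow, mul_inv_cancel₀ hC.ne', one_pow]
  have core := aux_core μ hmeas hinv F P Q N S W hPm hQm hNm hPf hS hW C (C ^ (i + 1) * ε) hC
    (by positivity) ?_ ?_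
  · refine ⟨hadm _ (hAm hPm) (hAf hPm hPf), ?_⟩
    have e : Q ∪ (F : Set G) • P = Q ∪ S := by rw [hS, Set.union_sdiff_self]
    rw [e]
    have h := hadd S subset_rfl hSm
    have hWS : W ∩ (F : Set G) • S = W := Set.inter_eq_left.2 (hW ▸ Set.sdiff_subset)
    rw [hWS] at h
    have : C⁻¹ ^ (i + 1) * (C⁻¹ * μ.real W - μ.real S) ≤
        C⁻¹ ^ (i + 1) * ((F.card + C⁻¹ * F.card) * (C ^ (i + 1) * ε)) :=
      mul_le_mul_of_nonneg_left (by linarith) (by positivity)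
    have e2 : C⁻¹ ^ (i + 1) * ((F.card + C⁻¹ * F.card) * (C ^ (i + 1) * ε)) =
      (F.card + C⁻¹ * F.card) * ε := by
      calc _ = (C ^ (i + 1) * C⁻¹ ^ (i + 1)) * ((F.card + C⁻¹ * F.card) * ε) := by ring
        _ = _ := by rw [hpow, one_mul]
    linarith
  · intro T hT hTm
    have h := hadd T hT hTm
    have h' := hopt _ (hadm T hTm (measure_ne_top_of_subset hT hSf))
    have h2 : -ε ≤ C⁻¹ ^ (i + 1) * (C⁻¹ * μ.real (W ∩ (F : Set G) • T) - μ.real T) := by linarith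
    have h3 := mul_le_mul_of_nonneg_left h2 (show 0 ≤ C ^ (i + 1) by positivity)
    rw [← mul_assoc, hpow] at h3
    linarith
  · intro T hT hTm
    set D := {u | ∃ a ∈ F, a • u ∈ T} with hD
    have hDm : MeasurableSet D := by
      have : D = ⋃ a ∈ F, (fun x => a • x) ⁻¹' T := by ext; simp [hD]
      rw [this]
      exact Finset.measurableSet_biUnion F (fun a _ => hmeas a hTm)
    have h' := hopt _ (hR.update i (by omega) (P \ D) (hPm.diff hDm)
      (measure_ne_top_of_subset Set.sdiff_subset hPf))
    have h := auxCost_update μ (F : Set G) B C⁻¹ k R i (by omega) (P \ D)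
    rw [← hPdef, ← hQdef] at h
    have hLf : μ (auxLev (F : Set G) B R i) ≠ ⊤ := by
      cases i with
      | zero => exact hBf
      | succ i => exact hAf (hR.meas i) (hR.fin i)
    have h1 : μ.real (auxLev (F : Set G) B R i \ (P \ D)) ≤
        μ.real (auxLev (F : Set G) B R i \ P) + μ.real (P ∩ D) := by
      refine (measureReal_mono (s₂ := (auxLev (F : Set G) B R i \ P) ∪ (P ∩ D)) ?_ ?_).trans
        (measureReal_union_le _ _)
      · rintro x ⟨hx, hx'⟩
        by_cases hxP : x ∈ P
        · right
          refine ⟨hxP, ?_⟩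
          by_contra hxD
          exact hx' ⟨hxP, hxD⟩
        · exact Or.inl ⟨hx, hxP⟩
      · exact measure_union_ne_top (measure_ne_top_of_subset Set.sdiff_subset hLf)
          (measure_ne_top_of_subset Set.inter_subset_left hPf)
    have h2 : μ.real ((F : Set G) • (P \ D) \ Q) ≤ μ.real ((F : Set G) • P \ Q) - μ.real T := by
      rw [← hS, ← measureReal_sdiff hT hTm hSf]
      refine measureReal_mono ?_ (measure_ne_top_of_subset Set.sdiff_subset hSf)
      rintro x ⟨hx, hxQ⟩
      obtain ⟨a, ha, u, hu, rfl⟩ := Set.mem_smul.1 hx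
      refine ⟨hS ▸ ⟨Set.smul_mem_smul ha hu.1, hxQ⟩, fun hT' => hu.2 ⟨a, ha, hT'⟩⟩
    have h3 : -ε ≤ C⁻¹ ^ i * μ.real (P ∩ D) - C⁻¹ ^ (i + 1) * μ.real T := by
      have a1 := mul_le_mul_of_nonneg_left (sub_le_iff_le_add'.2 h1)
        (show 0 ≤ C⁻¹ ^ i by positivity)
      have a2 : C⁻¹ ^ (i + 1) * (μ.real ((F : Set G) • (P \ D) \ Q) - μ.real ((F : Set G) • P \ Q))
          ≤ C⁻¹ ^ (i + 1) * (- μ.real T) :=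
        mul_le_mul_of_nonneg_left (by linarith) (by positivity)
      linarith
    have h4 := mul_le_mul_of_nonneg_left h3 (show 0 ≤ C ^ (i + 1) by positivity)
    have e3 : C ^ (i + 1) * C⁻¹ ^ i = C := by
      rw [pow_succ', mul_assoc, ← mul_pow, mul_inv_cancel₀ hC.ne', one_pow, mul_one]
    rw [mul_sub, ← mul_assoc, ← mul_assoc, hpow, e3] at h4
    linarith

theorem auxCost_nonneg (μ : Measure X) (A : Set G) (B : Set X) (c : ℝ) (hc : 0 ≤ c) (k : ℕ)
    (R : ℕ → Set X) : 0 ≤ auxCost μ A B c k R :=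
  Finset.sum_nonneg (fun i _ => by positivity)

theorem aux_iter (μ : Measure X) (hmeas : ∀ g : G, Measurable (fun x : X => g • x))
    (hinv : ∀ (g : G) (S : Set X), MeasurableSet S → μ (g • S) = μ S)
    (F : Finset G) (B : Set X) (hB : MeasurableSet B) (hBf : μ B ≠ ⊤)
    (C : ℝ) (hC : 0 < C) (k : ℕ) (n : ℕ) : n < k → ∀ ε : ℝ, 0 < ε → ∃ R, AuxAdm μ k R ∧
      (∀ R', AuxAdm μ k R' →
        auxCost μ (F : Set G) B C⁻¹ k R ≤ auxCost μ (F : Set G) B C⁻¹ k R' + ε) ∧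
      ∀ i < n, (F : Set G) • R i ⊆ R (i + 1) := by
  induction n with
  | zero =>
    intro _ ε hε
    let Z : Set ℝ := {r | ∃ R, AuxAdm μ k R ∧ r = auxCost μ (F : Set G) B C⁻¹ k R}
    have hne : Z.Nonempty := ⟨_, fun _ => ∅, ⟨by simp, by simp, rfl⟩, rfl⟩
    have hbd : BddBelow Z := ⟨0, by
      rintro r ⟨R, _, rfl⟩
      exact auxCost_nonneg _ _ _ _ (by positivity) _ _⟩
    obtain ⟨r, ⟨R, hR, rfl⟩, hlt⟩ := exists_lt_of_csInf_lt hne (lt_add_of_pos_right (sInf Z) hε)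
    refine ⟨R, hR, fun R' hR' => ?_, by simp⟩
    have := csInf_le hbd ⟨R', hR', rfl⟩
    linarith
  | succ n ih =>
    intro hn ε hε
    have hK : (0 : ℝ) ≤ F.card + C⁻¹ * F.card := by positivity
    set K : ℝ := F.card + C⁻¹ * F.card with hKdef
    obtain ⟨R, hR, hopt, hsub⟩ := ih (by omega) (ε / (1 + K)) (by positivity)
    obtain ⟨h1, h2⟩ := aux_push μ hmeas hinv F B hB hBf C hC k R hR _ (by positivity) hopt n hn
    refine ⟨_, h1, fun R' hR' => ?_, fun i hi => ?_⟩
    · have h3 := hopt R' hR'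
      have e : ε / (1 + K) + K * (ε / (1 + K)) = ε := by
        field_simp
      rw [← hKdef] at h2
      linarith
    · rcases Nat.lt_succ_iff_lt_or_eq.1 hi with h | h
      · rw [Function.update_of_ne (by omega), Function.update_of_ne (by omega)]
        exact hsub i h
      · subst h
        rw [Function.update_self, Function.update_of_ne (by omega)]
        exact Set.subset_union_right

theorem aux_lower (μ : Measure X) (hmeas : ∀ g : G, Measurable (fun x : X => g • x))
    (hinv : ∀ (g : G) (S : Set X), MeasurableSet S → μ (g • S) = μ S)
    (F : Finset G) (B : Set X) (hB : MeasurableSet B) (hBf : μ B ≠ ⊤)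
    (C : ℝ) (hC : 0 < C) (k : ℕ) (hk : 0 < k)
    (hmag : ∀ Z ⊆ B, MeasurableSet Z → C ^ k * μ.real Z ≤ μ.real ((F : Set G) ^ k • Z))
    (R' : ℕ → Set X) (hR' : AuxAdm μ k R') :
    μ.real B ≤ auxCost μ (F : Set G) B C⁻¹ k R' := by
  refine le_of_forall_pos_le_add (fun ε hε => ?_)
  obtain ⟨m, rfl⟩ : ∃ m, k = m + 1 := ⟨k - 1, by omega⟩
  obtain ⟨R, hR, hopt, hsub⟩ := aux_iter μ hmeas hinv F B hB hBf C hC (m + 1) m (by omega) ε hε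
  refine le_trans ?_ (hopt R' hR')
  have hpow : ∀ i ≤ m, (F : Set G) ^ i • R 0 ⊆ R i := by
    intro i
    induction i with
    | zero => intro _; simp
    | succ i ih =>
      intro hi
      rw [pow_succ', mul_smul]
      exact (Set.smul_subset_smul_left (ih (by omega))).trans (hsub i (by omega))
  have hlow : μ.real (B \ R 0) + C⁻¹ ^ (m + 1) * μ.real ((F : Set G) • R m) ≤
      auxCost μ (F : Set G) B C⁻¹ (m + 1) R := by
    unfold auxCost
    rw [Finset.sum_range_succ, Finset.sum_range_succ']
    have : 0 ≤ ∑ i ∈ Finset.range m,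
        C⁻¹ ^ (i + 1) * μ.real (auxLev (F : Set G) B R (i + 1) \ R (i + 1)) :=
      Finset.sum_nonneg (fun i _ => by positivity)
    have e : auxLev (F : Set G) B R (m + 1) \ R (m + 1) = (F : Set G) • R m := by
      rw [hR.top]; simp [auxLev]
    rw [e]
    simp only [pow_zero, one_mul, auxLev] at this ⊢
    linarith
  refine le_trans ?_ hlow
  have h1 := hmag (B ∩ R 0) Set.inter_subset_left (hB.inter (hR.meas 0))
  have h2 : μ.real ((F : Set G) ^ (m + 1) • (B ∩ R 0)) ≤ μ.real ((F : Set G) • R m) := by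
    refine measureReal_mono ?_ (aux_fin_set μ hinv F (hR.meas m) (hR.fin m))
    rw [pow_succ', mul_smul]
    exact Set.smul_subset_smul_left ((Set.smul_subset_smul_left Set.inter_subset_right).trans
      (hpow m le_rfl))
  have h3 : μ.real (B ∩ R 0) ≤ C⁻¹ ^ (m + 1) * μ.real ((F : Set G) • R m) := by
    have := mul_le_mul_of_nonneg_left (h1.trans h2) (show 0 ≤ C⁻¹ ^ (m + 1) by positivity)
    rwa [← mul_assoc, ← mul_pow, inv_mul_cancel₀ hC.ne', one_pow, one_mul] at this
  have h4 := measureReal_inter_add_sdiff (μ := μ) (s := B) (hR.meas 0) hBf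
  linarith

theorem aux_final (μ : Measure X) (hmeas : ∀ g : G, Measurable (fun x : X => g • x))
    (hinv : ∀ (g : G) (S : Set X), MeasurableSet S → μ (g • S) = μ S)
    (F : Finset G) (B : Set X) (hB : MeasurableSet B) (hBf : μ B ≠ ⊤)
    (C : ℝ) (hC : 0 < C) (j k : ℕ) (hj : 0 < j) (hjk : j < k)
    (hmag : ∀ Z ⊆ B, MeasurableSet Z → C ^ k * μ.real Z ≤ μ.real ((F : Set G) ^ k • Z))
    (Z : Set X) (hZB : Z ⊆ B) (hZ : MeasurableSet Z) :
    C ^ j * μ.real Z ≤ μ.real ((F : Set G) ^ j • Z) := by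
  have hZf : μ Z ≠ ⊤ := measure_ne_top_of_subset hZB hBf
  have hpm : ∀ i, MeasurableSet ((F : Set G) ^ i • Z) ∧ μ ((F : Set G) ^ i • Z) ≠ ⊤ := by
    intro i
    induction i with
    | zero => simpa using ⟨hZ, hZf⟩
    | succ i ih =>
      rw [pow_succ', mul_smul]
      exact ⟨aux_meas_set hmeas F ih.1, aux_fin_set μ hinv F ih.1 ih.2⟩
  let R : ℕ → Set X := fun i => if i < j then (F : Set G) ^ i • Z else ∅
  have hR : AuxAdm μ k R := by
    refine ⟨fun i => ?_, fun i => ?_, ?_⟩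
    · by_cases h : i < j
      · simpa [R, h] using (hpm i).1
      · simp [R, h]
    · by_cases h : i < j
      · simpa [R, h] using (hpm i).2
      · simp [R, h]
    · simp [R, hjk.le]
  have h := aux_lower μ hmeas hinv F B hB hBf C hC k (by omega) hmag R hR
  have hc : auxCost μ (F : Set G) B C⁻¹ k R =
      μ.real (B \ Z) + C⁻¹ ^ j * μ.real ((F : Set G) ^ j • Z) := by
    unfold auxCost
    rw [Finset.sum_eq_add (a := 0) (b := j) (by omega)]
    · congr 1
      · simp [auxLev, R, hj]
      · obtain ⟨m, rfl⟩ : ∃ m, j = m + 1 := ⟨j - 1, by omega⟩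
        simp [auxLev, R, pow_succ' (F : Set G), mul_smul]
    · rintro i _ ⟨h0, h1⟩
      obtain ⟨m, rfl⟩ : ∃ m, i = m + 1 := ⟨i - 1, by omega⟩
      have : auxLev (F : Set G) B R (m + 1) \ R (m + 1) = ∅ := by
        rcases lt_or_gt_of_ne h1 with h | h
        · have h' : m < j := by omega
          simp [auxLev, R, h, h', pow_succ' (F : Set G), mul_smul]
        · have h' : ¬ m < j := by omega
          simp [auxLev, R, h']
      rw [this]; simp
    · intro h; exact absurd (Finset.mem_range.2 (by omega)) h
    · intro h; exact absurd (Finset.mem_range.2 (by omega)) h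
  rw [hc, measureReal_sdiff hZB hZ hBf] at h
  have h2 : μ.real Z ≤ C⁻¹ ^ j * μ.real ((F : Set G) ^ j • Z) := by linarith
  have := mul_le_mul_of_nonneg_left h2 (show 0 ≤ C ^ j by positivity)
  rwa [← mul_assoc, ← mul_pow, mul_inv_cancel₀ hC.ne', one_pow, one_mul] at this

end Aux2

/-- Plünnecke inequality for measure preserving actions, finite set of translates:
if a countable abelian group `G` acts on a measure space `(X, 𝓑, μ)` by measure preserving
maps, `A ⊆ G` is finite and `B` is measurable with `0 < μ(B) < ∞`, then for positive
integers `j < k` one has `c(A^k, B)^(1/k) ≤ c(A^j, B)^(1/j)`. -/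
theorem magRatio_plunnecke_of_finite {G X : Type*} [CommGroup G] [Countable G]
    [MulAction G X] [MeasurableSpace X] (μ : Measure X)
    (hmeas : ∀ g : G, Measurable (fun x : X => g • x))
    (hinv : ∀ (g : G) (S : Set X), MeasurableSet S → μ (g • S) = μ S)
    (A : Set G) (hA : A.Finite) (B : Set X) (hB : MeasurableSet B)
    (hB0 : 0 < μ B) (hBfin : μ B < ⊤) (j k : ℕ) (hj : 0 < j) (hjk : j < k) :
    magRatio μ (A ^ k) B ^ (1 / (k : ℝ)) ≤ magRatio μ (A ^ j) B ^ (1 / (j : ℝ)) := by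
  obtain ⟨F, rfl⟩ := hA.exists_finset_coe
  have hk : 0 < k := hj.trans hjk
  have hkR : (0 : ℝ) < k := by exact_mod_cast hk
  have hjR : (0 : ℝ) < j := by exact_mod_cast hj
  have hpf : ∀ i (Z : Set X), MeasurableSet Z → μ Z ≠ ⊤ →
      MeasurableSet ((F : Set G) ^ i • Z) ∧ μ ((F : Set G) ^ i • Z) ≠ ⊤ := by
    intro i Z hZ hZf
    induction i with
    | zero => simpa using ⟨hZ, hZf⟩
    | succ i ih =>
      rw [pow_succ', mul_smul]
      exact ⟨aux_meas_set hmeas F ih.1, aux_fin_set μ hinv F ih.1 ih.2⟩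
  set c := magRatio μ ((F : Set G) ^ k) B with hc
  by_cases hc0 : c = 0
  · rw [hc0, ENNReal.zero_rpow_of_pos (by positivity)]
    exact zero_le
  have hle : ∀ Z ⊆ B, MeasurableSet Z → 0 < μ Z → c ≤ μ ((F : Set G) ^ k • Z) / μ Z :=
    fun Z hZB hZ hZ0 => sInf_le ⟨Z, hZB, hZ, hZ0, rfl⟩
  have hcT : c ≠ ⊤ := ne_top_of_le_ne_top
    (ENNReal.div_ne_top (hpf k B hB hBfin.ne).2 hB0.ne') (hle B subset_rfl hB hB0)
  have hcpos : 0 < c.toReal := ENNReal.toReal_pos hc0 hcT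
  set C : ℝ := c.toReal ^ (1 / (k : ℝ)) with hCdef
  have hC : 0 < C := Real.rpow_pos_of_pos hcpos _
  have hCk : C ^ k = c.toReal := by
    rw [hCdef, one_div, Real.rpow_inv_natCast_pow hcpos.le hk.ne']
  have hmag : ∀ Z ⊆ B, MeasurableSet Z → C ^ k * μ.real Z ≤ μ.real ((F : Set G) ^ k • Z) := by
    intro Z hZB hZ
    have hZf : μ Z ≠ ⊤ := measure_ne_top_of_subset hZB hBfin.ne
    rcases eq_or_ne (μ Z) 0 with h0 | h0
    · simp [Measure.real, h0]
    have h := hle Z hZB hZ (pos_iff_ne_zero.2 h0)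
    rw [ENNReal.le_div_iff_mul_le (Or.inl h0) (Or.inl hZf)] at h
    have := ENNReal.toReal_mono (hpf k Z hZ hZf).2 h
    rw [ENNReal.toReal_mul] at this
    rw [hCk]
    exact this
  have hfin := aux_final μ hmeas hinv F B hB hBfin.ne C hC j k hj hjk hmag
  have hLHS : c ^ (1 / (k : ℝ)) = ENNReal.ofReal C := by
    rw [hCdef, ← ENNReal.ofReal_rpow_of_pos hcpos, ENNReal.ofReal_toReal hcT]
  have hbound : ENNReal.ofReal C ^ j ≤ magRatio μ ((F : Set G) ^ j) B := by
    refine le_sInf ?_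
    rintro r ⟨Z, hZB, hZ, hZ0, rfl⟩
    have hZf : μ Z ≠ ⊤ := measure_ne_top_of_subset hZB hBfin.ne
    rw [ENNReal.le_div_iff_mul_le (Or.inl hZ0.ne') (Or.inl hZf)]
    have h := ENNReal.ofReal_le_ofReal (hfin Z hZB hZ)
    rw [ENNReal.ofReal_mul (by positivity), ENNReal.ofReal_pow hC.le, Measure.real, Measure.real,
      ENNReal.ofReal_toReal hZf, ENNReal.ofReal_toReal (hpf j Z hZ hZf).2] at h
    exact h
  rw [hLHS]
  calc ENNReal.ofReal C = (ENNReal.ofReal C ^ j) ^ (1 / (j : ℝ)) := by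
        rw [← ENNReal.rpow_natCast, ← ENNReal.rpow_mul, mul_one_div_cancel hjR.ne',
          ENNReal.rpow_one]
    _ ≤ _ := ENNReal.rpow_le_rpow hbound (by positivity)
end

section
/- Let G be a countable abelian group acting on a measure space (X, 𝓑, μ), let A ⊆ G be finite, let B ∈ 𝓑 have positive finite measure, and let E ⊆ X be measurable. Then for all positive integers j < k one has c(A^j, B, A^{j-1}E)^{1/j} ≥ c(A^k, B, A^{k-1}E)^{1/k}. -/
open Filter MeasureTheory Pointwise ENNReal

/-- The restricted magnification ratio
`c(A, B, E) = inf { μ(A B' \ E) / μ(B') : B' ⊆ B measurable, μ(B') > 0 }`,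
where `A B' = ⋃_{a ∈ A} a • B'`. -/
noncomputable def magRatioRes {G X : Type*} [SMul G X] [MeasurableSpace X]
    (μ : Measure X) (A : Set G) (B E : Set X) : ℝ≥0∞ :=
  sInf {r : ℝ≥0∞ | ∃ B' : Set X, B' ⊆ B ∧ MeasurableSet B' ∧ 0 < μ B' ∧
    r = μ ((A • B') \ E) / μ B'}

open Classical in
lemma mr_layer {X G : Type*} [MeasurableSpace X] (μ : Measure X) (A : Finset G)
    (P : G → Set X) (hP : ∀ a, MeasurableSet (P a)) :
    ∑ t ∈ Finset.range A.card, μ {x | t + 1 ≤ (A.filter (fun a => x ∈ P a)).card}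
      = ∑ a ∈ A, μ (P a) ∧
    ∀ t, MeasurableSet {x | t ≤ (A.filter (fun a => x ∈ P a)).card} := by
  have hm : Measurable (fun x => (A.filter (fun a => x ∈ P a)).card) := by
    have : (fun x => (A.filter (fun a => x ∈ P a)).card)
        = fun x => ∑ a ∈ A, (P a).indicator (fun _ => (1 : ℕ)) x := by
      funext x
      rw [Finset.card_filter]
      rfl
    rw [this]
    exact Finset.measurable_fun_sum _ (fun a _ => measurable_const.indicator (hP a))
  have hms : ∀ t, MeasurableSet {x | t ≤ (A.filter (fun a => x ∈ P a)).card} := by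
    intro t
    exact hm (measurableSet_Ici (a := t))
  refine ⟨?_, hms⟩
  have h1 : ∀ a ∈ A, μ (P a) = ∫⁻ x, (P a).indicator (fun _ => (1 : ℝ≥0∞)) x ∂μ := by
    intro a _
    rw [lintegral_indicator (hP a)]; simp
  have h2 : ∀ t ∈ Finset.range A.card,
      μ {x | t + 1 ≤ (A.filter (fun a => x ∈ P a)).card}
      = ∫⁻ x, ({x | t + 1 ≤ (A.filter (fun a => x ∈ P a)).card}).indicator
          (fun _ => (1 : ℝ≥0∞)) x ∂μ := by
    intro t _
    rw [lintegral_indicator (hms (t+1))]; simp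
  rw [Finset.sum_congr rfl h1, Finset.sum_congr rfl h2,
    ← lintegral_finsetSum _ (fun t _ => measurable_const.indicator (hms (t+1))),
    ← lintegral_finsetSum _ (fun a _ => measurable_const.indicator (hP a))]
  congr 1
  funext x
  have hc : (A.filter (fun a => x ∈ P a)).card ≤ A.card := Finset.card_filter_le _ _
  have e1 : ∑ a ∈ A, (P a).indicator (fun _ => (1 : ℝ≥0∞)) x
      = ((A.filter (fun a => x ∈ P a)).card : ℝ≥0∞) := by
    rw [Finset.card_filter]
    push_cast
    rfl
  rw [e1]
  simp only [Set.indicator_apply, Set.mem_ofPred_eq]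
  rw [Finset.sum_boole]
  congr 1
  generalize (A.filter (fun a => x ∈ P a)).card = c at hc ⊢
  have : (Finset.range A.card).filter (fun t => t + 1 ≤ c) = Finset.range c := by
    ext t; simp; omega
  rw [this, Finset.card_range]

/-- Level sets of the counting function. -/
def mrLev {X G : Type*} (A : Finset G) (P : G → Set X) (t : ℕ) : Set X :=
  {x | ∃ I : Finset G, I ⊆ A ∧ t ≤ I.card ∧ ∀ a ∈ I, x ∈ P a}

open Classical in
lemma mrLev_eq {X G : Type*} (A : Finset G) (P : G → Set X) (t : ℕ) :
    mrLev A P t = {x | t ≤ (A.filter (fun a => x ∈ P a)).card} := by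
  ext x
  constructor
  · rintro ⟨I, hI, ht, h⟩
    refine le_trans ht (Finset.card_le_card fun a ha => ?_)
    exact Finset.mem_filter.mpr ⟨hI ha, h a ha⟩
  · intro h
    exact ⟨_, Finset.filter_subset _ _, h, fun a ha => (Finset.mem_filter.mp ha).2⟩

lemma mr_layer2 {X G : Type*} [MeasurableSpace X] (μ : Measure X) (A : Finset G)
    (P : G → Set X) (hP : ∀ a, MeasurableSet (P a)) :
    ∑ t ∈ Finset.range A.card, μ (mrLev A P (t + 1)) = ∑ a ∈ A, μ (P a) ∧
    ∀ t, MeasurableSet (mrLev A P t) := by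
  simp only [mrLev_eq]
  exact mr_layer μ A P hP

lemma mrLev_mono {X G : Type*} (A : Finset G) (P P' : G → Set X) (t : ℕ) (x y : X)
    (h : ∀ a ∈ A, x ∈ P a → y ∈ P' a) (hx : x ∈ mrLev A P t) : y ∈ mrLev A P' t := by
  obtain ⟨I, hI, ht, h'⟩ := hx
  exact ⟨I, hI, ht, fun a ha => h a (hI ha) (h' a ha)⟩

lemma mr_local {G X : Type*} [CommGroup G]
    [MulAction G X] [MeasurableSpace X] (μ : Measure X)
    (hmeas : ∀ g : G, Measurable (fun x : X => g • x))
    (hinv : ∀ (g : G) (S : Set X), MeasurableSet S → μ (g • S) = μ S)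
    (A : Finset G) (s F U : Set X) (hs : MeasurableSet s) (hF : MeasurableSet F)
    (hU : MeasurableSet U) (hsfin : μ s ≠ ⊤) (c e1 e2 : ℝ≥0∞)
    (hcomm : ∀ u ∈ F, ∀ a ∈ A, ∀ b ∈ A, a • b • u ∈ U → b • u ∈ s)
    (H1 : ∀ Y, MeasurableSet Y → Y ⊆ s →
      c * μ Y ≤ μ {w | w ∈ U ∧ ∃ a ∈ A, a⁻¹ • w ∈ Y} + e1)
    (H2 : ∀ Y, MeasurableSet Y → Y ⊆ s → μ Y ≤ c * μ {u | u ∈ F ∧ ∃ a ∈ A, a • u ∈ Y} + e2) :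
    c * μ {u | u ∈ F ∧ ∃ a ∈ A, a • u ∈ s} ≤ μ s + A.card * (e1 + e2) := by
  classical
  have pm : ∀ (g : G) (S : Set X), MeasurableSet S → MeasurableSet {x | g • x ∈ S} :=
    fun g S h => hmeas g h
  have inv' : ∀ (a : G) (S T : Set X), MeasurableSet S → MeasurableSet T →
      μ {w | w ∈ T ∧ a⁻¹ • w ∈ S} = μ {v | v ∈ S ∧ a • v ∈ T} := by
    intro a S T hS hT
    rw [← hinv a {v | v ∈ S ∧ a • v ∈ T} (hS.inter (pm a T hT))]
    congr 1
    ext w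
    rw [Set.mem_smul_set_iff_inv_smul_mem]
    simp [and_comm]
  obtain ⟨LY, mY⟩ := mr_layer2 μ A (fun b => {v | v ∈ s ∧ b • v ∈ U})
    (fun b => hs.inter (pm b U hU))
  obtain ⟨LT, mT⟩ := mr_layer2 μ A (fun a => {u | u ∈ F ∧ a • u ∈ s})
    (fun b => hF.inter (pm b s hs))
  obtain ⟨LZ, mZ⟩ := mr_layer2 μ A (fun a => {v | v ∈ s ∧ a⁻¹ • v ∈ F})
    (fun b => hs.inter (pm b⁻¹ F hF))
  obtain ⟨LU, mU⟩ := mr_layer2 μ A (fun a => {w | w ∈ U ∧ a⁻¹ • w ∈ s})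
    (fun b => hU.inter (pm b⁻¹ s hs))
  rw [Finset.sum_congr rfl (fun a _ => inv' a F s hF hs)] at LZ
  rw [Finset.sum_congr rfl (fun a _ => inv' a s U hs hU)] at LU
  have key : ∀ (t : ℕ) (P : G → Set X) (x : X),
      x ∈ mrLev A P (t + 1) → ∃ a ∈ A, x ∈ P a := by
    rintro t P x ⟨I, hI, ht, h⟩
    obtain ⟨a, ha⟩ := Finset.card_pos.mp (by omega : 0 < I.card)
    exact ⟨a, hI ha, h a ha⟩
  set Y : ℕ → Set X := fun t => mrLev A (fun b => {v | v ∈ s ∧ b • v ∈ U}) (t + 1) with hY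
  set T : ℕ → Set X := fun t => mrLev A (fun a => {u | u ∈ F ∧ a • u ∈ s}) (t + 1) with hT
  set Z : ℕ → Set X := fun t => mrLev A (fun a => {v | v ∈ s ∧ a⁻¹ • v ∈ F}) (t + 1) with hZ
  set V : ℕ → Set X := fun t => mrLev A (fun a => {w | w ∈ U ∧ a⁻¹ • w ∈ s}) (t + 1) with hV
  have Ys : ∀ t, Y t ⊆ s := fun t x hx => by
    obtain ⟨a, _, h⟩ := key t (fun b => {v | v ∈ s ∧ b • v ∈ U}) x hx; exact h.1
  have Zs : ∀ t, Z t ⊆ s := fun t x hx => by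
    obtain ⟨a, _, h⟩ := key t (fun a => {v | v ∈ s ∧ a⁻¹ • v ∈ F}) x hx; exact h.1
  have I1 : ∀ t, μ (Y t) ≤ c * μ (T t) + e2 := by
    intro t
    refine (H2 (Y t) (mY (t+1)) (Ys t)).trans ?_
    gcongr
    rintro u ⟨hu, a, ha, hau⟩
    refine mrLev_mono A _ _ _ _ _ ?_ hau
    intro b hb hb'
    refine ⟨hu, hcomm u hu a ha b hb ?_⟩
    rw [smul_comm]; exact hb'.2
  have I2 : ∀ t, c * μ (Z t) ≤ μ (V t) + e1 := by
    intro t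
    refine (H1 (Z t) (mZ (t+1)) (Zs t)).trans ?_
    gcongr
    rintro w ⟨hw, b, hb, hbw⟩
    refine mrLev_mono A _ _ _ _ _ ?_ hbw
    intro a ha ha'
    refine ⟨hw, ?_⟩
    have := hcomm _ ha'.2 a ha b hb (by
      rw [smul_comm b, smul_inv_smul, smul_inv_smul]; exact hw)
    rw [smul_comm b, smul_inv_smul] at this
    exact this
  rcases Nat.eq_zero_or_pos A.card with h0 | hpos
  · have : A = ∅ := Finset.card_eq_zero.mp h0
    subst this
    simp
  obtain ⟨n, hn⟩ : ∃ n, A.card = n + 1 := ⟨A.card - 1, by omega⟩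
  have hT0 : {u | u ∈ F ∧ ∃ a ∈ A, a • u ∈ s} ⊆ T 0 := by
    rintro u ⟨hu, a, ha, hau⟩
    exact ⟨{a}, by simpa using ha, by simp, by simpa using ⟨hu, hau⟩⟩
  have LY' : ∑ t ∈ Finset.range A.card, μ (Y t) = ∑ a ∈ A, μ {v | v ∈ s ∧ a • v ∈ U} := LY
  have LT' : ∑ t ∈ Finset.range A.card, μ (T t) = ∑ a ∈ A, μ {v | v ∈ F ∧ a • v ∈ s} := LT
  have LZ' : ∑ t ∈ Finset.range A.card, μ (Z t) = ∑ a ∈ A, μ {v | v ∈ F ∧ a • v ∈ s} := LZ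
  have LU' : ∑ t ∈ Finset.range A.card, μ (V t) = ∑ a ∈ A, μ {v | v ∈ s ∧ a • v ∈ U} := LU
  have S2 : c * ∑ t ∈ Finset.range A.card, μ (T t)
      ≤ ∑ t ∈ Finset.range A.card, μ (Y t) + A.card * e1 := by
    rw [LT', ← LZ', LY', ← LU', Finset.mul_sum]
    refine (Finset.sum_le_sum (fun t _ => I2 t)).trans ?_
    rw [Finset.sum_add_distrib]; simp
  have S1 : ∑ t ∈ Finset.range n, μ (Y (t+1))
      ≤ c * ∑ t ∈ Finset.range n, μ (T (t+1)) + n * e2 := by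
    rw [Finset.mul_sum]
    refine (Finset.sum_le_sum (fun t _ => I1 (t+1))).trans ?_
    rw [Finset.sum_add_distrib]; simp
  rw [hn, Finset.sum_range_succ', Finset.sum_range_succ'] at S2
  have hfin : ∑ t ∈ Finset.range n, μ (Y (t+1)) ≠ ⊤ :=
    ENNReal.sum_ne_top.mpr fun t _ => ne_top_of_le_ne_top hsfin (measure_mono (Ys _))
  refine (mul_le_mul_right (measure_mono hT0) c).trans ?_
  refine (ENNReal.add_le_add_iff_left hfin).mp ?_
  rw [hn]
  calc ∑ t ∈ Finset.range n, μ (Y (t+1)) + c * μ (T 0)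
      ≤ (c * ∑ t ∈ Finset.range n, μ (T (t+1)) + n * e2) + c * μ (T 0) := by gcongr
    _ = c * (∑ t ∈ Finset.range n, μ (T (t+1)) + μ (T 0)) + n * e2 := by ring
    _ ≤ (∑ t ∈ Finset.range n, μ (Y (t+1)) + μ (Y 0) + ((n + 1 : ℕ) : ℝ≥0∞) * e1)
        + ((n + 1 : ℕ) : ℝ≥0∞) * e2 := by
      gcongr; omega
    _ = ∑ t ∈ Finset.range n, μ (Y (t+1)) + (μ (Y 0) + ((n + 1 : ℕ) : ℝ≥0∞) * (e1 + e2)) := by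
      ring
    _ ≤ _ := by
      gcongr; exact Ys 0

/-- Certified separating families. -/
structure MRCert {G X : Type*} [SMul G X] [MeasurableSpace X]
    (A : Finset G) (h : ℕ) (B Q : Set X) (S F : ℕ → Set X) : Prop where
  mS : ∀ i, MeasurableSet (S i)
  mF : ∀ i, MeasurableSet (F i)
  zero : ∀ x ∈ B, x ∈ F 0 ∨ x ∈ S 0
  step : ∀ i < h, ∀ x ∈ F i, ∀ a ∈ A, a • x ∈ F (i+1) ∨ a • x ∈ S (i+1)
  last : ∀ x ∈ F h, x ∉ Q

/-- Weight of a separating family. -/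
noncomputable def mrW {X : Type*} [MeasurableSpace X] (μ : Measure X) (q : ℝ≥0∞) (h : ℕ)
    (S : ℕ → Set X) : ℝ≥0∞ := ∑ i ∈ Finset.range (h+1), q ^ i * μ (S i)

/-- Modified family. -/
def mrMod {X : Type*} (S : ℕ → Set X) (i i' : ℕ) (Y O : Set X) : ℕ → Set X :=
  fun l => if l = i then S l \ Y else if l = i' then S l ∪ O else S l

lemma measure_diff_add_inter_sub {X : Type*} [MeasurableSpace X] (μ : Measure X) {Y S : Set X}
    (hY : MeasurableSet Y) (hYS : Y ⊆ S) : μ (S \ Y) + μ Y = μ S := by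
  have := measure_sdiff_add_inter (μ := μ) S hY
  rwa [Set.inter_eq_self_of_subset_right hYS] at this

lemma mrW_mod {X : Type*} [MeasurableSpace X] (μ : Measure X) (q : ℝ≥0∞) (h : ℕ)
    (S : ℕ → Set X) (i i' : ℕ) (hi : i ≤ h) (hi' : i' ≤ h) (Y O : Set X)
    (hY : MeasurableSet Y) (hYS : Y ⊆ S i) :
    mrW μ q h (mrMod S i i' Y O) + q ^ i * μ Y ≤ mrW μ q h S + q ^ i' * μ O := by
  unfold mrW
  have e1 : q ^ i * μ Y = ∑ l ∈ Finset.range (h+1), if l = i then q ^ i * μ Y else 0 := by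
    rw [Finset.sum_ite_eq']; simp [Nat.lt_succ_of_le hi]
  have e2 : q ^ i' * μ O = ∑ l ∈ Finset.range (h+1), if l = i' then q ^ i' * μ O else 0 := by
    rw [Finset.sum_ite_eq']; simp [Nat.lt_succ_of_le hi']
  rw [e1, e2, ← Finset.sum_add_distrib, ← Finset.sum_add_distrib]
  refine Finset.sum_le_sum fun l _ => ?_
  unfold mrMod
  by_cases h1 : l = i
  · subst h1
    simp only [if_true]
    rw [← mul_add, measure_diff_add_inter_sub μ hY hYS]
    exact le_self_add
  · by_cases h2 : l = i'
    · subst h2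
      simp only [h1, if_true, if_false, add_zero]
      rw [← mul_add]
      gcongr
      exact measure_union_le _ _
    · simp [h1, h2]

lemma mr_step {G X : Type*} [CommGroup G]
    [MulAction G X] [MeasurableSpace X] (μ : Measure X)
    (hmeas : ∀ g : G, Measurable (fun x : X => g • x))
    (hinv : ∀ (g : G) (S : Set X), MeasurableSet S → μ (g • S) = μ S)
    (A : Finset G) (h : ℕ) (B Q : Set X) (C : ℝ≥0∞) (hC0 : C ≠ 0) (hCt : C ≠ ⊤)
    (m : ℝ≥0∞) (hm : m ≠ ⊤)
    (hmin : ∀ S F, MRCert A h B Q S F → m ≤ mrW μ C⁻¹ h S)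
    (S F : ℕ → Set X) (hc : MRCert A h B Q S F) (d : ℝ≥0∞) (hd : d ≠ ⊤)
    (hw : mrW μ C⁻¹ h S ≤ m + d) (n : ℕ) (hn : n + 1 < h) :
    ∃ S' F', MRCert A h B Q S' F' ∧ mrW μ C⁻¹ h S' ≤ m + (1 + A.card * (C + 1)) * d ∧
      S' (n+1) = ∅ ∧ ∀ i, n + 1 < i → S' i = S i := by
  have pm : ∀ (g : G) (S : Set X), MeasurableSet S → MeasurableSet {x | g • x ∈ S} :=
    fun g S h => hmeas g h
  have hWfin : mrW μ C⁻¹ h S ≠ ⊤ := ne_top_of_le_ne_top (by finiteness) hw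
  have hq0 : C⁻¹ ≠ 0 := by simpa using hCt
  have hqt : C⁻¹ ≠ ⊤ := by simpa using hC0
  have hqC : C⁻¹ * C = 1 := ENNReal.inv_mul_cancel hC0 hCt
  have hsfin : μ (S (n+1)) ≠ ⊤ := by
    intro htop
    apply hWfin
    unfold mrW
    rw [ENNReal.sum_eq_top]
    refine ⟨n+1, by simp; omega, ?_⟩
    rw [htop, ENNReal.mul_top (pow_ne_zero _ hq0)]
  -- going down
  have mIn : ∀ Y, MeasurableSet Y → MeasurableSet {u | u ∈ F n ∧ ∃ a ∈ A, a • u ∈ Y} := by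
    intro Y hY
    have : {u | u ∈ F n ∧ ∃ a ∈ A, a • u ∈ Y} = F n ∩ ⋃ a ∈ A, {u | a • u ∈ Y} := by
      ext u; simp
    rw [this]
    exact (hc.mF n).inter (Finset.measurableSet_biUnion _ fun a _ => pm a Y hY)
  have mOut : ∀ Y, MeasurableSet Y → MeasurableSet {w : X | ∃ a ∈ A, a⁻¹ • w ∈ Y} := by
    intro Y hY
    have : {w : X | ∃ a ∈ A, a⁻¹ • w ∈ Y} = ⋃ a ∈ A, {u | a⁻¹ • u ∈ Y} := by
      ext u; simp
    rw [this]
    exact (Finset.measurableSet_biUnion _ fun a _ => pm a⁻¹ Y hY)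
  have down : ∀ Y, MeasurableSet Y → Y ⊆ S (n+1) →
      MRCert A h B Q (mrMod S (n+1) n Y {u | u ∈ F n ∧ ∃ a ∈ A, a • u ∈ Y})
        (fun l => if l = n then F l \ {u | u ∈ F n ∧ ∃ a ∈ A, a • u ∈ Y} else F l) := by
    intro Y hY hYs
    refine ⟨?_, ?_, ?_, ?_, ?_⟩
    · intro i
      unfold mrMod
      split_ifs
      · exact (hc.mS _).diff hY
      · exact (hc.mS _).union (mIn Y hY)
      · exact hc.mS _
    · intro i
      try dsimp only
      split_ifs
      · exact (hc.mF _).diff (mIn Y hY)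
      · exact hc.mF _
    · intro x hx
      have := hc.zero x hx
      by_cases h0 : 0 = n
      · subst h0
        simp only [mrMod, if_true, Set.mem_sdiff, Set.mem_union, Set.mem_ofPred_eq]
        simp
        grind
      · simpa [mrMod, h0] using this
    · intro i hi x hx a ha
      have hx0 : x ∈ F i := by
        try dsimp only at hx
        split_ifs at hx
        · exact hx.1
        · exact hx
      have := hc.step i hi x hx0 a ha
      by_cases h1 : i = n
      · subst h1
        simp only [if_true, Set.mem_sdiff, Set.mem_ofPred_eq] at hx
        simp only [mrMod, if_true, Set.mem_sdiff]
        simp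
        rcases this with h | h
        · exact Or.inl h
        · exact Or.inr ⟨h, fun hy => hx.2 ⟨hx.1, a, ha, hy⟩⟩
      · have h2 : ¬ (i + 1 = n + 1) := by omega
        by_cases h3 : i + 1 = n
        · simp only [mrMod, h2, h3, if_true, if_false, Set.mem_sdiff, Set.mem_union] at this ⊢
          simp
          grind
        · simpa [mrMod, h1, h3] using this
    · intro x hx
      have h1 : ¬ (h = n) := by omega
      simp only [h1, if_false] at hx
      exact hc.last x hx
  have up : ∀ Y, MeasurableSet Y → Y ⊆ S (n+1) →
      MRCert A h B Q (mrMod S (n+1) (n+2) Y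
          {w | w ∈ (F (n+2) ∪ S (n+2))ᶜ ∧ ∃ a ∈ A, a⁻¹ • w ∈ Y})
        (fun l => if l = n+1 then F l ∪ Y else F l) := by
    intro Y hY hYs
    refine ⟨?_, ?_, ?_, ?_, ?_⟩
    · intro i
      unfold mrMod
      split_ifs
      · exact (hc.mS _).diff hY
      · exact (hc.mS _).union (((hc.mF _).union (hc.mS _)).compl.inter (mOut Y hY))
      · exact hc.mS _
    · intro i
      try dsimp only
      split_ifs
      · exact (hc.mF _).union hY
      · exact hc.mF _
    · intro x hx
      have := hc.zero x hx
      simpa [mrMod] using this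
    · intro i hi x hx a ha
      by_cases h1 : i = n + 1
      · subst h1
        simp only [if_true, Set.mem_union] at hx
        have h2 : ¬ (n + 1 + 1 = n + 1) := by omega
        simp only [mrMod, h2, if_true, if_false, Set.mem_union, Set.mem_ofPred_eq, Set.mem_compl_iff]
        rcases hx with hx | hx
        · have := hc.step _ hi x hx a ha
          tauto
        · have : ∃ b ∈ A, b⁻¹ • a • x ∈ Y := ⟨a, ha, by simpa using hx⟩
          simp only [show n + 1 + 1 = n + 2 from rfl]
          tauto
      · simp only [h1, if_false] at hx
        have := hc.step i hi x hx a ha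
        by_cases h2 : i = n
        · subst h2
          simp only [mrMod, if_true, Set.mem_union, Set.mem_sdiff]
          tauto
        · have h3 : ¬ (i + 1 = n + 1) := by omega
          have h4 : ¬ (i + 1 = n + 2) := by omega
          simpa [mrMod, h1, h2, h4] using this
    · intro x hx
      have h1 : ¬ (h = n+1) := by omega
      simp only [h1, if_false] at hx
      exact hc.last x hx
  have pc : ∀ i, C ^ i * C⁻¹ ^ i = 1 := by
    intro i; rw [← mul_pow, mul_comm, hqC, one_pow]
  have canc : ∀ W a b : ℝ≥0∞, m ≤ W → W + a ≤ mrW μ C⁻¹ h S + b → a ≤ b + d := by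
    intro W a b h1 h2
    refine (ENNReal.add_le_add_iff_left hWfin).mp ?_
    calc mrW μ C⁻¹ h S + a ≤ (W + d) + a := by
          gcongr; exact hw.trans (by gcongr)
      _ = W + a + d := by ring
      _ ≤ mrW μ C⁻¹ h S + b + d := by gcongr
      _ = _ := by ring
  have H1 : ∀ Y, MeasurableSet Y → Y ⊆ S (n+1) →
      C * μ Y ≤ μ {w | w ∈ (F (n+2) ∪ S (n+2))ᶜ ∧ ∃ a ∈ A, a⁻¹ • w ∈ Y} + C ^ (n+2) * d := by
    intro Y hY hYs
    have := canc _ _ _ (hmin _ _ (up Y hY hYs))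
      (mrW_mod μ C⁻¹ h S (n+1) (n+2) (by omega) (by omega) Y _ hY hYs)
    have := mul_le_mul_right this (C ^ (n+2))
    rw [mul_add, ← mul_assoc, ← mul_assoc, pc, one_mul, pow_succ' C (n+1), mul_assoc C, pc,
      mul_one, ← pow_succ'] at this
    exact this
  have H2 : ∀ Y, MeasurableSet Y → Y ⊆ S (n+1) →
      μ Y ≤ C * μ {u | u ∈ F n ∧ ∃ a ∈ A, a • u ∈ Y} + C ^ (n+1) * d := by
    intro Y hY hYs
    have := canc _ _ _ (hmin _ _ (down Y hY hYs))
      (mrW_mod μ C⁻¹ h S (n+1) n (by omega) (by omega) Y _ hY hYs)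
    have := mul_le_mul_right this (C ^ (n+1))
    rw [mul_add, ← mul_assoc, ← mul_assoc, pc, one_mul, pow_succ' C n, mul_assoc C, pc,
      mul_one, ← pow_succ'] at this
    exact this
  have L := mr_local μ hmeas hinv A (S (n+1)) (F n) (F (n+2) ∪ S (n+2))ᶜ (hc.mS _) (hc.mF _)
    ((hc.mF _).union (hc.mS _)).compl hsfin C (C ^ (n+2) * d) (C ^ (n+1) * d) (by
      intro u hu a ha b hb hab
      rcases hc.step n (by omega) u hu b hb with h1 | h1
      · exact absurd (hc.step (n+1) (by omega) _ h1 a ha) (by simpa using hab)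
      · exact h1) H1 H2
  refine ⟨_, _, down (S (n+1)) (hc.mS _) subset_rfl, ?_, ?_, ?_⟩
  · have := mrW_mod μ C⁻¹ h S (n+1) n (by omega) (by omega) (S (n+1))
      {u | u ∈ F n ∧ ∃ a ∈ A, a • u ∈ S (n+1)} (hc.mS _) subset_rfl
    refine (ENNReal.add_le_add_iff_right (a := C⁻¹ ^ (n+1) * μ (S (n+1))) (by finiteness)).mp ?_
    refine this.trans ?_
    have e : C⁻¹ ^ n = C⁻¹ ^ (n+1) * C := by rw [pow_succ, mul_assoc, hqC, mul_one]
    have pc' : C⁻¹ ^ (n+1) * C ^ (n+1) = 1 := by rw [mul_comm, pc]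
    rw [e, mul_assoc]
    calc _ ≤ (m + d) + C⁻¹ ^ (n+1) *
          (μ (S (n+1)) + A.card * (C ^ (n+2) * d + C ^ (n+1) * d)) := by gcongr
      _ = m + d + C⁻¹ ^ (n+1) * μ (S (n+1))
          + (C⁻¹ ^ (n+1) * C ^ (n+1)) * (A.card * (C + 1) * d) := by ring
      _ = _ := by rw [pc']; ring
  · simp [mrMod]
  · intro i hi
    simp [mrMod, show i ≠ n + 1 by omega, show i ≠ n by omega]

lemma mr_main {G X : Type*} [CommGroup G]
    [MulAction G X] [MeasurableSpace X] (μ : Measure X)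
    (hmeas : ∀ g : G, Measurable (fun x : X => g • x))
    (hinv : ∀ (g : G) (S : Set X), MeasurableSet S → μ (g • S) = μ S)
    (A : Finset G) (h : ℕ) (hh : 0 < h) (B Q : Set X) (hB : MeasurableSet B) (hBfin : μ B ≠ ⊤)
    (C : ℝ≥0∞) (hC0 : C ≠ 0) (hCt : C ≠ ⊤)
    (hmag : ∀ Z, Z ⊆ B → MeasurableSet Z → C ^ h * μ Z ≤ μ (((A : Set G) ^ h • Z) ∩ Q))
    (S F : ℕ → Set X) (hc : MRCert A h B Q S F) : μ B ≤ mrW μ C⁻¹ h S := by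
  set m : ℝ≥0∞ := sInf {r | ∃ S F, MRCert A h B Q S F ∧ r = mrW μ C⁻¹ h S} with hmdef
  have hmin : ∀ S F, MRCert A h B Q S F → m ≤ mrW μ C⁻¹ h S :=
    fun S F hc => sInf_le ⟨S, F, hc, rfl⟩
  refine le_trans ?_ (hmin S F hc)
  have htriv : MRCert A h B Q (fun i => if i = 0 then B else ∅) (fun _ => ∅) := by
    refine ⟨?_, fun _ => MeasurableSet.empty, ?_, ?_, ?_⟩
    · intro i; try dsimp only
      split_ifs
      · exact hB
      · exact MeasurableSet.empty
    · intro x hx; simpa using hx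
    · simp
    · simp
  have hm : m ≠ ⊤ := by
    refine ne_top_of_le_ne_top ?_ (hmin _ _ htriv)
    unfold mrW
    rw [Finset.sum_range_succ']
    simpa using hBfin
  have hqt : C⁻¹ ≠ ⊤ := by simpa using hC0
  have P : ∀ l, l < h → ∀ d : ℝ≥0∞, d ≠ 0 → d ≠ ⊤ → ∃ S F, MRCert A h B Q S F ∧
      mrW μ C⁻¹ h S ≤ m + d ∧ ∀ i, h - l ≤ i → i < h → S i = ∅ := by
    intro l
    induction l with
    | zero =>
      intro _ d hd0 hdt
      have : m < m + d := ENNReal.lt_add_right hm hd0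
      obtain ⟨r, ⟨S, F, hc, rfl⟩, hr⟩ := sInf_lt_iff.mp this
      exact ⟨S, F, hc, hr.le, by intro i h1 h2; omega⟩
    | succ l ih =>
      intro hl d hd0 hdt
      set K : ℝ≥0∞ := 1 + A.card * (C + 1) with hK
      have hK0 : K ≠ 0 := by rw [hK]; simp
      have hKt : K ≠ ⊤ := by rw [hK]; finiteness
      have hdK : d / K ≠ ⊤ := ENNReal.div_ne_top hdt hK0
      obtain ⟨S, F, hc, hw, hS⟩ := ih (by omega) (d / K) (ENNReal.div_ne_zero.mpr ⟨hd0, hKt⟩) hdK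
      obtain ⟨n, hn⟩ : ∃ n, h - (l+1) = n + 1 := ⟨h - (l+1) - 1, by omega⟩
      obtain ⟨S', F', hc', hw', h0, h1⟩ := mr_step μ hmeas hinv A h B Q C hC0 hCt m hm hmin S F hc
        (d / K) hdK hw n (by omega)
      refine ⟨S', F', hc', ?_, ?_⟩
      · rwa [← hK, ENNReal.mul_div_cancel hK0 hKt] at hw'
      · intro i hi hih
        by_cases e : i = n + 1
        · rw [e, h0]
        · rw [h1 i (by omega)]; exact hS i (by omega) hih
  refine ENNReal.le_of_forall_pos_le_add ?_
  intro e he _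
  obtain ⟨S, F, hc, hw, hS⟩ := P (h-1) (by omega) e (by simpa using he.ne') (by simp)
  refine le_trans ?_ hw
  have hFi : ∀ i, i < h → (A : Set G) ^ i • (B \ S 0) ⊆ F i := by
    intro i
    induction i with
    | zero =>
      intro _ x hx
      rw [pow_zero, one_smul] at hx
      exact (hc.zero x hx.1).resolve_right hx.2
    | succ i ih =>
      intro hi x hx
      rw [pow_succ', mul_smul] at hx
      obtain ⟨a, ha, y, hy, rfl⟩ := hx
      have := hc.step i (by omega) y (ih (by omega) hy) a ha
      rw [hS (i+1) (by omega) hi] at this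
      simpa using this
  have hlast : ((A : Set G) ^ h • (B \ S 0)) ∩ Q ⊆ S h := by
    rintro x ⟨hx, hxQ⟩
    obtain ⟨n, rfl⟩ : ∃ n, h = n + 1 := ⟨h-1, by omega⟩
    rw [pow_succ', mul_smul] at hx
    obtain ⟨a, ha, y, hy, rfl⟩ := hx
    rcases hc.step n (by omega) y (hFi n (by omega) hy) a ha with h1 | h1
    · exact absurd hxQ (hc.last _ h1)
    · exact h1
  have hpc : C⁻¹ ^ h * C ^ h = 1 := by
    rw [← mul_pow, ENNReal.inv_mul_cancel hC0 hCt, one_pow]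
  have hmg := hmag (B \ S 0) Set.sdiff_subset (hB.diff (hc.mS 0))
  calc μ B ≤ μ (S 0) + μ (B \ S 0) := by
        rw [add_comm]
        refine (measure_mono ?_).trans (measure_union_le _ _)
        intro x hx; by_cases h : x ∈ S 0 <;> simp [h, hx]
    _ = μ (S 0) + C⁻¹ ^ h * (C ^ h * μ (B \ S 0)) := by rw [← mul_assoc, hpc, one_mul]
    _ ≤ μ (S 0) + C⁻¹ ^ h * μ (S h) := by
        gcongr; exact hmg.trans (measure_mono hlast)
    _ ≤ _ := by
        unfold mrW
        rw [Finset.sum_range_succ]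
        gcongr
        have := Finset.single_le_sum (f := fun i => C⁻¹ ^ i * μ (S i)) (s := Finset.range h)
          (fun _ _ => zero_le) (Finset.mem_range.mpr hh)
        simpa using this

lemma mr_smul_meas {G X : Type*} [CommGroup G] [Countable G]
    [MulAction G X] [MeasurableSpace X]
    (hmeas : ∀ g : G, Measurable (fun x : X => g • x)) (A : Set G) (S : Set X)
    (hS : MeasurableSet S) : MeasurableSet (A • S) := by
  rw [← Set.iUnion_smul_set]
  refine MeasurableSet.biUnion (Set.to_countable A) fun a _ => ?_
  rw [← Set.preimage_smul_inv]
  exact hmeas a⁻¹ hS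

/-- Restricted Plünnecke inequality for measure preserving actions: if a countable abelian
group `G` acts on a measure space `(X, 𝓑, μ)` by measure preserving maps, `A ⊆ G` is finite,
`B` is measurable with `0 < μ(B) < ∞` and `E ⊆ X` is measurable, then for positive integers
`j < k` one has `c(A^j, B, A^(j-1) E)^(1/j) ≥ c(A^k, B, A^(k-1) E)^(1/k)`. -/
theorem magRatioRes_plunnecke_of_finite {G X : Type*} [CommGroup G] [Countable G]
    [MulAction G X] [MeasurableSpace X] (μ : Measure X)
    (hmeas : ∀ g : G, Measurable (fun x : X => g • x))
    (hinv : ∀ (g : G) (S : Set X), MeasurableSet S → μ (g • S) = μ S)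
    (A : Set G) (hA : A.Finite) (B : Set X) (hB : MeasurableSet B)
    (hB0 : 0 < μ B) (hBfin : μ B < ⊤) (E : Set X) (hE : MeasurableSet E)
    (j k : ℕ) (hj : 0 < j) (hjk : j < k) :
    magRatioRes μ (A ^ j) B ((A ^ (j - 1)) • E) ^ (1 / (j : ℝ)) ≥
      magRatioRes μ (A ^ k) B ((A ^ (k - 1)) • E) ^ (1 / (k : ℝ)) := by
  have hmS := mr_smul_meas (G := G) (X := X) hmeas
  set ck := magRatioRes μ (A ^ k) B ((A ^ (k - 1)) • E) with hck
  have hk : 0 < k := by omega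
  have hk' : (0:ℝ) < 1 / (k:ℝ) := by positivity
  have hj' : (0:ℝ) < 1 / (j:ℝ) := by positivity
  rcases eq_or_ne ck 0 with h0 | h0
  · rw [h0, ENNReal.zero_rpow_of_pos hk']; exact zero_le
  have hAk : (A ^ k).Finite := by
    clear_value ck
    clear hck hk hk' hjk h0
    induction k with
    | zero => simp
    | succ n ih => rw [pow_succ]; exact Set.Finite.mul ih hA
  have hfin : μ (A ^ k • B) ≠ ⊤ := by
    rw [← Set.iUnion_smul_set]
    refine (measure_biUnion_lt_top hAk fun a _ => ?_).ne
    rw [hinv a B hB]; exact hBfin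
  have hmag : ∀ Z, Z ⊆ B → MeasurableSet Z → ck * μ Z ≤ μ ((A ^ k • Z) ∩ (A ^ (k-1) • E)ᶜ) := by
    intro Z hZB hZ
    rcases eq_or_ne (μ Z) 0 with hz | hz
    · simp [hz]
    have : ck ≤ μ ((A ^ k • Z) \ (A ^ (k-1) • E)) / μ Z :=
      sInf_le ⟨Z, hZB, hZ, pos_iff_ne_zero.mpr hz, rfl⟩
    rw [← Set.sdiff_eq]
    exact ENNReal.mul_le_of_le_div this
  have hct : ck ≠ ⊤ := by
    intro ht
    have := hmag B subset_rfl hB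
    rw [ht, ENNReal.top_mul hB0.ne'] at this
    exact hfin (top_le_iff.mp (this.trans (measure_mono Set.inter_subset_left)))
  set C := ck ^ (1 / (k:ℝ)) with hC
  have hCk : C ^ k = ck := by
    rw [hC, ← ENNReal.rpow_natCast, ← ENNReal.rpow_mul, one_div,
      inv_mul_cancel₀ (by positivity), ENNReal.rpow_one]
  have hC0 : C ≠ 0 := by
    intro h; rw [h, zero_pow hk.ne'] at hCk; exact h0 hCk.symm
  have hCt : C ≠ ⊤ := by
    intro h; rw [h, ENNReal.top_pow hk.ne'] at hCk; exact hct hCk.symm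
  suffices hs : C ^ j ≤ magRatioRes μ (A ^ j) B ((A ^ (j - 1)) • E) by
    have h2 := ENNReal.rpow_le_rpow hs hj'.le
    rw [← ENNReal.rpow_natCast, ← ENNReal.rpow_mul, mul_one_div_cancel (by positivity),
      ENNReal.rpow_one] at h2
    exact h2
  refine le_sInf ?_
  rintro r ⟨Z, hZB, hZ, hZ0, rfl⟩
  have hZt : μ Z ≠ ⊤ := ne_top_of_le_ne_top hBfin.ne (measure_mono hZB)
  have hcA : ((hA.toFinset : Finset G) : Set G) = A := hA.coe_toFinset
  have cert : MRCert hA.toFinset k B (A ^ (k-1) • E)ᶜ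
      (fun i => if i = 0 then B \ Z else if i = j then (A ^ j • Z) \ (A ^ (j-1) • E) else ∅)
      (fun i => if i < j then A ^ i • Z else A ^ (i-1) • E) := by
    refine ⟨?_, ?_, ?_, ?_, ?_⟩
    · intro i; try dsimp only
      split_ifs
      · exact hB.diff hZ
      · exact (hmS _ _ hZ).diff (hmS _ _ hE)
      · exact MeasurableSet.empty
    · intro i; try dsimp only
      split_ifs
      · exact hmS _ _ hZ
      · exact hmS _ _ hE
    · intro x hx
      simp only [hj, if_true, pow_zero, one_smul, Set.mem_sdiff]
      tauto
    · intro i hi x hx a ha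
      have ha' : a ∈ A := hA.mem_toFinset.mp ha
      by_cases h1 : i < j
      · simp only [h1, if_true] at hx
        have hax : a • x ∈ A ^ (i+1) • Z := by
          rw [pow_succ', mul_smul]; exact Set.smul_mem_smul ha' hx
        by_cases h2 : i + 1 < j
        · left; simpa only [h2, if_true] using hax
        · have h3 : i + 1 = j := by omega
          have h4 : j ≠ 0 := by omega
          rw [h3] at hax ⊢
          simp only [lt_irrefl, h4, if_true, if_false, Set.mem_sdiff]
          tauto
      · simp only [h1, if_false] at hx
        have h2 : ¬ (i + 1 < j) := by omega
        left
        simp only [h2, if_false]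
        have e : i + 1 - 1 = (i - 1) + 1 := by omega
        rw [e, pow_succ', mul_smul]; exact Set.smul_mem_smul ha' hx
    · intro x hx
      have h1 : ¬ (k < j) := by omega
      simp only [h1, if_false] at hx
      simpa using hx
  have M := mr_main μ hmeas hinv hA.toFinset k hk B _ hB hBfin.ne C hC0 hCt
    (by rw [hCk, hcA]; exact hmag) _ _ cert
  have hw : mrW μ C⁻¹ k
      (fun i => if i = 0 then B \ Z else if i = j then (A ^ j • Z) \ (A ^ (j-1) • E) else ∅)
      ≤ μ (B \ Z) + C⁻¹ ^ j * μ ((A ^ j • Z) \ (A ^ (j-1) • E)) := by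
    unfold mrW
    have e1 : ∀ x : ℝ≥0∞, x = ∑ l ∈ Finset.range (k+1), if l = 0 then x else 0 := by
      intro x; rw [Finset.sum_ite_eq']; simp
    have e2 : ∀ x : ℝ≥0∞, x = ∑ l ∈ Finset.range (k+1), if l = j then x else 0 := by
      intro x; rw [Finset.sum_ite_eq']; simp [show j < k + 1 by omega]
    rw [e1 (μ (B \ Z)), e2 (C⁻¹ ^ j * _), ← Finset.sum_add_distrib]
    refine Finset.sum_le_sum fun l _ => ?_
    by_cases h1 : l = 0
    · subst h1; simp
    · by_cases h2 : l = j
      · subst h2; simp [h1]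
      · simp [h1, h2]
  have M2 := M.trans hw
  rw [← measure_diff_add_inter_sub μ hZ hZB] at M2
  have M3 := (ENNReal.add_le_add_iff_left
    (ne_top_of_le_ne_top hBfin.ne (measure_mono Set.sdiff_subset))).mp M2
  rw [ENNReal.le_div_iff_mul_le (Or.inl hZ0.ne') (Or.inl hZt)]
  calc C ^ j * μ Z ≤ C ^ j * (C⁻¹ ^ j * μ ((A ^ j • Z) \ (A ^ (j-1) • E))) := by gcongr
    _ = _ := by
      rw [← mul_assoc, ← mul_pow, ENNReal.mul_inv_cancel hC0 hCt, one_pow, one_mul]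
end
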